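/- arXiv:1301.4016 — 5 statements merged into one kernel-verified Lean document; each statement's English description precedes it below -/
import Mathlib

section
/- If g_t(x,y) has an absolutely irreducible factor over F_p, then there exists N such that for every n ≥ N there exist α, β ∈ F_{p^n} with α ≠ β and g_t(α,β) = 0. -/
/-- A finite-dimensional subspace of a module meets a decreasing chain of submodules with trivial
intersection trivially from some point on; here for powers of a proper ideal. -/
theorem exists_forall_sum_smul_mem_pow_imp_eq_zero {K A ι : Type*} [Field K] [CommRing A]
    [IsDomain A] [IsNoetherianRing A] [Algebra K A] [Fintype ι] {m : Ideal A} (hm : m ≠ ⊤)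
    {v : ι → A} (hv : LinearIndependent K v) :
    ∃ B : ℕ, ∀ n, B ≤ n → ∀ c : ι → K, ∑ i, c i • v i ∈ m ^ n → c = 0 := by
  let f : ℕ →o (Submodule K (ι → K))ᵒᵈ :=
    { toFun := fun n => OrderDual.toDual
        (((m ^ n).restrictScalars K).comap (Fintype.linearCombination K v))
      monotone' := by
        intro a b hab x hx
        exact Ideal.pow_le_pow_right hab hx }
  obtain ⟨B, hB⟩ := IsArtinian.monotone_stabilizes f
  have hf : ∀ n c, c ∈ OrderDual.ofDual (f n) ↔ ∑ i, c i • v i ∈ m ^ n := fun n c => Iff.rfl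
  refine ⟨B, fun n hn c hc => ?_⟩
  have hcn : ∀ k, B ≤ k → ∑ i, c i • v i ∈ m ^ k := by
    intro k hk
    rwa [← hf, ← hB k hk, hB n hn, hf]
  have h0 : ∑ i, c i • v i ∈ (⨅ k, m ^ k : Ideal A) := by
    rw [Ideal.mem_iInf]
    intro k
    exact Ideal.pow_le_pow_right (le_max_left k B) (hcn _ (le_max_right k B))
  rw [Ideal.iInf_pow_eq_bot_of_isDomain m hm, Ideal.mem_bot] at h0
  funext i
  exact Fintype.linearIndependent_iff.1 hv c h0 i

/-- At a regular rational point of an integral curve, functions that are linearly independent over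
the ground field stay independent over high Frobenius powers. -/
theorem exists_forall_sum_mul_pow_eq_zero_imp {K A ι : Type*} [Field K] (p : ℕ) [Fact p.Prime]
    [CharP K p] [CommRing A] [IsDomain A] [IsNoetherianRing A] [Algebra K A] [Fintype ι]
    (ev : A →ₐ[K] K) {ξ κ : A} (hξ : ξ ≠ 0) (hξ0 : ev ξ = 0) (hκ : ev κ ≠ 0)
    (hdiv : ∀ a, ev a = 0 → ∃ b, κ * a = ξ * b)
    {v : ι → A} (hv : LinearIndependent K v) :
    ∃ B : ℕ, ∀ r, B ≤ p ^ r → ∀ w : ι → A, ∑ i, v i * w i ^ p ^ r = 0 → w = 0 := by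
  set m : Ideal A := RingHom.ker ev with hm
  have hmem : ∀ a, a ∈ m ↔ ev a = 0 := fun a => RingHom.mem_ker
  have hmt : m ≠ ⊤ := RingHom.ker_ne_top _
  have : CharP A p := charP_of_injective_algebraMap (algebraMap K A).injective p
  obtain ⟨B, hB⟩ := exists_forall_sum_smul_mem_pow_imp_eq_zero hmt hv
  refine ⟨B, fun r hr w hw => ?_⟩
  have key : ∀ u : ι → A, ∑ i, v i * u i ^ p ^ r = 0 → ∀ i, ev (u i) = 0 := by
    intro u hu
    have h1 : ∑ i, (ev (u i)) ^ p ^ r • v i ∈ m ^ p ^ r := by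
      have h2 : ∑ i, (ev (u i)) ^ p ^ r • v i
          = - ∑ i, v i * (u i - algebraMap K A (ev (u i))) ^ p ^ r := by
        simp_rw [sub_pow_char_pow, mul_sub, Finset.sum_sub_distrib, hu, zero_sub, neg_neg,
          Algebra.smul_def, map_pow, mul_comm]
      rw [h2]
      refine neg_mem (Ideal.sum_mem _ fun i _ => Ideal.mul_mem_left _ _ (Ideal.pow_mem_pow ?_ _))
      rw [hmem, map_sub, AlgHom.commutes, Algebra.algebraMap_self, RingHom.id_apply, sub_self]
    intro i
    exact eq_zero_of_pow_eq_zero (congrFun (hB _ hr _ h1) i)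
  have step : ∀ n, ∃ u : ι → A, (∀ i, κ ^ n * w i = ξ ^ n * u i) ∧
      ∑ i, v i * u i ^ p ^ r = 0 := by
    intro n
    induction n with
    | zero => exact ⟨w, by simp, hw⟩
    | succ n ih =>
      obtain ⟨u, hu, hs⟩ := ih
      choose u' hu' using fun i => hdiv (u i) (key u hs i)
      refine ⟨u', fun i => ?_, ?_⟩
      · rw [pow_succ, pow_succ, mul_assoc (ξ ^ n), ← hu' i]
        linear_combination κ * hu i
      · have h3 : ξ ^ p ^ r * ∑ i, v i * u' i ^ p ^ r = κ ^ p ^ r * ∑ i, v i * u i ^ p ^ r := by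
          rw [Finset.mul_sum, Finset.mul_sum]
          refine Finset.sum_congr rfl fun i _ => ?_
          have := congrArg (· ^ p ^ r) (hu' i)
          simp only [mul_pow] at this
          linear_combination (-v i) * this
        rw [hs, mul_zero] at h3
        exact (mul_eq_zero.1 h3).resolve_left (pow_ne_zero _ hξ)
  funext i
  have hinf : w i ∈ (⨅ n, m ^ n : Ideal A) := by
    rw [Ideal.mem_iInf]
    intro n
    obtain ⟨u, hu, -⟩ := step n
    have hcop : IsCoprime (Ideal.span {κ}) m := by
      rw [Ideal.isCoprime_iff_exists]
      refine ⟨κ * algebraMap K A (ev κ)⁻¹, Ideal.mul_mem_right _ _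
        (Ideal.mem_span_singleton_self _), 1 - κ * algebraMap K A (ev κ)⁻¹, ?_, by ring⟩
      rw [hmem]
      simp [hκ]
    obtain ⟨a, ha, b, hb, hab⟩ := Ideal.isCoprime_iff_exists.1 (hcop.pow (m := n) (n := n))
    rw [Ideal.span_singleton_pow, Ideal.mem_span_singleton] at ha
    obtain ⟨a', rfl⟩ := ha
    have : w i = ξ ^ n * (a' * u i) + b * w i := by
      linear_combination (-w i) * hab + a' * hu i
    rw [this]
    exact add_mem (Ideal.mul_mem_right _ _ (Ideal.pow_mem_pow ((hmem _).2 hξ0) _))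
      (Ideal.mul_mem_right _ _ hb)
  rwa [Ideal.iInf_pow_eq_bot_of_isDomain m hmt, Ideal.mem_bot] at hinf

open Submodule in
/-- In a commutative algebra in which `y ^ e` and `z ^ e'` reduce to lower powers without
increasing the weighted degree, every monomial reduces to monomials with small exponents of `y` and
`z` without increasing the weighted degree. -/
theorem monomial_mem_span_of_reduction {K A : Type*} [CommRing K] [CommRing A] [Algebra K A]
    {x y z : A} {w e e' : ℕ}
    (hy : y ^ e ∈ span K {u | ∃ a b, a + w * b ≤ w * e ∧ b < e ∧ x ^ a * y ^ b = u})
    (hz : z ^ e' ∈ span K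
      {u | ∃ a b c, a + w * b + w * c ≤ w * e' ∧ c < e' ∧ x ^ a * y ^ b * z ^ c = u}) (a b c : ℕ) :
    x ^ a * y ^ b * z ^ c ∈ span K {u | ∃ i j k, i + w * j + w * k ≤ a + w * b + w * c ∧
      j < e ∧ k < e' ∧ x ^ i * y ^ j * z ^ k = u} := by
  set M : ℕ → Submodule K A := fun n => span K {u | ∃ i j k, i + w * j + w * k ≤ n ∧
      j < e ∧ k < e' ∧ x ^ i * y ^ j * z ^ k = u} with hM
  have mono : ∀ {n n'}, n ≤ n' → M n ≤ M n' := fun h => span_mono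
    fun u ⟨i, j, k, h1, h2⟩ => ⟨i, j, k, h1.trans h, h2⟩
  have closure : ∀ (s : A) (d : ℕ), (∀ i j k, j < e → k < e' →
      x ^ i * y ^ j * z ^ k * s ∈ M (i + w * j + w * k + d)) → ∀ n, ∀ u ∈ M n, u * s ∈ M (n + d) := by
    intro s d hs n u hu
    induction hu using span_induction with
    | mem u hu =>
      obtain ⟨i, j, k, h, hj, hk, rfl⟩ := hu
      exact mono (by omega) (hs i j k hj hk)
    | zero => rw [zero_mul]; exact zero_mem _
    | add u u' _ _ h h' => rw [add_mul]; exact add_mem h h'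
    | smul r u _ h => rw [smul_mul_assoc]; exact smul_mem _ _ h
  have hx1 : ∀ n, ∀ u ∈ M n, u * x ∈ M (n + 1) := closure _ _ fun i j k hj hk =>
    subset_span ⟨i + 1, j, k, by omega, hj, hk, by ring⟩
  have reduce : ∀ (v : A) (S : Set A) (s : A) (N : ℕ), s ∈ span K S → (∀ u ∈ S, v * u ∈ M N) →
      v * s ∈ M N := by
    intro v S s N hs hS
    induction hs using span_induction with
    | mem u hu => exact hS u hu
    | zero => rw [mul_zero]; exact zero_mem _
    | add u u' _ _ h h' => rw [mul_add]; exact add_mem h h'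
    | smul r u _ h => rw [mul_smul_comm]; exact smul_mem _ _ h
  have hy1 : ∀ n, ∀ u ∈ M n, u * y ∈ M (n + w) := by
    refine closure _ _ fun i j k hj hk => ?_
    rcases Nat.lt_or_ge (j + 1) e with h | h
    · exact subset_span ⟨i, j + 1, k, by rw [mul_add]; omega, h, hk, by ring⟩
    · obtain rfl : e = j + 1 := by omega
      have : x ^ i * y ^ j * z ^ k * y = x ^ i * z ^ k * y ^ (j + 1) := by ring
      rw [this]
      refine reduce _ _ _ _ hy ?_
      rintro u ⟨a, b, hab, hb, rfl⟩
      refine subset_span ⟨i + a, b, k, ?_, hb, hk, by ring⟩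
      rw [mul_add] at hab
      omega
  have hxp : ∀ a n, ∀ u ∈ M n, u * x ^ a ∈ M (n + a) := by
    intro a n u hu
    induction a with
    | zero => simpa using hu
    | succ a ih => simpa [pow_succ, mul_assoc, add_assoc] using hx1 _ _ ih
  have hyp : ∀ a n, ∀ u ∈ M n, u * y ^ a ∈ M (n + w * a) := by
    intro a n u hu
    induction a with
    | zero => simpa using hu
    | succ a ih => simpa [pow_succ, mul_assoc, add_assoc, mul_add] using hy1 _ _ ih
  have hz1 : ∀ n, ∀ u ∈ M n, u * z ∈ M (n + w) := by
    refine closure _ _ fun i j k hj hk => ?_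
    rcases Nat.lt_or_ge (k + 1) e' with h | h
    · exact subset_span ⟨i, j, k + 1, by rw [mul_add]; omega, hj, h, by ring⟩
    · obtain rfl : e' = k + 1 := by omega
      have : x ^ i * y ^ j * z ^ k * z = x ^ i * y ^ j * z ^ (k + 1) := by ring
      rw [this]
      refine reduce _ _ _ _ hz ?_
      rintro u ⟨a, b, c, hab, hc, rfl⟩
      have h1 : x ^ i * y ^ j * z ^ c ∈ M (i + w * j + w * c) :=
        subset_span ⟨i, j, c, le_rfl, hj, hc, rfl⟩
      have h2 := hyp b _ _ (hxp a _ _ h1)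
      have h3 : x ^ i * y ^ j * (x ^ a * y ^ b * z ^ c) = x ^ i * y ^ j * z ^ c * x ^ a * y ^ b := by
        ring
      rw [← h3] at h2
      refine mono ?_ h2
      rw [mul_add] at hab
      omega
  have hzp : ∀ a n, ∀ u ∈ M n, u * z ^ a ∈ M (n + w * a) := by
    intro a n u hu
    induction a with
    | zero => simpa using hu
    | succ a ih => simpa [pow_succ, mul_assoc, add_assoc, mul_add] using hz1 _ _ ih
  have hone : (1 : A) ∈ M 0 := by
    rcases Nat.eq_zero_or_pos e' with rfl | he'
    · have : {u : A | ∃ a b c, a + w * b + w * c ≤ w * 0 ∧ c < 0 ∧ x ^ a * y ^ b * z ^ c = u} = ∅ := by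
        ext; simp
      rw [this, span_empty, mem_bot, pow_zero] at hz
      rw [hz]; exact zero_mem _
    · rcases Nat.eq_zero_or_pos e with rfl | he
      · have : {u : A | ∃ a b, a + w * b ≤ w * 0 ∧ b < 0 ∧ x ^ a * y ^ b = u} = ∅ := by
          ext; simp
        rw [this, span_empty, mem_bot, pow_zero] at hy
        rw [hy]; exact zero_mem _
      · exact subset_span ⟨0, 0, 0, by simp, he, he', by simp⟩
  simpa using hzp c _ _ (hyp b _ _ (hxp a _ _ hone))

open Polynomial Submodule in
theorem pow_natDegree_mem_span_of_eval₂_eq_zero {K A : Type*} [CommRing K] [CommRing A]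
    [Algebra K A] {x y : A} {w : ℕ} {H : K[X][X]} (hH : H.Monic)
    (hw : ∀ i, (H.coeff i).natDegree ≤ w)
    (h0 : eval₂ (aeval x : K[X] →ₐ[K] A).toRingHom y H = 0) :
    y ^ H.natDegree ∈ span K {u | ∃ a b, a + w * b ≤ w * H.natDegree ∧ b < H.natDegree ∧
      x ^ a * y ^ b = u} := by
  rw [eval₂_eq_sum_range, Finset.sum_range_succ, coeff_natDegree, hH.leadingCoeff, map_one,
    one_mul] at h0
  rw [eq_neg_of_add_eq_zero_right h0]
  refine neg_mem (sum_mem fun b hb => ?_)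
  rw [Finset.mem_range] at hb
  change aeval x (H.coeff b) * y ^ b ∈ _
  rw [aeval_eq_sum_range, Finset.sum_mul]
  refine sum_mem fun a ha => ?_
  rw [Finset.mem_range] at ha
  rw [smul_mul_assoc]
  refine smul_mem _ _ (subset_span ⟨a, b, ?_, hb, rfl⟩)
  have := hw b
  obtain ⟨d, hd⟩ := Nat.exists_eq_add_of_lt hb
  rw [hd, mul_add, mul_add]
  omega

open Polynomial Submodule in
theorem pow_natDegree_sub_one_mem_span_of_sum_geom_eq_zero {K A : Type*} [CommRing K] [CommRing A]
    [Algebra K A] {x y z : A} {w : ℕ} {H : K[X][X]} (hH : H.Monic) (he : 0 < H.natDegree)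
    (hw : ∀ i, (H.coeff i).natDegree ≤ w)
    (h0 : ∑ i ∈ Finset.range (H.natDegree + 1),
      aeval x (H.coeff i) * ∑ c ∈ Finset.range i, z ^ c * y ^ (i - 1 - c) = 0) :
    z ^ (H.natDegree - 1) ∈ span K {u | ∃ a b c, a + w * b + w * c ≤ w * (H.natDegree - 1) ∧
      c < H.natDegree - 1 ∧ x ^ a * y ^ b * z ^ c = u} := by
  obtain ⟨e, he⟩ : ∃ e, H.natDegree = e + 1 := ⟨H.natDegree - 1, by omega⟩
  rw [Finset.sum_range_succ, coeff_natDegree, hH.leadingCoeff, map_one, one_mul, he,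
    Nat.add_sub_cancel, Finset.sum_range_succ (fun c => z ^ c * y ^ (e - c)), Nat.sub_self,
    pow_zero, mul_one,
    ← add_assoc] at h0
  rw [he, Nat.add_sub_cancel, eq_neg_of_add_eq_zero_right h0]
  refine neg_mem (add_mem (sum_mem fun i hi => ?_) (sum_mem fun c hc => ?_))
  · rw [Finset.mem_range] at hi
    rw [aeval_eq_sum_range, Finset.sum_mul_sum]
    refine sum_mem fun a ha => sum_mem fun c hc => ?_
    rw [Finset.mem_range] at ha hc
    rw [smul_mul_assoc]
    refine smul_mem _ _ (subset_span ⟨a, i - 1 - c, c, ?_, by omega, by ring⟩)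
    have := hw i
    obtain ⟨d, hd⟩ : ∃ d, e = (i - 1 - c) + c + 1 + d := ⟨e - i, by omega⟩
    rw [hd]
    simp only [mul_add]
    omega
  · rw [Finset.mem_range] at hc
    refine subset_span ⟨0, e - c, c, ?_, hc, by ring⟩
    rw [zero_add, ← mul_add, Nat.sub_add_cancel hc.le]

open Submodule in
/-- Existence of an auxiliary function: with more monomials `x ^ (i * P + k) y ^ (j * P) z ^ l` than
the dimension of the space containing them, there is a nontrivial linear relation. -/
theorem exists_sum_monomial_eq_zero {K A : Type*} [Field K] [CommRing A] [Algebra K A]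
    {x y z : A} {w e e' : ℕ}
    (hy : y ^ e ∈ span K {u | ∃ a b, a + w * b ≤ w * e ∧ b < e ∧ x ^ a * y ^ b = u})
    (hz : z ^ e' ∈ span K
      {u | ∃ a b c, a + w * b + w * c ≤ w * e' ∧ c < e' ∧ x ^ a * y ^ b * z ^ c = u})
    (P r s : ℕ) (hcard : (r * P + s + w * e * P + w * e) * (e * e') < r * e * (s * e)) :
    ∃ c : (Fin r × Fin e) → (Fin s × Fin e) → K, c ≠ 0 ∧
      ∑ i, ∑ k, c i k • (x ^ (i.1.1 * P + k.1.1) * y ^ (i.2.1 * P) * z ^ k.2.1) = 0 := by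
  set n := r * P + s + w * e * P + w * e with hn
  let b : Fin n × Fin e × Fin e' → A := fun t => x ^ t.1.1 * y ^ t.2.1.1 * z ^ t.2.2.1
  have hfin : FiniteDimensional K (span K (Set.range b)) :=
    FiniteDimensional.span_of_finite K (Set.finite_range b)
  have hrank : Module.finrank K (span K (Set.range b)) ≤ n * (e * e') := by
    have := finrank_range_le_card (R := K) b
    simpa [Set.finrank] using this
  have hmem : ∀ t : (Fin r × Fin e) × (Fin s × Fin e),
      x ^ (t.1.1.1 * P + t.2.1.1) * y ^ (t.1.2.1 * P) * z ^ t.2.2.1 ∈ span K (Set.range b) := by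
    rintro ⟨⟨i, j⟩, k, l⟩
    refine span_mono ?_ (monomial_mem_span_of_reduction hy hz _ _ _)
    rintro u ⟨a, b', c, h, hb, hc, rfl⟩
    refine ⟨(⟨a, ?_⟩, ⟨b', hb⟩, ⟨c, hc⟩), rfl⟩
    have h1 : i.1 * P ≤ r * P := Nat.mul_le_mul_right _ i.2.le
    have h2 : w * (j.1 * P) ≤ w * e * P := by
      rw [mul_assoc]; exact Nat.mul_le_mul_left _ (Nat.mul_le_mul_right _ j.2.le)
    have h3 : w * l.1 ≤ w * e := Nat.mul_le_mul_left _ l.2.le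
    have h4 := k.2
    dsimp only at h
    omega
  have hdep : ¬ LinearIndependent K (fun t => (⟨_, hmem t⟩ : span K (Set.range b))) := by
    intro hli
    have := hli.fintype_card_le_finrank
    simp only [Fintype.card_prod, Fintype.card_fin] at this
    omega
  rw [Fintype.not_linearIndependent_iff] at hdep
  obtain ⟨g, hg, t, ht⟩ := hdep
  refine ⟨fun i k => g (i, k), fun h => ht (congrFun (congrFun h t.1) t.2), ?_⟩
  have := congrArg Subtype.val hg
  simpa [Fintype.sum_prod_type] using this

open Polynomial in
theorem AdjoinRoot.algHom_mk_eq_evalEval {K : Type*} [CommRing K] {H : K[X][X]}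
    (ev : AdjoinRoot H →ₐ[K] K) (f : K[X][X]) :
    ev (AdjoinRoot.mk H f) =
      f.evalEval (ev (AdjoinRoot.of H X)) (ev (AdjoinRoot.root H)) := by
  have : (ev : AdjoinRoot H →+* K).comp (AdjoinRoot.mk H) =
      evalEvalRingHom (ev (AdjoinRoot.of H X)) (ev (AdjoinRoot.root H)) := by
    refine Polynomial.ringHom_ext' (Polynomial.ringHom_ext (fun a => ?_) ?_) ?_
    · have : ev (algebraMap K _ a) = a := ev.commutes a
      simpa [evalEvalRingHom, AdjoinRoot.algebraMap_eq'] using this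
    · simp [evalEvalRingHom]
    · simp [evalEvalRingHom]
  exact congrArg (fun φ => φ f) this

open Polynomial in
theorem AdjoinRoot.exists_algHom_of_evalEval_eq_zero {K : Type*} [CommRing K] {H : K[X][X]}
    {x y : K} (h : H.evalEval x y = 0) :
    ∃ ev : AdjoinRoot H →ₐ[K] K, ev (AdjoinRoot.of H X) = x ∧ ev (AdjoinRoot.root H) = y := by
  refine ⟨AdjoinRoot.liftAlgHom H (aeval x : K[X] →ₐ[K] K) y ?_, ?_, ?_⟩
  · rw [← h, ← map_evalRingHom_eval, eval_map]
    rfl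
  · simp
  · simp

open Polynomial in
theorem AdjoinRoot.exists_forall_sum_mul_pow_eq_zero_imp {K ι : Type*} [Field K] (p : ℕ)
    [Fact p.Prime] [CharP K p] [Fintype ι] {H : K[X][X]} (hH : H.Monic) (hirr : Irreducible H)
    (ev : AdjoinRoot H →ₐ[K] K)
    (hev : (derivative (H.map (evalRingHom (ev (AdjoinRoot.of H X))))).eval
      (ev (AdjoinRoot.root H)) ≠ 0)
    {v : ι → AdjoinRoot H} (hv : LinearIndependent K v) :
    ∃ B : ℕ, ∀ r, B ≤ p ^ r → ∀ u : ι → AdjoinRoot H, ∑ i, v i * u i ^ p ^ r = 0 → u = 0 := by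
  have := AdjoinRoot.isDomain_of_prime hirr.prime
  set x₀ := ev (AdjoinRoot.of H X) with hx₀
  set y₀ := ev (AdjoinRoot.root H) with hy₀
  have hdecomp : ∀ f : K[X][X], f.evalEval x₀ y₀ = 0 → ∃ f₁ : K[X][X], ∃ u : K[X],
      f = (X - C (C y₀)) * f₁ + C (X - C x₀) * C u := by
    intro f hf
    obtain ⟨u, hu⟩ := dvd_iff_isRoot.2 (show (f.eval (C y₀)).IsRoot x₀ from hf)
    refine ⟨f /ₘ (X - C (C y₀)), u, ?_⟩
    conv_lhs => rw [← modByMonic_add_div f (X - C (C y₀)), modByMonic_X_sub_C_eq_C_eval, hu]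
    rw [C_mul]; ring
  have hH0 : H.evalEval x₀ y₀ = 0 := by
    rw [← AdjoinRoot.algHom_mk_eq_evalEval ev, AdjoinRoot.mk_self, map_zero]
  obtain ⟨k, u, hk⟩ := hdecomp H hH0
  have hrel : AdjoinRoot.mk H (X - C (C y₀)) * AdjoinRoot.mk H k
      = - (AdjoinRoot.mk H (C (X - C x₀)) * AdjoinRoot.mk H (C u)) := by
    rw [eq_neg_iff_add_eq_zero, ← map_mul, ← map_mul, ← map_add, ← hk, AdjoinRoot.mk_self]
  refine _root_.exists_forall_sum_mul_pow_eq_zero_imp p ev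
    (ξ := AdjoinRoot.mk H (C (X - C x₀))) (κ := AdjoinRoot.mk H k) ?_ ?_ ?_ ?_ hv
  · rw [Ne, AdjoinRoot.mk_eq_zero]
    intro hd
    have hne : (X - C x₀ : K[X]) ≠ 0 := X_sub_C_ne_zero x₀
    have h1 := natDegree_le_of_dvd hd (C_ne_zero.2 hne)
    rw [natDegree_C, Nat.le_zero, hH.natDegree_eq_zero] at h1
    exact hirr.not_isUnit (h1 ▸ isUnit_one)
  · rw [AdjoinRoot.algHom_mk_eq_evalEval, evalEval_C]
    simp [hx₀]
  · rw [AdjoinRoot.algHom_mk_eq_evalEval]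
    intro h0
    apply hev
    have h2 : H.map (evalRingHom x₀) = (X - C y₀) * k.map (evalRingHom x₀) := by
      conv_lhs => rw [hk]
      simp
    rw [h2, derivative_mul]
    simpa [map_evalRingHom_eval] using h0
  · intro a ha
    obtain ⟨f, rfl⟩ := AdjoinRoot.mk_surjective a
    rw [AdjoinRoot.algHom_mk_eq_evalEval] at ha
    obtain ⟨f₁, u₁, hf⟩ := hdecomp f ha
    refine ⟨AdjoinRoot.mk H k * AdjoinRoot.mk H (C u₁) - AdjoinRoot.mk H (C u) *
      AdjoinRoot.mk H f₁, ?_⟩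
    rw [hf, map_add, map_mul, map_mul]
    linear_combination (AdjoinRoot.mk H f₁) * hrel

open Polynomial in
theorem AdjoinRoot.linearIndependent_monomial {K : Type*} [Field K] {H : K[X][X]} (hH : H.Monic)
    (r : ℕ) : LinearIndependent K (fun i : Fin r × Fin H.natDegree =>
      AdjoinRoot.of H X ^ i.1.1 * AdjoinRoot.root H ^ i.2.1) := by
  have h1 : LinearIndependent K (fun i : Fin r => (X : K[X]) ^ i.1) := by
    have := (basisMonomials K).linearIndependent.comp (Fin.val : Fin r → ℕ) Fin.val_injective
    simpa [Function.comp_def, ← X_pow_eq_monomial] using this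
  have h2 : LinearIndependent K[X] (fun j : Fin H.natDegree => AdjoinRoot.root H ^ j.1) := by
    have := (AdjoinRoot.powerBasis' hH).basis.linearIndependent
    rw [PowerBasis.coe_basis] at this
    exact this
  have h3 := linearIndependent_smul h1 h2
  simpa [Algebra.smul_def] using h3

open Polynomial in
theorem eq_zero_of_evalEval_eq_zero {K : Type*} [Field K] [IsAlgClosed K] {H f : K[X][X]}
    (hH : H.Monic) {n : ℕ} (hf : f.degree < H.degree) (hn : ∀ j, (f.coeff j).natDegree ≤ n)
    (T : Finset K) (hT : n < T.card)
    (hsep : ∀ x ∈ T, (H.map (evalRingHom x)).Separable)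
    (h : ∀ x ∈ T, ∀ y, H.evalEval x y = 0 → f.evalEval x y = 0) : f = 0 := by
  ext1 j
  rw [coeff_zero]
  refine eq_zero_of_natDegree_lt_card_of_eval_eq_zero' _ T (fun x hx => ?_) ((hn j).trans_lt hT)
  have hz : f.map (evalRingHom x) = 0 := by
    by_contra hne
    have hs := hsep x hx
    have hdvd : H.map (evalRingHom x) ∣ f.map (evalRingHom x) := by
      refine (IsAlgClosed.splits _).dvd_of_roots_le_roots hs.ne_zero
        ((Multiset.le_iff_subset (nodup_roots hs)).2 fun y hy => ?_)
      rw [mem_roots hne, IsRoot, map_evalRingHom_eval]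
      rw [mem_roots hs.ne_zero, IsRoot, map_evalRingHom_eval] at hy
      exact h x hx y hy
    refine hne (eq_zero_of_dvd_of_degree_lt hdvd ?_)
    rw [hH.degree_map]
    exact degree_map_le.trans_lt hf
  have := congrArg (fun g => g.coeff j) hz
  simpa using this

open Polynomial in
theorem AdjoinRoot.eq_zero_of_mem_span {K : Type*} [Field K] [IsAlgClosed K] {H : K[X][X]}
    (hH : H.Monic) {n : ℕ} {G : AdjoinRoot H}
    (hG : G ∈ Submodule.span K {u | ∃ i j, i ≤ n ∧ j < H.natDegree ∧
      AdjoinRoot.of H X ^ i * AdjoinRoot.root H ^ j = u})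
    (T : Finset K) (hT : n < T.card)
    (hsep : ∀ x ∈ T, (H.map (evalRingHom x)).Separable)
    (h : ∀ ev : AdjoinRoot H →ₐ[K] K, ev (AdjoinRoot.of H X) ∈ T → ev G = 0) : G = 0 := by
  obtain ⟨f, hf, hn, rfl⟩ : ∃ f : K[X][X], f.degree < H.degree ∧
      (∀ j, (f.coeff j).natDegree ≤ n) ∧ AdjoinRoot.mk H f = G := by
    clear h
    induction hG using Submodule.span_induction with
    | mem u hu =>
      obtain ⟨i, j, hi, hj, rfl⟩ := hu
      refine ⟨C (X ^ i) * X ^ j, ?_, fun k => ?_, by simp⟩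
      · rw [degree_C_mul_X_pow j (pow_ne_zero _ X_ne_zero), degree_eq_natDegree hH.ne_zero]
        exact_mod_cast hj
      · rw [coeff_C_mul_X_pow]
        split_ifs
        · simpa using hi
        · simp
    | zero =>
      refine ⟨0, ?_, by simp, map_zero _⟩
      rw [degree_zero, bot_lt_iff_ne_bot, Ne, degree_eq_bot]
      exact hH.ne_zero
    | add u u' _ _ ih ih' =>
      obtain ⟨f, hf, hn, rfl⟩ := ih
      obtain ⟨f', hf', hn', rfl⟩ := ih'
      refine ⟨f + f', (degree_add_le _ _).trans_lt (max_lt hf hf'), fun j => ?_, map_add _ _ _⟩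
      rw [coeff_add]
      exact (natDegree_add_le _ _).trans (max_le (hn j) (hn' j))
    | smul a u _ ih =>
      obtain ⟨f, hf, hn, rfl⟩ := ih
      refine ⟨a • f, (degree_smul_le _ _).trans_lt hf, fun j => ?_, ?_⟩
      · rw [coeff_smul]
        exact (natDegree_smul_le _ _).trans (hn j)
      · rw [AdjoinRoot.smul_mk]
  rw [eq_zero_of_evalEval_eq_zero hH hf hn T hT hsep fun x hx y hxy => ?_, map_zero]
  obtain ⟨ev, rfl, rfl⟩ := AdjoinRoot.exists_algHom_of_evalEval_eq_zero hxy
  rw [← AdjoinRoot.algHom_mk_eq_evalEval]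
  exact h ev hx

open Polynomial in
theorem card_roots_toFinset_X_pow_sub_X {K : Type*} [Field K] [IsAlgClosed K] [DecidableEq K]
    (p n : ℕ) [Fact p.Prime] [CharP K p] (hn : n ≠ 0) :
    (X ^ p ^ n - X : K[X]).roots.toFinset.card = p ^ n := by
  have h := nodup_roots (galois_poly_separable (K := K) p (p ^ n) (dvd_pow_self p hn))
  rw [Multiset.toFinset_card_of_nodup h,
    ← (IsAlgClosed.splits (X ^ p ^ n - X : K[X])).natDegree_eq_card_roots,
    FiniteField.X_pow_card_pow_sub_X_natDegree_eq K hn (Fact.out : p.Prime).one_lt]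

open Polynomial in
/-- Weak form of the Weil bound: on an absolutely irreducible plane curve, for every large power
`q = p ^ n` some point `(x, y)` with `x ∈ 𝔽_q` violates the condition that its Frobenius conjugate
lies on the curve and differs from it. -/
theorem exists_frobenius_fixed_fiber_point {K : Type*} [Field K] [IsAlgClosed K] (p : ℕ)
    [Fact p.Prime] [CharP K p] {H : K[X][X]} (hH : H.Monic) (hirr : Irreducible H) (B : Finset K)
    (hB : ∀ x ∉ B, (H.map (evalRingHom x)).Separable) :
    ∃ N : ℕ, ∀ n, N ≤ n → ∃ x ∉ B, x ^ p ^ n = x ∧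
      ∃ y, H.evalEval x y = 0 ∧ (H.evalEval x (y ^ p ^ n) = 0 → y ^ p ^ n = y) := by
  classical
  have hp : 1 < p := (Fact.out : p.Prime).one_lt
  have := AdjoinRoot.isDomain_of_prime hirr.prime
  have : CharP (AdjoinRoot H) p :=
    charP_of_injective_algebraMap (algebraMap K (AdjoinRoot H)).injective p
  set e := H.natDegree with he
  have he0 : 0 < e := by
    rw [Nat.pos_iff_ne_zero, he, Ne, hH.natDegree_eq_zero]
    exact fun h1 => hirr.not_isUnit (h1 ▸ isUnit_one)
  obtain ⟨w, hw⟩ : ∃ w, ∀ i, (H.coeff i).natDegree ≤ w := by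
    refine ⟨(Finset.range (e + 1)).sup fun i => (H.coeff i).natDegree, fun i => ?_⟩
    rcases Nat.lt_or_ge i (e + 1) with h | h
    · exact Finset.le_sup (f := fun i => (H.coeff i).natDegree) (Finset.mem_range.2 h)
    · rw [coeff_eq_zero_of_natDegree_lt (by omega), natDegree_zero]; exact Nat.zero_le _
  obtain ⟨x₁, hx₁⟩ := Infinite.exists_notMem_finset B
  obtain ⟨y₁, hy₁⟩ := IsAlgClosed.exists_root (H.map (evalRingHom x₁)) (by
    rw [hH.degree_map, degree_eq_natDegree hH.ne_zero]
    exact_mod_cast he0.ne')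
  have hroot : H.evalEval x₁ y₁ = 0 := by rw [← map_evalRingHom_eval]; exact hy₁
  obtain ⟨ev, hevx, hevy⟩ := AdjoinRoot.exists_algHom_of_evalEval_eq_zero hroot
  have hev : (derivative (H.map (evalRingHom (ev (AdjoinRoot.of H X))))).eval
      (ev (AdjoinRoot.root H)) ≠ 0 := by
    rw [hevx, hevy]
    have := (hB x₁ hx₁).eval₂_derivative_ne_zero (RingHom.id K) (x := y₁) (by simpa using hy₁)
    simpa using this
  set μ := w * e ^ 3 + w * e + 1 with hμ
  set P := p ^ μ with hP
  have hPμ : μ < P := Nat.lt_pow_self hp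
  set r := e * (1 + w * e) with hr
  set s := P - w * e with hs
  have hcard : (r * P + s + w * e * P + w * e) * (e * (e - 1)) < r * e * (s * e) := by
    have hPs : P = s + w * e := by omega
    have hs' : w * e ^ 3 < s + w * e := by omega
    obtain ⟨d, hd⟩ : ∃ d, e = d + 1 := ⟨e - 1, by omega⟩
    rw [hPs, hr, hd, Nat.add_sub_cancel]
    rw [hd] at hs'
    have h1 : w * (d + 1) * (d * (d + 2)) < s := by nlinarith
    have h2 : (s + w * (d + 1)) * (d * (d + 2)) < s * (d + 1) ^ 2 := by nlinarith
    have h3 := Nat.mul_lt_mul_of_pos_left h2 (show 0 < (1 + w * (d + 1)) * (d + 1) by positivity)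
    nlinarith
  obtain ⟨Bd, hBd⟩ := AdjoinRoot.exists_forall_sum_mul_pow_eq_zero_imp p hH hirr ev hev
    (AdjoinRoot.linearIndependent_monomial hH r)
  refine ⟨μ + (Bd + r + w * e + B.card + 1), fun n hn => ?_⟩
  obtain ⟨ν, rfl⟩ : ∃ ν, n = μ + ν := ⟨n - μ, by omega⟩
  have hν : Bd + r + w * e + B.card + 1 ≤ ν := by omega
  have hνQ : ν < p ^ ν := Nat.lt_pow_self hp
  by_contra! hcon
  set Q := p ^ ν with hQ
  have hq : p ^ (μ + ν) = P * Q := pow_add _ _ _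
  rw [hq] at hcon
  let Z := {t : K × K × K // H.evalEval t.1 t.2.1 = 0 ∧ H.evalEval t.1 t.2.2 = 0 ∧
    t.2.2 - t.2.1 ≠ 0}
  let x : Z → K := fun t => t.1.1
  let y : Z → K := fun t => t.1.2.1
  let z : Z → K := fun t => t.1.2.2
  have haeval : ∀ (f : K[X]) (t : Z), (aeval x f) t = f.eval (x t) := by
    intro f t
    have := aeval_algHom_apply (Pi.evalAlgHom K (fun _ : Z => K) t) x f
    refine this.symm.trans ?_
    rw [coe_aeval_eq_eval]
    rfl
  have hsum : ∀ a b : K, H.evalEval a b =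
      ∑ i ∈ Finset.range (e + 1), (H.coeff i).eval a * b ^ i := by
    intro a b
    rw [← map_evalRingHom_eval, eval_map, eval₂_eq_sum_range]
    rfl
  have hy := pow_natDegree_mem_span_of_eval₂_eq_zero (x := x) (y := y) hH hw (by
    funext t
    rw [eval₂_eq_sum_range, Finset.sum_apply]
    refine Eq.trans (Finset.sum_congr rfl fun i _ => ?_) ((hsum _ _).symm.trans t.2.1)
    exact congrArg (· * y t ^ i) (haeval _ t))
  have hz := pow_natDegree_sub_one_mem_span_of_sum_geom_eq_zero (x := x) (y := y) (z := z) hH he0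
    hw (by
      funext t
      refine (mul_eq_zero.1 ?_).resolve_right t.2.2.2
      have h1 := (hsum _ _).symm.trans t.2.1
      have h2 := (hsum _ _).symm.trans t.2.2.1
      rw [Finset.sum_apply, Finset.sum_mul]
      refine Eq.trans ?_ ((congrArg₂ (· - ·) h2 h1).trans (sub_self 0))
      rw [← Finset.sum_sub_distrib]
      refine Finset.sum_congr rfl fun i _ => ?_
      rw [Pi.mul_apply, haeval, ← mul_sub, ← geom_sum₂_mul, mul_assoc, Finset.sum_apply]
      rfl)
  obtain ⟨c, hc0, hc⟩ := exists_sum_monomial_eq_zero hy hz P r s hcard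
  have hq0 : 0 < P * Q := by positivity
  choose γ hγ using fun i k => IsAlgClosed.exists_pow_nat_eq (c i k) hq0
  set xx := AdjoinRoot.of H X with hxx
  set yy := AdjoinRoot.root H with hyy
  let u : Fin r × Fin e → AdjoinRoot H := fun i => ∑ k, γ i k • (xx ^ k.1.1 * yy ^ k.2.1)
  have huQ : ∀ i, u i ^ Q = ∑ k, γ i k ^ Q • (xx ^ (k.1.1 * Q) * yy ^ (k.2.1 * Q)) := by
    intro i
    simp only [u, hQ]
    rw [sum_pow_char_pow]
    simp only [_root_.smul_pow, mul_pow, ← pow_mul]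
  set G := ∑ i : Fin r × Fin e, (xx ^ i.1.1 * yy ^ i.2.1) * u i ^ Q with hG
  have hyA := pow_natDegree_mem_span_of_eval₂_eq_zero (x := xx) (y := yy) hH hw (by
    have h1 : (aeval xx : K[X] →ₐ[K] AdjoinRoot H).toRingHom = AdjoinRoot.of H :=
      Polynomial.ringHom_ext (fun a => by simp [AdjoinRoot.algebraMap_eq']) (by simp [hxx])
    rw [h1, hyy, AdjoinRoot.eval₂_root])
  have hGmem : G ∈ Submodule.span K {v | ∃ i j, i ≤ r + w * e + (P - 1) * Q ∧
      j < H.natDegree ∧ xx ^ i * yy ^ j = v} := by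
    refine sum_mem fun i _ => ?_
    rw [huQ, Finset.mul_sum]
    refine sum_mem fun k _ => ?_
    rw [mul_smul_comm]
    refine Submodule.smul_mem _ _ ?_
    have h1 := monomial_mem_span_of_reduction (z := 1) (e' := 1) hyA
      (Submodule.subset_span ⟨0, 0, 0, by simp⟩) (i.1.1 + k.1.1 * Q) (i.2.1 + k.2.1 * Q) 0
    have h2 : xx ^ i.1.1 * yy ^ i.2.1 * (xx ^ (k.1.1 * Q) * yy ^ (k.2.1 * Q)) =
        xx ^ (i.1.1 + k.1.1 * Q) * yy ^ (i.2.1 + k.2.1 * Q) * 1 ^ 0 := by ring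
    rw [h2]
    refine Submodule.span_mono ?_ h1
    rintro v ⟨a, b, c, h, hb, -, rfl⟩
    refine ⟨a, b, ?_, hb, by simp⟩
    have h3 : w * i.2.1 ≤ w * e := Nat.mul_le_mul_left _ i.2.2.le
    have h4 : w * k.2.1 ≤ w * e := Nat.mul_le_mul_left _ k.2.2.le
    have h5 : (k.1.1 + w * k.2.1) * Q ≤ (P - 1) * Q :=
      Nat.mul_le_mul_right _ (by have := k.1.2; omega)
    have h6 := i.1.2
    have h7 : w * (i.2.1 + k.2.1 * Q) = w * i.2.1 + w * k.2.1 * Q := by ring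
    rw [add_mul] at h5
    omega
  have hG0 : G = 0 := by
    refine AdjoinRoot.eq_zero_of_mem_span hH hGmem
      ((X ^ p ^ (μ + ν) - X : K[X]).roots.toFinset \ B) ?_ ?_ ?_
    · refine lt_of_lt_of_le ?_ (Finset.le_card_sdiff _ _)
      rw [card_roots_toFinset_X_pow_sub_X p (μ + ν) (by omega), hq]
      have h1 : P * Q = (P - 1) * Q + Q := by
        rw [← Nat.succ_mul, Nat.succ_eq_add_one, Nat.sub_add_cancel (by omega)]
      omega
    · intro x hx
      exact hB x (Finset.mem_sdiff.1 hx).2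
    · intro ev hx
      set x₀ := ev (AdjoinRoot.of H X) with hx₀
      set y₀ := ev (AdjoinRoot.root H) with hy₀
      obtain ⟨hxr, hxB⟩ := Finset.mem_sdiff.1 hx
      have hxq : x₀ ^ (P * Q) = x₀ := by
        rw [Multiset.mem_toFinset, mem_roots'] at hxr
        rw [← hq]
        simpa [sub_eq_zero] using hxr.2
      have hxy : H.evalEval x₀ y₀ = 0 := by
        rw [← AdjoinRoot.algHom_mk_eq_evalEval ev, AdjoinRoot.mk_self, map_zero]
      obtain ⟨h1, h2⟩ := hcon x₀ hxB hxq y₀ hxy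
      have h3 := congrFun hc ⟨(x₀, y₀, y₀ ^ (P * Q)), hxy, h1, sub_ne_zero.2 h2⟩
      refine eq_zero_of_pow_eq_zero (n := P) ?_
      refine Eq.trans ?_ h3
      have hsum₁ : ∀ f : Fin r × Fin e → K, (∑ i, f i) ^ P = ∑ i, f i ^ P :=
        fun f => by rw [hP, sum_pow_char_pow]
      have hsum₂ : ∀ f : Fin s × Fin e → K, (∑ i, f i) ^ P = ∑ i, f i ^ P :=
        fun f => by rw [hP, sum_pow_char_pow]
      rw [hG, map_sum, hsum₁, Finset.sum_apply]
      refine Finset.sum_congr rfl fun i _ => ?_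
      rw [map_mul, huQ, map_sum, mul_pow, hsum₂, Finset.mul_sum,
        Finset.sum_apply]
      refine Finset.sum_congr rfl fun k _ => ?_
      simp only [map_smul, map_mul, map_pow, smul_eq_mul, Pi.smul_apply, Pi.mul_apply, Pi.pow_apply,
        x, y, z, ← hγ]
      have h4 : x₀ ^ (k.1.1 * Q * P) = x₀ ^ k.1.1 := by
        rw [mul_assoc, mul_comm Q P, mul_comm, pow_mul, hxq]
      have h5 : x₀ ^ (i.1.1 * P + k.1.1) = (x₀ ^ i.1.1) ^ P * x₀ ^ (k.1.1 * Q * P) := by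
        rw [h4, pow_add, pow_mul]
      rw [h5]
      ring
  have hu := hBd ν (by omega) u hG0
  apply hc0
  funext i k
  have := Fintype.linearIndependent_iff.1 (AdjoinRoot.linearIndependent_monomial hH s) (γ i)
    (congrFun hu i) k
  rw [← hγ, this, zero_pow hq0.ne']
  rfl

/-- Polynomials in two variables as polynomials in `X 0` over polynomials in `X 1`. -/
noncomputable def bivariateEquiv (K : Type*) [CommRing K] :
    MvPolynomial (Fin 2) K ≃ₐ[K] Polynomial (Polynomial K) :=
  (MvPolynomial.finSuccEquiv K 1).trans
    (Polynomial.mapAlgEquiv (MvPolynomial.uniqueAlgEquiv K (Fin 1)))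

theorem bivariateEquiv_X_zero (K : Type*) [CommRing K] :
    bivariateEquiv K (MvPolynomial.X 0) = Polynomial.X := by
  simp [bivariateEquiv, MvPolynomial.finSuccEquiv_X_zero]

theorem bivariateEquiv_X_one (K : Type*) [CommRing K] :
    bivariateEquiv K (MvPolynomial.X 1) = Polynomial.C Polynomial.X := by
  have := MvPolynomial.finSuccEquiv_X_succ (R := K) (n := 1) (j := 0)
  simp only [Fin.succ_zero_eq_one] at this
  simp [bivariateEquiv, this]

theorem evalEval_bivariateEquiv {K : Type*} [CommRing K] (x y : K) (f : MvPolynomial (Fin 2) K) :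
    (bivariateEquiv K f).evalEval x y = MvPolynomial.eval ![y, x] f := by
  have h : (Polynomial.evalEvalRingHom x y).comp (bivariateEquiv K : _ →+* _) =
      MvPolynomial.eval ![y, x] := by
    apply MvPolynomial.ringHom_ext
    · intro a
      have : bivariateEquiv K (MvPolynomial.C a) = Polynomial.C (Polynomial.C a) :=
        (bivariateEquiv K).commutes a
      simp [this, Polynomial.evalEvalRingHom]
    · intro i
      fin_cases i
      · simp [bivariateEquiv_X_zero, Polynomial.evalEvalRingHom]
      · simp [bivariateEquiv_X_one, Polynomial.evalEvalRingHom]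
  exact RingHom.congr_fun h f

open Polynomial in
theorem separable_of_dvd_sub_C {K : Type*} [Field K] [IsAlgClosed K] {D f : K[X]} {c : K}
    (hf : f ∣ D - C c) (hD : ∀ y, D.eval y = c → (derivative D).eval y ≠ 0) : f.Separable := by
  refine Separable.of_dvd ?_ hf
  refine (isCoprime_iff_aeval_ne_zero_of_isAlgClosed K K _ _).2 fun y => ?_
  by_cases h : D.eval y = c
  · right
    simpa [coe_aeval_eq_eval] using hD y h
  · left
    simpa [coe_aeval_eq_eval, sub_eq_zero] using h

theorem MvPolynomial.eval_map_pow_char_pow {p : ℕ} [Fact p.Prime] {K : Type*} [Field K]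
    [Algebra (ZMod p) K] {σ : Type*} (h : MvPolynomial σ (ZMod p)) (n : ℕ) (v : σ → K) :
    MvPolynomial.eval (fun i => v i ^ p ^ n) (MvPolynomial.map (algebraMap (ZMod p) K) h) =
      MvPolynomial.eval v (MvPolynomial.map (algebraMap (ZMod p) K) h) ^ p ^ n := by
  have : CharP K p := charP_of_injective_algebraMap (algebraMap (ZMod p) K).injective p
  simp only [← iterateFrobenius_def]
  rw [MvPolynomial.eval_map, MvPolynomial.eval_map, MvPolynomial.eval₂_comp_left]
  congr 1
  exact Subsingleton.elim _ _

open Polynomial in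
/-- A factor of `(D(Y) - D(X)) / (Y - X)` has points off the diagonal over every large extension
of the prime field. -/
theorem exists_frobenius_fixed_fiber_point_ne {K : Type*} [Field K] [IsAlgClosed K] (p : ℕ)
    [Fact p.Prime] [CharP K p] {D : K[X]} (hD : derivative D ≠ 0) {H R : K[X][X]}
    (hirr : Irreducible H) (hHR : D.map C - C D = (X - C X) * (H * R)) :
    ∃ N : ℕ, ∀ n, N ≤ n → ∃ x y, y ≠ x ∧ x ^ p ^ n = x ∧ H.evalEval x y = 0 ∧
      (H.evalEval x (y ^ p ^ n) = 0 → y ^ p ^ n = y) := by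
  classical
  have hdeg : 0 < D.natDegree := by
    rw [Nat.pos_iff_ne_zero]
    intro h
    rw [eq_C_of_natDegree_eq_zero h, derivative_C] at hD
    exact hD rfl
  have hlc : (D.map C - C D : K[X][X]).leadingCoeff = C D.leadingCoeff := by
    rw [leadingCoeff_sub_of_degree_lt, leadingCoeff_map_of_injective C_injective]
    refine degree_C_le.trans_lt ?_
    rw [degree_map_eq_of_injective C_injective]
    exact natDegree_pos_iff_degree_pos.1 hdeg
  have hunit : IsUnit H.leadingCoeff := by
    refine isUnit_of_dvd_unit ?_
      (isUnit_C.2 (IsUnit.mk0 _ (leadingCoeff_ne_zero.2 (ne_zero_of_natDegree_gt hdeg))))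
    rw [← hlc, hHR, leadingCoeff_mul, leadingCoeff_mul]
    exact (dvd_mul_right _ _).mul_left _
  obtain ⟨a, ha, haH⟩ := isUnit_iff.1 hunit
  have hinv : IsUnit (C (C (↑ha.unit⁻¹ : K)) : K[X][X]) :=
    isUnit_C.2 (isUnit_C.2 (Units.isUnit _))
  have hmonic : (H * C (C (↑ha.unit⁻¹ : K))).Monic := by
    rw [Monic, leadingCoeff_mul, leadingCoeff_C, ← haH, ← C_mul, IsUnit.mul_val_inv, C_1]
  have hzero : ∀ x y, (H * C (C (↑ha.unit⁻¹ : K))).evalEval x y = 0 ↔ H.evalEval x y = 0 := by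
    intro x y
    simp [evalEval_mul, evalEval_C, ha.ne_zero]
  have hfiber : ∀ x, D - C (D.eval x) =
      (X - C x) * (H.map (evalRingHom x) * R.map (evalRingHom x)) := by
    intro x
    have h := congrArg (Polynomial.map (evalRingHom x)) hHR
    have h1 : (evalRingHom x).comp C = RingHom.id K := RingHom.ext fun a => by simp
    simpa [Polynomial.map_map, h1] using h
  let B : Finset K :=
    (derivative D).roots.toFinset.biUnion fun y => (D - C (D.eval y)).roots.toFinset
  have hB : ∀ x ∉ B, ∀ y, D.eval y = D.eval x → (derivative D).eval y ≠ 0 := by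
    intro x hx y hxy h
    refine hx (Finset.mem_biUnion.2 ⟨y, ?_, ?_⟩)
    · rw [Multiset.mem_toFinset, mem_roots']
      exact ⟨hD, h⟩
    · rw [Multiset.mem_toFinset, mem_roots']
      refine ⟨fun h0 => ?_, by simp [hxy]⟩
      rw [sub_eq_zero] at h0
      rw [h0, natDegree_C] at hdeg
      exact hdeg.false
  obtain ⟨N, hN⟩ := exists_frobenius_fixed_fiber_point p hmonic
    ((irreducible_mul_isUnit hinv).2 hirr) B fun x hx => by
      refine separable_of_dvd_sub_C (D := D) (c := D.eval x) ?_ (hB x hx)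
      rw [Polynomial.map_mul, hfiber x]
      exact (associated_mul_unit_left _ _ (hinv.map (mapRingHom (evalRingHom x)))).dvd.trans
        ((dvd_mul_right _ _).mul_left _)
  refine ⟨N, fun n hn => ?_⟩
  obtain ⟨x, hx, hxq, y, hxy, hyq⟩ := hN n hn
  rw [hzero] at hxy hyq
  refine ⟨x, y, ?_, hxq, hxy, hyq⟩
  rintro rfl
  refine hB y hx y rfl ?_
  have h := congrArg (fun f => (derivative f).eval y) (hfiber y)
  rw [← map_evalRingHom_eval] at hxy
  simpa [hxy] using h

open MvPolynomial

noncomputable section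

/-- If `g_t` has an absolutely irreducible factor over `F_p` then, for all
sufficiently large `n`, `g_t` has a rational point over `F_{p^n}` (realized as
the subfield of fixed points of the `p^n`-power Frobenius in the algebraic
closure) with distinct coordinates. -/
theorem gt_has_rational_points_of_abs_irred_factor
    (p t : ℕ) [Fact p.Prime] (hp2 : p ≠ 2) (ht : 3 ≤ t) (hpt : ¬ p ∣ t)
    (g : MvPolynomial (Fin 2) (ZMod p))
    (hg : ((X 0 + 1) ^ t - X 0 ^ t - (X 1 + 1) ^ t + X 1 ^ t : MvPolynomial (Fin 2) (ZMod p))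
        = (X 0 - X 1) * g)
    (habs : ∃ h : MvPolynomial (Fin 2) (ZMod p), 0 < h.totalDegree ∧ h ∣ g ∧
      Irreducible (MvPolynomial.map (algebraMap (ZMod p) (AlgebraicClosure (ZMod p))) h)) :
    ∃ N : ℕ, ∀ n : ℕ, N ≤ n →
      ∃ α β : AlgebraicClosure (ZMod p), α ≠ β ∧
        α ^ (p ^ n) = α ∧ β ^ (p ^ n) = β ∧
        MvPolynomial.eval ![α, β]
          (MvPolynomial.map (algebraMap (ZMod p) (AlgebraicClosure (ZMod p))) g) = 0 := by
  obtain ⟨h, -, ⟨g', rfl⟩, hirr⟩ := habs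
  have hchar : CharP (AlgebraicClosure (ZMod p)) p := inferInstance
  set ι := algebraMap (ZMod p) (AlgebraicClosure (ZMod p)) with hι
  let D : Polynomial (AlgebraicClosure (ZMod p)) := (Polynomial.X + 1) ^ t - Polynomial.X ^ t
  have hD : Polynomial.derivative D ≠ 0 := by
    intro h0
    have h1 := congrArg (Polynomial.eval 0) h0
    have ht1 : t - 1 ≠ 0 := by omega
    have h2 : (t : AlgebraicClosure (ZMod p)) = 0 := by
      simpa [D, Polynomial.derivative_pow, ht1] using h1
    exact hpt ((CharP.cast_eq_zero_iff _ p t).1 h2)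
  have hfac := congrArg (fun f => bivariateEquiv _ (MvPolynomial.map ι f)) hg
  simp only [map_sub, map_add, map_mul, map_pow, map_one, MvPolynomial.map_X,
    bivariateEquiv_X_zero, bivariateEquiv_X_one] at hfac
  obtain ⟨N, hN⟩ := exists_frobenius_fixed_fiber_point_ne p hD
    ((MulEquiv.irreducible_iff (bivariateEquiv _)).2 hirr)
    (R := bivariateEquiv _ (MvPolynomial.map ι g')) (by
      rw [← hfac]
      simp only [D, Polynomial.map_sub, Polynomial.map_pow, Polynomial.map_add, Polynomial.map_X,
        Polynomial.map_one, map_sub, map_add, map_pow, map_one]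
      ring)
  refine ⟨N, fun n hn => ?_⟩
  obtain ⟨x, y, hne, hx, hxy, hy⟩ := hN n hn
  rw [evalEval_bivariateEquiv] at hxy hy
  refine ⟨y, x, hne, hy ?_, hx, ?_⟩
  · have h1 := MvPolynomial.eval_map_pow_char_pow h n ![y, x]
    have h2 : (fun i => ![y, x] i ^ p ^ n) = ![y ^ p ^ n, x] := by
      funext i
      fin_cases i
      · rfl
      · exact hx
    rw [h2, ← hι, hxy, zero_pow (pow_ne_zero _ (Fact.out : p.Prime).ne_zero)] at h1
    exact h1
  · rw [map_mul, map_mul, hxy, zero_mul]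
end
end

section
/- Assume t is even and t is congruent to neither 0 nor 1 modulo p. If gcd(p − 1, t) ≥ 3 or gcd(p − 1, t − 1) ≥ 2, then g_t(x,y) has an absolutely irreducible factor over F_p. -/
open MvPolynomial

noncomputable section

/-- A polynomial fixed by the Galois group coefficientwise descends to the base field. -/
theorem MvPolynomial.exists_map_eq_of_forall_map_eq {ι F K : Type*} [Field F] [Field K]
    [Algebra F K] [IsGalois F K] (P : MvPolynomial ι K)
    (hP : ∀ σ : K ≃ₐ[F] K, map (σ : K →+* K) P = P) :
    ∃ q : MvPolynomial ι F, map (algebraMap F K) q = P := by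
  have hc : ∀ m, P.coeff m ∈ Set.range (algebraMap F K) := by
    intro m
    have : P.coeff m ∈ (⊥ : IntermediateField F K) := by
      rw [InfiniteGalois.mem_bot_iff_fixed]
      intro σ
      conv_rhs => rw [← hP σ, coeff_map]
      rfl
    simpa [IntermediateField.mem_bot] using this
  have := (MvPolynomial.mem_range_map_iff_coeffs_subset (f := algebraMap F K) (x := P)).2 (by
    intro c hc'
    rw [Finset.mem_coe, mem_coeffs_iff] at hc'
    obtain ⟨m, -, rfl⟩ := hc'
    exact hc m)
  simpa using this

/-- If exactly one irreducible factor of `g` over a Galois extension is singled out, counted with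
multiplicity, by a Galois-stable property `P`, then that factor is defined over the base field. -/
theorem MvPolynomial.exists_dvd_irreducible_map_of_unique {ι F K : Type*} [Field F] [Field K]
    [Algebra F K] [IsGalois F K] (g : MvPolynomial ι F) (P : MvPolynomial ι K → Prop)
    (hPσ : ∀ (σ : K ≃ₐ[F] K) H, P H → P (map (σ : K →+* K) H))
    (hex : ∃ H, Irreducible H ∧ H ∣ map (algebraMap F K) g ∧ P H)
    (huniq : ∀ H H', P H → P H' → ¬ H * H' ∣ map (algebraMap F K) g) :
    ∃ h : MvPolynomial ι F, 0 < h.totalDegree ∧ h ∣ g ∧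
      Irreducible (map (algebraMap F K) h) := by
  obtain ⟨H, hH, hHg, hPH⟩ := hex
  have hσg : ∀ (σ : K ≃ₐ[F] K), map (σ : K →+* K) (map (algebraMap F K) g)
      = map (algebraMap F K) g := by
    intro σ
    rw [map_map]
    congr 2
    ext x
    simp
  have hassoc : ∀ σ : K ≃ₐ[F] K, Associated H (map (σ : K →+* K) H) := by
    intro σ
    have hirr : Irreducible (map (σ : K →+* K) H) :=
      (MulEquiv.irreducible_iff (mapEquiv ι (σ : K ≃+* K))).2 hH
    have hdvd : map (σ : K →+* K) H ∣ map (algebraMap F K) g := by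
      rw [← hσg σ]
      exact map_dvd _ hHg
    by_contra hna
    obtain ⟨Q, hQ⟩ := hHg
    rw [hQ] at hdvd
    rcases hirr.prime.dvd_or_dvd hdvd with h | h
    · exact hna (hirr.associated_of_dvd hH h).symm
    · exact huniq _ _ hPH (hPσ σ H hPH) (hQ ▸ mul_dvd_mul_left H h)
  obtain ⟨m, hm⟩ := MvPolynomial.ne_zero_iff.1 hH.ne_zero
  have hfix : ∀ σ : K ≃ₐ[F] K, map (σ : K →+* K) (C (H.coeff m)⁻¹ * H) = C (H.coeff m)⁻¹ * H := by
    intro σ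
    obtain ⟨u, hu⟩ := hassoc σ
    obtain ⟨c, hc, hcu⟩ := MvPolynomial.isUnit_iff_eq_C_of_isReduced.1 u.isUnit
    rw [hcu] at hu
    have hcm : H.coeff m * c = σ (H.coeff m) := by
      have := congrArg (coeff m) hu
      rw [coeff_map, mul_comm, coeff_C_mul, mul_comm] at this
      exact this
    have hc0 : c ≠ 0 := hc.ne_zero
    rw [map_mul, map_C, ← hu]
    have : (σ : K →+* K) (H.coeff m)⁻¹ = (H.coeff m)⁻¹ * c⁻¹ := by
      rw [map_inv₀]
      change (σ (H.coeff m))⁻¹ = _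
      rw [← hcm, mul_inv]
    have hcc : (C c⁻¹ * C c : MvPolynomial ι K) = 1 := by
      rw [← C_mul, inv_mul_cancel₀ hc0, C_1]
    rw [this, C_mul]
    linear_combination (C (H.coeff m)⁻¹ * H) * hcc
  obtain ⟨h, hh⟩ := MvPolynomial.exists_map_eq_of_forall_map_eq (F := F) _ hfix
  have hunit : IsUnit (C (H.coeff m)⁻¹ : MvPolynomial ι K) :=
    (IsUnit.mk0 _ (inv_ne_zero hm)).map C
  have hirr : Irreducible (map (algebraMap F K) h) := by
    rw [hh]
    exact (irreducible_isUnit_mul hunit).2 hH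
  obtain ⟨Q, hQ⟩ : map (algebraMap F K) h ∣ map (algebraMap F K) g := by
    rw [hh]
    exact (hunit.mul_left_dvd).2 hHg
  have hQfix : ∀ σ : K ≃ₐ[F] K, map (σ : K →+* K) Q = Q := by
    intro σ
    apply mul_left_cancel₀ hirr.ne_zero
    conv_rhs => rw [← hQ, ← hσg σ, hQ, map_mul]
    rw [hh, hfix σ]
  obtain ⟨q, hq⟩ := MvPolynomial.exists_map_eq_of_forall_map_eq (F := F) _ hQfix
  refine ⟨h, ?_, ⟨q, ?_⟩, hirr⟩
  · rw [Nat.pos_iff_ne_zero]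
    intro h0
    rw [totalDegree_eq_zero_iff_eq_C] at h0
    rw [h0, map_C] at hirr
    have hne := hirr.ne_zero
    rw [Ne, C_eq_zero] at hne
    exact hirr.not_isUnit ((IsUnit.mk0 _ hne).map C)
  · apply map_injective _ (algebraMap F K).injective
    rw [map_mul, hq, hQ]

/-- If a Galois-compatible multiplicative map to univariate polynomials sends a multiple `l * g`
of `g` to a polynomial with a simple zero at `a` not coming from `l`, then `g` has an irreducible
factor over `K` which is defined over `F`. -/
theorem MvPolynomial.exists_dvd_irreducible_map_of_simple_root {ι F K : Type*} [Field F] [Field K]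
    [Algebra F K] [IsGalois F K] (g : MvPolynomial ι F)
    (N : MvPolynomial ι K →* Polynomial K) (a : K)
    (hNσ : ∀ (σ : K ≃ₐ[F] K) H, (N H).eval a = 0 → (N (map (σ : K →+* K) H)).eval a = 0)
    (l : MvPolynomial ι K) (hl : (N l).eval a ≠ 0)
    (hroot : (N (l * map (algebraMap F K) g)).eval a = 0)
    (hsimple : (N (l * map (algebraMap F K) g)).derivative.eval a ≠ 0) :
    ∃ h : MvPolynomial ι F, 0 < h.totalDegree ∧ h ∣ g ∧
      Irreducible (map (algebraMap F K) h) := by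
  set G := map (algebraMap F K) g with hG
  have huniq : ∀ H H', (N H).eval a = 0 → (N H').eval a = 0 → ¬ H * H' ∣ G := by
    rintro H H' h1 h2 ⟨Q, hQ⟩
    apply hsimple
    rw [hQ]
    simp [Polynomial.derivative_mul, h1, h2]
  have hNG : (N G).eval a = 0 := by
    rw [map_mul, Polynomial.eval_mul] at hroot
    exact (mul_eq_zero.1 hroot).resolve_left hl
  have hG0 : G ≠ 0 := by
    intro h0
    exact huniq G G hNG hNG (by rw [h0, mul_zero])
  refine MvPolynomial.exists_dvd_irreducible_map_of_unique g (fun H => (N H).eval a = 0) hNσ ?_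
    huniq
  obtain ⟨s, hs, hsG⟩ := WfDvdMonoid.exists_factors G hG0
  let φ : MvPolynomial ι K →* K := (Polynomial.evalRingHom a : Polynomial K →* K).comp N
  have hφG : φ G = 0 := hNG
  obtain ⟨u, hu⟩ := hsG
  rw [← hu, map_mul] at hφG
  have hφs := (mul_eq_zero.1 hφG).resolve_right (u.isUnit.map φ).ne_zero
  rw [map_multiset_prod, Multiset.prod_eq_zero_iff, Multiset.mem_map] at hφs
  obtain ⟨H, hHs, hH⟩ := hφs
  exact ⟨H, hs H hHs, (Multiset.dvd_prod hHs).trans ⟨u, hu.symm⟩, hH⟩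

/-- The cyclic group of units of `ZMod p` has an element of each order dividing `p - 1`. -/
theorem ZMod.exists_orderOf_eq_of_dvd_sub_one (p : ℕ) [Fact p.Prime] {d : ℕ} (hd : d ∣ p - 1) :
    ∃ w : ZMod p, w ≠ 0 ∧ orderOf w = d := by
  obtain ⟨u, hu⟩ := IsCyclic.exists_ofOrder_eq_natCard (α := (ZMod p)ˣ)
  rw [Nat.card_eq_fintype_card, ZMod.card_units p] at hu
  obtain ⟨k, hk⟩ := hd
  have hp : p - 1 ≠ 0 := by have := (Fact.out : p.Prime).two_le; omega
  have hk0 : k ≠ 0 := by rintro rfl; simp_all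
  refine ⟨((u ^ k : (ZMod p)ˣ) : ZMod p), Units.ne_zero _, ?_⟩
  rw [orderOf_units, orderOf_pow_of_dvd hk0 (by rw [hu, hk]; exact dvd_mul_left _ _), hu, hk]
  exact Nat.mul_div_cancel _ (Nat.pos_of_ne_zero hk0)

/-- Restriction to the horizontal line `y = b`. -/
def restrictLine {K : Type*} [Field K] (b : K) : MvPolynomial (Fin 2) K →ₐ[K] Polynomial K :=
  aeval ![Polynomial.X, Polynomial.C b]

theorem eval_restrictLine {K : Type*} [Field K] (a b : K) (H : MvPolynomial (Fin 2) K) :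
    (restrictLine b H).eval a = eval ![a, b] H := by
  have : (Polynomial.aeval a).comp (restrictLine b) = (aeval ![a, b] : _ →ₐ[K] K) := by
    ext i
    fin_cases i <;> simp [restrictLine]
  have h := DFunLike.congr_fun this H
  rwa [AlgHom.comp_apply, Polynomial.coe_aeval_eq_eval, aeval_eq_eval] at h

/-- The substitution `x = z * T`, `y = T`, whose leading coefficient in `T` is the dehomogenized
top form. -/
def polarSubst (K : Type*) [Field K] :
    MvPolynomial (Fin 2) K →ₐ[K] Polynomial (Polynomial K) :=
  aeval ![Polynomial.C Polynomial.X * Polynomial.X, Polynomial.X]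

/-- The top form of a bivariate polynomial, dehomogenized at `y = 1`. -/
def topForm (K : Type*) [Field K] : MvPolynomial (Fin 2) K →* Polynomial K :=
  Polynomial.leadingCoeffHom.comp (polarSubst K : MvPolynomial (Fin 2) K →* _)

theorem topForm_map {K : Type*} [Field K] (σ : K →+* K) (H : MvPolynomial (Fin 2) K) :
    topForm K (map σ H) = (topForm K H).map σ := by
  have : (polarSubst K : MvPolynomial (Fin 2) K →+* _).comp (map σ)
      = (Polynomial.mapRingHom (Polynomial.mapRingHom σ)).comp
        (polarSubst K : MvPolynomial (Fin 2) K →+* _) := by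
    apply MvPolynomial.ringHom_ext
    · intro r
      simp [polarSubst, Polynomial.algebraMap_apply]
    · intro i
      fin_cases i <;> simp [polarSubst]
  have h := DFunLike.congr_fun this H
  simp only [RingHom.comp_apply, RingHom.coe_coe, Polynomial.coe_mapRingHom] at h
  change Polynomial.leadingCoeff (polarSubst K (map σ H)) =
    (Polynomial.leadingCoeff (polarSubst K H)).map σ
  rw [h, Polynomial.leadingCoeff_map_of_injective (Polynomial.map_injective σ σ.injective)]
  rfl

theorem topForm_X_sub_X (K : Type*) [Field K] :
    topForm K (X 0 - X 1) = Polynomial.X - 1 := by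
  change Polynomial.leadingCoeff (polarSubst K (X 0 - X 1)) = _
  have : polarSubst K (X 0 - X 1) = Polynomial.C (Polynomial.X - 1) * Polynomial.X := by
    simp [polarSubst, sub_mul]
  rw [this, Polynomial.leadingCoeff_mul_X, Polynomial.leadingCoeff_C]

theorem topForm_difference (K : Type*) [Field K] {t : ℕ} (ht : 2 ≤ t) (ht0 : (t : K) ≠ 0) :
    topForm K ((X 0 + 1) ^ t - X 0 ^ t - (X 1 + 1) ^ t + X 1 ^ t)
      = (t : Polynomial K) * (Polynomial.X ^ (t - 1) - 1) := by
  set f : MvPolynomial (Fin 2) K := (X 0 + 1) ^ t - X 0 ^ t - (X 1 + 1) ^ t + X 1 ^ t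
  change Polynomial.leadingCoeff (polarSubst K f) = _
  have hcomp : polarSubst K f =
      (((Polynomial.X + 1) ^ t - Polynomial.X ^ t : Polynomial (Polynomial K)).comp
        (Polynomial.C Polynomial.X * Polynomial.X))
      - ((Polynomial.X + 1) ^ t - Polynomial.X ^ t) := by
    simp [polarSubst, f]
    ring
  have hcoeff : ∀ n, (polarSubst K f).coeff n
      = ((t.choose n : Polynomial K) - if n = t then 1 else 0) * (Polynomial.X ^ n - 1) := by
    intro n
    rw [hcomp, Polynomial.coeff_sub, Polynomial.comp_C_mul_X_coeff, Polynomial.coeff_sub,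
      Polynomial.coeff_X_add_one_pow, Polynomial.coeff_X_pow]
    ring
  have hlast : (polarSubst K f).coeff (t - 1) =
      (t : Polynomial K) * (Polynomial.X ^ (t - 1) - 1) := by
    rw [hcoeff, if_neg (by omega), Nat.choose_symm (by omega : 1 ≤ t), Nat.choose_one_right]
    simp
  have hne : (polarSubst K f).coeff (t - 1) ≠ 0 := by
    rw [hlast]
    refine mul_ne_zero ?_ (Polynomial.X_pow_sub_C_ne_zero (by omega) (1 : K))
    rw [← Polynomial.C_eq_natCast]
    exact Polynomial.C_ne_zero.2 ht0
  have hdeg : (polarSubst K f).natDegree = t - 1 := by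
    refine Polynomial.natDegree_eq_of_le_of_coeff_ne_zero ?_ hne
    rw [Polynomial.natDegree_le_iff_coeff_eq_zero]
    intro n hn
    rw [hcoeff]
    rcases eq_or_ne n t with rfl | h
    · simp
    · rw [if_neg h, Nat.choose_eq_zero_of_lt (by omega)]
      simp
  rw [Polynomial.leadingCoeff, hdeg, hlast]

/-- Over any Galois extension `K` of `ZMod p`, the difference quotient `g_t` has a factor with
coefficients in `ZMod p` which is irreducible over `K`. -/
theorem exists_dvd_irreducible_map_of_gcd
    {p t : ℕ} [Fact p.Prime] (K : Type*) [Field K] [Algebra (ZMod p) K] [IsGalois (ZMod p) K]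
    (ht : 3 ≤ t) (g : MvPolynomial (Fin 2) (ZMod p))
    (hg : ((X 0 + 1) ^ t - X 0 ^ t - (X 1 + 1) ^ t + X 1 ^ t : MvPolynomial (Fin 2) (ZMod p))
        = (X 0 - X 1) * g)
    (hpt : ¬ p ∣ t) (h1 : t % p ≠ 1)
    (hgcd : 3 ≤ Nat.gcd (p - 1) t ∨ 2 ≤ Nat.gcd (p - 1) (t - 1)) :
    ∃ h : MvPolynomial (Fin 2) (ZMod p), 0 < h.totalDegree ∧ h ∣ g ∧
      Irreducible (MvPolynomial.map (algebraMap (ZMod p) K) h) := by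
  have ht0 : (t : ZMod p) ≠ 0 := by rwa [Ne, ZMod.natCast_eq_zero_iff]
  set i := algebraMap (ZMod p) K
  have htK : (t : K) ≠ 0 := by
    rw [← map_natCast i t]
    exact (map_ne_zero i).2 ht0
  have hgK : (X 0 - X 1) * map i g
      = ((X 0 + 1) ^ t - X 0 ^ t - (X 1 + 1) ^ t + X 1 ^ t : MvPolynomial (Fin 2) K) := by
    have := congrArg (map i) hg
    simpa using this.symm
  rcases hgcd with hgcd | hgcd
  · obtain ⟨w, hw0, hw⟩ := ZMod.exists_orderOf_eq_of_dvd_sub_one p (Nat.gcd_dvd_left (p - 1) t)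
    have hwt : w ^ t = 1 := orderOf_dvd_iff_pow_eq_one.1 (hw ▸ Nat.gcd_dvd_right (p - 1) t)
    have hw1 : w - 1 ≠ 0 := by
      intro h
      rw [sub_eq_zero.1 h, orderOf_one] at hw
      omega
    have hw2 : w ^ 2 - 1 ≠ 0 := by
      intro h
      have := Nat.le_of_dvd two_pos (orderOf_dvd_iff_pow_eq_one.2 (sub_eq_zero.1 h))
      omega
    have hzero : ∀ v : ZMod p, v ^ t = 1 → v - 1 ≠ 0 →
        ((v - 1)⁻¹ + 1) ^ t - (v - 1)⁻¹ ^ t = 0 := by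
      intro v hv hv1
      have : (v - 1)⁻¹ + 1 = v * (v - 1)⁻¹ := by field_simp; ring
      rw [this, mul_pow, hv, one_mul, sub_self]
    set a := (w - 1)⁻¹ with ha
    set b := (w ^ 2 - 1)⁻¹ with hb
    have hDa := hzero w hwt hw1
    have hDb := hzero (w ^ 2) (by rw [← pow_mul, mul_comm, pow_mul, hwt, one_pow]) hw2
    have ha0 : a ≠ 0 := inv_ne_zero hw1
    have hab : a - b ≠ 0 := by
      intro h
      have : w - 1 = w ^ 2 - 1 := inv_injective (sub_eq_zero.1 h)
      apply mul_ne_zero hw0 hw1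
      linear_combination -this
    have hDa' : (t : ZMod p) * ((a + 1) ^ (t - 1) - a ^ (t - 1)) ≠ 0 := by
      refine mul_ne_zero ht0 fun h => ?_
      have hs : ∀ x : ZMod p, x ^ t = x ^ (t - 1) * x := fun x => by
        rw [← pow_succ, Nat.sub_add_cancel (by omega)]
      rw [← ha, hs, hs, sub_eq_zero.1 h] at hDa
      apply pow_ne_zero (t - 1) ha0
      linear_combination hDa
    have hf : restrictLine (i b) ((X 0 - X 1) * map i g) =
        (Polynomial.X + 1) ^ t - Polynomial.X ^ t
          - Polynomial.C ((i b + 1) ^ t - i b ^ t) := by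
      rw [hgK]
      simp [restrictLine]
      ring
    refine MvPolynomial.exists_dvd_irreducible_map_of_simple_root g
      (restrictLine (i b) : MvPolynomial (Fin 2) K →* _) (i a) ?_ (X 0 - X 1) ?_ ?_ ?_
    · intro σ H hH
      change (restrictLine (i b) H).eval (i a) = 0 at hH
      change (restrictLine (i b) (map _ H)).eval (i a) = 0
      rw [eval_restrictLine] at hH ⊢
      have hpt : (![i a, i b] : Fin 2 → K) = (σ : K →+* K) ∘ ![i a, i b] := by
        funext j
        fin_cases j <;> simp [i]
      rw [hpt, eval_map, ← eval₂_comp, hH, map_zero]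
    · change (restrictLine (i b) (X 0 - X 1)).eval (i a) ≠ 0
      rw [eval_restrictLine]
      rw [map_sub, eval_X, eval_X]
      have h2 := (map_ne_zero i).2 hab
      rwa [map_sub] at h2
    · change (restrictLine (i b) _).eval (i a) = 0
      rw [hf]
      have h1 := congrArg i hDa
      have h2 := congrArg i hDb
      simp only [map_sub, map_pow, map_add, map_one, map_zero] at h1 h2
      simp only [← ha, ← hb] at h1 h2
      simp [h1, h2]
    · change (Polynomial.derivative (restrictLine (i b) _)).eval (i a) ≠ 0
      rw [hf]
      have h1 := (map_ne_zero i).2 hDa'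
      simpa [mul_sub, Polynomial.derivative_pow] using h1
  · obtain ⟨z, hz0, hz⟩ :=
      ZMod.exists_orderOf_eq_of_dvd_sub_one p (Nat.gcd_dvd_left (p - 1) (t - 1))
    have hzt : z ^ (t - 1) = 1 :=
      orderOf_dvd_iff_pow_eq_one.1 (hz ▸ Nat.gcd_dvd_right (p - 1) (t - 1))
    have hz1 : z - 1 ≠ 0 := by
      intro h
      rw [sub_eq_zero.1 h, orderOf_one] at hz
      omega
    have ht1 : ((t - 1 : ℕ) : ZMod p) ≠ 0 := by
      rw [Ne, ZMod.natCast_eq_zero_iff]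
      rintro ⟨k, hk⟩
      apply h1
      rw [show t = 1 + p * k by omega, Nat.add_mul_mod_self_left,
        Nat.mod_eq_of_lt (Fact.out : p.Prime).one_lt]
    have hf := topForm_difference K (by omega) htK
    rw [← hgK] at hf
    refine MvPolynomial.exists_dvd_irreducible_map_of_simple_root g (topForm K) (i z) ?_
      (X 0 - X 1) ?_ ?_ ?_
    · intro σ H hH
      have hσz : i z = (σ : K →+* K) (i z) := by simp [i]
      rw [topForm_map, hσz, Polynomial.eval_map_apply, hH, map_zero]
    · rw [topForm_X_sub_X]
      simpa [map_sub] using (map_ne_zero i).2 hz1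
    · rw [hf]
      simp [← map_pow, hzt]
    · rw [hf]
      have h2 := (map_ne_zero i).2
        (mul_ne_zero ht0 (mul_ne_zero ht1 (pow_ne_zero (t - 1 - 1) hz0)))
      simpa [Polynomial.derivative_pow] using h2

/-- Case (A), condition (a): if `gcd(p-1,t) ≥ 3` or `gcd(p-1,t-1) ≥ 2`, then
`g_t` has an absolutely irreducible factor over `F_p`. -/
theorem gt_has_abs_irred_factor_of_gcd
    (p t : ℕ) [Fact p.Prime] (hp2 : p ≠ 2) (ht : 3 ≤ t) (hpt : ¬ p ∣ t)
    (g : MvPolynomial (Fin 2) (ZMod p))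
    (hg : ((X 0 + 1) ^ t - X 0 ^ t - (X 1 + 1) ^ t + X 1 ^ t : MvPolynomial (Fin 2) (ZMod p))
        = (X 0 - X 1) * g)
    (hte : Even t) (h0 : t % p ≠ 0) (h1 : t % p ≠ 1)
    (hgcd : 3 ≤ Nat.gcd (p - 1) t ∨ 2 ≤ Nat.gcd (p - 1) (t - 1)) :
    ∃ h : MvPolynomial (Fin 2) (ZMod p), 0 < h.totalDegree ∧ h ∣ g ∧
      Irreducible (MvPolynomial.map (algebraMap (ZMod p) (AlgebraicClosure (ZMod p))) h) := by
  exact exists_dvd_irreducible_map_of_gcd _ ht g hg hpt h1 hgcd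
end
end

section
/- Assume t is even and t is congruent to neither 0 nor 1 modulo p. If there exists a positive integer m such that g_t(x,y) is irreducible in F_{p^m}[x,y] and, furthermore, either gcd(p^m − 1, t) ≥ 3 or gcd(p^m − 1, t − 1) ≥ 2, then g_t(x,y) has an absolutely irreducible factor over F_p. -/
open MvPolynomial

noncomputable section

open Polynomial in
/-- If `F = (X - b) * G`, then `G` vanishes to order exactly one at any simple root `a ≠ b`
of `F`. -/
theorem simple_root_of_eq_X_sub_C_mul {L : Type*} [Field L] {F G : L[X]} {a b : L}
    (hFG : F = (Polynomial.X - Polynomial.C b) * G) (hab : a ≠ b) (hF : F.eval a = 0)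
    (hF' : (derivative F).eval a ≠ 0) :
    G.eval a = 0 ∧ ¬ (Polynomial.X - Polynomial.C a) ^ 2 ∣ G := by
  constructor
  · rw [hFG] at hF
    simpa [sub_ne_zero.mpr hab] using hF
  · rintro ⟨k, rfl⟩
    apply hF'
    rw [hFG]
    simp [derivative_mul, derivative_pow]

/-- A polynomial over a Galois extension fixed by all automorphisms is defined over the base. -/
theorem mem_range_map_of_fixed {K L ι : Type*} [Field K] [Field L] [Algebra K L] [IsGalois K L]
    {h : MvPolynomial ι L}
    (hfix : ∀ s : L ≃ₐ[K] L, MvPolynomial.map (s : L →+* L) h = h) :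
    ∃ h₀ : MvPolynomial ι K, MvPolynomial.map (algebraMap K L) h₀ = h := by
  apply mem_range_map_iff_coeffs_subset.mpr
  intro c hc
  obtain ⟨d, -, rfl⟩ := mem_coeffs_iff.mp hc
  rw [InfiniteGalois.mem_range_algebraMap_iff_fixed]
  intro s
  conv_rhs => rw [← hfix s]
  rw [coeff_map]
  rfl

theorem map_algEquiv_map_algebraMap {K L ι : Type*} [Field K] [Field L] [Algebra K L]
    (s : L ≃ₐ[K] L) (g : MvPolynomial ι K) :
    MvPolynomial.map (s : L →+* L) (MvPolynomial.map (algebraMap K L) g) =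
      MvPolynomial.map (algebraMap K L) g := by
  rw [MvPolynomial.map_map, show (s : L →+* L).comp (algebraMap K L) = algebraMap K L from
    RingHom.ext s.commutes]

/-- A nonzero polynomial that is associated to all its Galois conjugates has a scalar multiple
that is fixed by the Galois group. -/
theorem exists_associated_fixed {K L ι : Type*} [Field K] [Field L] [Algebra K L]
    {h : MvPolynomial ι L} (h0 : h ≠ 0)
    (hassoc : ∀ s : L ≃ₐ[K] L, Associated h (MvPolynomial.map (s : L →+* L) h)) :
    ∃ h' : MvPolynomial ι L, Associated h h' ∧
      ∀ s : L ≃ₐ[K] L, MvPolynomial.map (s : L →+* L) h' = h' := by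
  obtain ⟨d, hd⟩ := MvPolynomial.ne_zero_iff.mp h0
  set c := coeff d h with hc
  refine ⟨h * C c⁻¹, ?_, fun s => ?_⟩
  · exact associated_mul_unit_right _ _ ((isUnit_iff_ne_zero.mpr (inv_ne_zero hd)).map C)
  · obtain ⟨u, hu⟩ := hassoc s
    obtain ⟨r, -, hr⟩ := isUnit_iff_eq_C_of_isReduced.mp u.isUnit
    rw [hr] at hu
    have hsc : s c = c * r := by
      have := congrArg (coeff d) hu
      rw [mul_comm, coeff_C_mul, coeff_map, mul_comm] at this
      exact this.symm
    have hr0 : r ≠ 0 := by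
      rintro rfl
      exact hd (by simpa using hsc)
    rw [map_mul, ← hu, map_C, mul_assoc, ← map_mul]
    congr 2
    change r * s c⁻¹ = c⁻¹
    rw [map_inv₀, hsc]
    field_simp

/-- An irreducible polynomial over `K` remains irreducible over a Galois extension `L` if a
Galois-equivariant multiplicative map to univariate polynomials sends it to a polynomial with a
simple `K`-rational root. -/
theorem irreducible_map_of_simple_root {K L ι : Type*} [Field K] [Field L] [Algebra K L]
    [IsGalois K L] [Finite ι] {g : MvPolynomial ι K} (hg : Irreducible g)
    (φ : MvPolynomial ι L →* Polynomial L)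
    (hφ : ∀ (s : L ≃ₐ[K] L) (h : MvPolynomial ι L),
      φ (MvPolynomial.map (s : L →+* L) h) = (φ h).map (s : L →+* L))
    (a : K) (hroot : (φ (MvPolynomial.map (algebraMap K L) g)).eval (algebraMap K L a) = 0)
    (hsimple : ¬ (Polynomial.X - Polynomial.C (algebraMap K L a)) ^ 2 ∣
      φ (MvPolynomial.map (algebraMap K L) g)) :
    Irreducible (MvPolynomial.map (algebraMap K L) g) := by
  set gL := MvPolynomial.map (algebraMap K L) g with hgL
  have hinj : Function.Injective (MvPolynomial.map (algebraMap K L) : MvPolynomial ι K → _) :=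
    map_injective _ (algebraMap K L).injective
  have hgL0 : gL ≠ 0 := (map_ne_zero_iff _ hinj).mpr hg.ne_zero
  obtain ⟨h, hirr, hdvd, hh⟩ : ∃ h, Irreducible h ∧ h ∣ gL ∧
      (φ h).eval (algebraMap K L a) = 0 := by
    clear_value gL
    clear hsimple hgL
    induction gL using WfDvdMonoid.induction_on_irreducible with
    | zero => exact absurd rfl hgL0
    | unit u hu =>
      have := (hu.map φ).map (Polynomial.evalRingHom (algebraMap K L a))
      exact absurd hroot this.ne_zero
    | mul b i hb hi ih =>
      rw [map_mul, Polynomial.eval_mul, mul_eq_zero] at hroot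
      rcases hroot with hi0 | hb0
      · exact ⟨i, hi, dvd_mul_right i b, hi0⟩
      · obtain ⟨h, hirr, hdvd, hh⟩ := ih hb0 hb
        exact ⟨h, hirr, hdvd.mul_left i, hh⟩
  have hassoc : ∀ s : L ≃ₐ[K] L, Associated h (MvPolynomial.map (s : L →+* L) h) := by
    intro s
    have hsirr : Irreducible (MvPolynomial.map (s : L →+* L) h) :=
      (MulEquiv.irreducible_iff (MvPolynomial.mapEquiv ι s.toRingEquiv)).mpr hirr
    have hsdvd : MvPolynomial.map (s : L →+* L) h ∣ gL := by
      rw [hgL, ← map_algEquiv_map_algebraMap s g]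
      exact map_dvd _ hdvd
    by_contra hna
    obtain ⟨k, hk⟩ := hdvd
    rw [hk] at hsdvd
    have hsk : MvPolynomial.map (s : L →+* L) h ∣ k :=
      (hsirr.prime.dvd_or_dvd hsdvd).resolve_left fun hd =>
        hna (hsirr.associated_of_dvd hirr hd).symm
    apply hsimple
    rw [hk, map_mul, sq]
    refine mul_dvd_mul (Polynomial.dvd_iff_isRoot.mpr hh)
      (dvd_trans (Polynomial.dvd_iff_isRoot.mpr ?_) (map_dvd φ hsk))
    have he := Polynomial.eval_map_apply (f := (s : L →+* L)) (p := φ h) (algebraMap K L a)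
    rw [hh, map_zero] at he
    rwa [hφ, Polynomial.IsRoot, ← s.commutes a]
  obtain ⟨h', hh', hfix⟩ := exists_associated_fixed hirr.ne_zero hassoc
  obtain ⟨h₀, hh₀⟩ := mem_range_map_of_fixed hfix
  obtain ⟨k, hk⟩ := hh'.symm.dvd.trans hdvd
  have h'0 : h' ≠ 0 := fun h0 => hirr.ne_zero ((hh'.eq_zero_iff).mpr h0)
  obtain ⟨k₀, hk₀⟩ := mem_range_map_of_fixed (h := k) (K := K) fun s => by
    apply mul_left_cancel₀ h'0
    rw [← hk]
    conv_lhs => rw [← hfix s]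
    rw [← map_mul, ← hk, hgL, map_algEquiv_map_algebraMap]
  have hgfac : g = h₀ * k₀ := by
    apply hinj
    rw [map_mul, hh₀, hk₀, ← hk]
  have hirr' : Irreducible h' := hh'.irreducible hirr
  rcases hg.isUnit_or_isUnit hgfac with hu | hu
  · exact absurd (hh₀ ▸ hu.map (MvPolynomial.map (algebraMap K L))) hirr'.not_isUnit
  · rw [hk]
    exact (irreducible_mul_isUnit (hk₀ ▸ hu.map (MvPolynomial.map (algebraMap K L)))).mpr hirr'

/-- An irreducible bivariate polynomial with a simple rational zero on a horizontal line defined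
over the ground field remains irreducible over Galois extensions. -/
theorem irreducible_map_of_simple_root_line {K L : Type*} [Field K] [Field L] [Algebra K L]
    [IsGalois K L] {g : MvPolynomial (Fin 2) K} (hg : Irreducible g) (a b : K)
    {G : Polynomial L}
    (hG : eval₂Hom Polynomial.C ![Polynomial.X, Polynomial.C (algebraMap K L b)]
      (MvPolynomial.map (algebraMap K L) g) = G)
    (hroot : G.eval (algebraMap K L a) = 0)
    (hsimple : ¬ (Polynomial.X - Polynomial.C (algebraMap K L a)) ^ 2 ∣ G) :
    Irreducible (MvPolynomial.map (algebraMap K L) g) := by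
  subst hG
  refine irreducible_map_of_simple_root hg
    (eval₂Hom Polynomial.C ![Polynomial.X, Polynomial.C (algebraMap K L b)] :
      MvPolynomial (Fin 2) L →+* Polynomial L).toMonoidHom (fun s h => ?_) a hroot hsimple
  change eval₂Hom _ _ _ = Polynomial.mapRingHom (s : L →+* L) (eval₂Hom _ _ h)
  rw [eval₂Hom_map_hom, map_eval₂Hom]
  congr 2
  · ext; simp
  · ext i
    fin_cases i <;> simp

/-- The substitution `x ↦ XT, y ↦ T`. The leading coefficient in `T` of the image of a polynomial
is its dehomogenized leading form. -/
def homogeneousSubst (L : Type*) [Field L] :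
    MvPolynomial (Fin 2) L →+* Polynomial (Polynomial L) :=
  eval₂Hom (Polynomial.C.comp Polynomial.C)
    ![Polynomial.C Polynomial.X * Polynomial.X, Polynomial.X]

/-- An irreducible bivariate polynomial whose leading form has a simple rational zero remains
irreducible over Galois extensions. -/
theorem irreducible_map_of_simple_root_infinity {K L : Type*} [Field K] [Field L] [Algebra K L]
    [IsGalois K L] {g : MvPolynomial (Fin 2) K} (hg : Irreducible g) (a : K)
    {G : Polynomial L}
    (hG : (homogeneousSubst L (MvPolynomial.map (algebraMap K L) g)).leadingCoeff = G)
    (hroot : G.eval (algebraMap K L a) = 0)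
    (hsimple : ¬ (Polynomial.X - Polynomial.C (algebraMap K L a)) ^ 2 ∣ G) :
    Irreducible (MvPolynomial.map (algebraMap K L) g) := by
  subst hG
  refine irreducible_map_of_simple_root hg
    ((Polynomial.leadingCoeffHom (R := Polynomial L)).comp (homogeneousSubst L).toMonoidHom)
    (fun s h => ?_) a hroot hsimple
  change (homogeneousSubst L _).leadingCoeff =
    Polynomial.mapRingHom (s : L →+* L) (homogeneousSubst L h).leadingCoeff
  rw [← Polynomial.leadingCoeff_map_of_injective
    (Polynomial.map_injective (s : L →+* L) s.injective)]
  congr 1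
  change _ = Polynomial.mapRingHom _ _
  rw [homogeneousSubst, eval₂Hom_map_hom, map_eval₂Hom]
  congr 2
  · ext; simp
  · ext i
    fin_cases i <;> simp

/-- A finite field contains an element of every order dividing the order of its unit group. -/
theorem exists_orderOf_eq_of_dvd_card_sub_one {K : Type*} [Field K] [Finite K] {d : ℕ}
    (hd : d ∣ Nat.card K - 1) : ∃ w : K, orderOf w = d := by
  obtain ⟨u, hu⟩ := IsCyclic.exists_ofOrder_eq_natCard (α := Kˣ)
  rw [Nat.card_units] at hu
  have hpos : 0 < Nat.card K - 1 := hu ▸ orderOf_pos u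
  obtain ⟨e, he⟩ := hd
  have he0 : e ≠ 0 := by rintro rfl; omega
  refine ⟨((u ^ e : Kˣ) : K), ?_⟩
  rw [orderOf_units, orderOf_pow_of_dvd he0 (by rw [hu, he]; exact dvd_mul_left e d), hu, he,
    Nat.mul_div_cancel _ (Nat.pos_of_ne_zero he0)]

/-- The dehomogenized leading form of the difference polynomial of `x ↦ (x + 1) ^ (n + 1) -
x ^ (n + 1)`. -/
theorem leadingCoeff_homogeneousSubst_diff {L : Type*} [Field L] {n : ℕ} (hn : n ≠ 0)
    (hnL : ((n + 1 : ℕ) : L) ≠ 0) :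
    (homogeneousSubst L ((X 0 + 1) ^ (n + 1) - X 0 ^ (n + 1) - (X 1 + 1) ^ (n + 1)
      + X 1 ^ (n + 1))).leadingCoeff =
      Polynomial.C ((n + 1 : ℕ) : L) * (Polynomial.X ^ n - 1) := by
  set q : Polynomial (Polynomial L) := (Polynomial.X + 1) ^ (n + 1) - Polynomial.X ^ (n + 1)
    with hq
  set P := q.comp (Polynomial.C Polynomial.X * Polynomial.X) - q with hP
  have hPf : homogeneousSubst L ((X 0 + 1) ^ (n + 1) - X 0 ^ (n + 1) - (X 1 + 1) ^ (n + 1)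
      + X 1 ^ (n + 1)) = P := by
    simp only [homogeneousSubst, hP, hq, map_add, map_sub, map_pow, map_one, eval₂Hom_X',
      Matrix.cons_val_zero, Matrix.cons_val_one, Polynomial.sub_comp, Polynomial.pow_comp,
      Polynomial.add_comp, Polynomial.X_comp, Polynomial.one_comp]
    ring
  have hcoeff : ∀ k, P.coeff k = q.coeff k * (Polynomial.X ^ k - 1) := fun k => by
    rw [hP, Polynomial.coeff_sub, Polynomial.comp_C_mul_X_coeff]
    ring
  have hqk : ∀ k, q.coeff k = ((n + 1).choose k : Polynomial L) - if k = n + 1 then 1 else 0 :=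
    fun k => by
      rw [hq, Polynomial.coeff_sub, Polynomial.coeff_X_add_one_pow, Polynomial.coeff_X_pow]
  have hPn : P.coeff n = Polynomial.C ((n + 1 : ℕ) : L) * (Polynomial.X ^ n - 1) := by
    rw [hcoeff, hqk, if_neg (by omega), sub_zero, Nat.choose_succ_self_right, map_natCast]
  have hdeg : P.natDegree = n := by
    apply Polynomial.natDegree_eq_of_le_of_coeff_ne_zero
    · rw [Polynomial.natDegree_le_iff_coeff_eq_zero]
      intro k hk
      rw [hcoeff, hqk]
      rcases eq_or_ne k (n + 1) with rfl | hk'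
      · simp
      · rw [Nat.choose_eq_zero_of_lt (by omega), if_neg hk']
        simp
    · rw [hPn]
      exact mul_ne_zero (Polynomial.C_ne_zero.mpr hnL)
        (Polynomial.X_pow_sub_C_ne_zero (Nat.pos_of_ne_zero hn) 1)
  rw [hPf, Polynomial.leadingCoeff, hdeg, hPn]

theorem leadingCoeff_homogeneousSubst_X_sub_X (L : Type*) [Field L] :
    (homogeneousSubst L (X 0 - X 1)).leadingCoeff = Polynomial.X - Polynomial.C 1 := by
  have : homogeneousSubst L (X 0 - X 1) =
      Polynomial.C (Polynomial.X - Polynomial.C 1) * Polynomial.X := by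
    simp [homogeneousSubst, sub_mul]
  rw [this, Polynomial.leadingCoeff_C_mul_X]

/-- If the ground field contains a nontrivial `n`-th root of unity, the quotient of the difference
polynomial of exponent `n + 1` by `x - y` stays irreducible over Galois extensions. -/
theorem irreducible_map_of_root_of_unity_pred {K L : Type*} [Field K] [Field L] [Algebra K L]
    [IsGalois K L] {n : ℕ} (hnL : (n : L) ≠ 0) (hnL' : ((n + 1 : ℕ) : L) ≠ 0)
    {g : MvPolynomial (Fin 2) K} (hg : Irreducible g)
    (hfac : ((X 0 + 1) ^ (n + 1) - X 0 ^ (n + 1) - (X 1 + 1) ^ (n + 1) + X 1 ^ (n + 1) :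
      MvPolynomial (Fin 2) K) = (X 0 - X 1) * g)
    {w : K} (hw : w ^ n = 1) (hw1 : w ≠ 1) :
    Irreducible (MvPolynomial.map (algebraMap K L) g) := by
  have hn : n ≠ 0 := by rintro rfl; simp at hnL
  have hw0 : w ≠ 0 := by rintro rfl; simp [hn] at hw
  have hF := congrArg
    (fun h => (homogeneousSubst L (MvPolynomial.map (algebraMap K L) h)).leadingCoeff) hfac
  simp only [map_mul, Polynomial.leadingCoeff_mul] at hF
  rw [map_sub (MvPolynomial.map (algebraMap K L)) (X 0) (X 1), map_X, map_X,
    leadingCoeff_homogeneousSubst_X_sub_X] at hF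
  have hL := leadingCoeff_homogeneousSubst_diff hn hnL'
  simp only [map_add, map_sub, map_pow, map_one, map_X] at hF hL
  rw [hL] at hF
  have hwL : algebraMap K L w ^ n = 1 := by rw [← map_pow, hw, map_one]
  obtain ⟨h1, h2⟩ := simple_root_of_eq_X_sub_C_mul (a := algebraMap K L w) hF
    (by rwa [Ne, FaithfulSMul.algebraMap_eq_one_iff]) (by simp [hwL])
    (by
      rw [Polynomial.derivative_C_mul, Polynomial.derivative_sub, Polynomial.derivative_X_pow]
      simp only [Polynomial.derivative_one, sub_zero, Polynomial.eval_mul, Polynomial.eval_C,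
        Polynomial.eval_pow, Polynomial.eval_X]
      exact mul_ne_zero hnL' (mul_ne_zero hnL (pow_ne_zero _
        ((map_ne_zero _).mpr hw0))))
  exact irreducible_map_of_simple_root_infinity hg w rfl h1 h2

/-- If the ground field contains two distinct nontrivial `(n + 1)`-st roots of unity, the quotient
of the difference polynomial of exponent `n + 1` by `x - y` stays irreducible over Galois
extensions. -/
theorem irreducible_map_of_roots_of_unity {K L : Type*} [Field K] [Field L] [Algebra K L]
    [IsGalois K L] {n : ℕ} (hnL' : ((n + 1 : ℕ) : L) ≠ 0)
    {g : MvPolynomial (Fin 2) K} (hg : Irreducible g)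
    (hfac : ((X 0 + 1) ^ (n + 1) - X 0 ^ (n + 1) - (X 1 + 1) ^ (n + 1) + X 1 ^ (n + 1) :
      MvPolynomial (Fin 2) K) = (X 0 - X 1) * g)
    {w v : K} (hw : w ^ (n + 1) = 1) (hw1 : w ≠ 1) (hv : v ^ (n + 1) = 1) (hv1 : v ≠ 1)
    (hwv : w ≠ v) :
    Irreducible (MvPolynomial.map (algebraMap K L) g) := by
  have hw' : w - 1 ≠ 0 := sub_ne_zero.mpr hw1
  have hv' : v - 1 ≠ 0 := sub_ne_zero.mpr hv1
  have key : ∀ z : K, z - 1 ≠ 0 → (z - 1)⁻¹ + 1 = z * (z - 1)⁻¹ := fun z hz => by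
    field_simp; ring
  set a := (w - 1)⁻¹ with ha
  set b := (v - 1)⁻¹ with hb
  have hab : a ≠ b := fun h => hwv (by simpa using inv_injective h)
  have ha1 : a + 1 = w * a := key w hw'
  have hb1 : b + 1 = v * b := key v hv'
  have haL : algebraMap K L a + 1 = algebraMap K L w * algebraMap K L a := by
    rw [← map_mul, ← ha1, map_add, map_one]
  have hbL : algebraMap K L b + 1 = algebraMap K L v * algebraMap K L b := by
    rw [← map_mul, ← hb1, map_add, map_one]
  have hwL : algebraMap K L w ^ (n + 1) = 1 := by rw [← map_pow, hw, map_one]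
  have hvL : algebraMap K L v ^ (n + 1) = 1 := by rw [← map_pow, hv, map_one]
  have haL0 : algebraMap K L a ≠ 0 := (map_ne_zero _).mpr (inv_ne_zero hw')
  have hwL1 : algebraMap K L w ≠ 1 := by rwa [Ne, FaithfulSMul.algebraMap_eq_one_iff]
  have hF := congrArg (fun h => eval₂Hom Polynomial.C
    ![Polynomial.X, Polynomial.C (algebraMap K L b)] (MvPolynomial.map (algebraMap K L) h)) hfac
  simp only [map_mul, map_add, map_sub, map_pow, map_one, map_X, eval₂Hom_X',
    Matrix.cons_val_zero, Matrix.cons_val_one] at hF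
  obtain ⟨h1, h2⟩ := simple_root_of_eq_X_sub_C_mul (a := algebraMap K L a) hF
    (fun h => hab ((algebraMap K L).injective h))
    (by simp [haL, hbL, mul_pow, hwL, hvL])
    (by
      simp only [Polynomial.derivative_add, Polynomial.derivative_sub, Polynomial.derivative_pow,
        Polynomial.derivative_X, Polynomial.derivative_C, Polynomial.derivative_one]
      simp only [Polynomial.eval_add, Polynomial.eval_sub, Polynomial.eval_mul, Polynomial.eval_pow,
        Polynomial.eval_X, Polynomial.eval_C, Polynomial.eval_one, add_tsub_cancel_right, haL,
        mul_pow, add_zero, mul_one, mul_zero, sub_zero]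
      rw [← mul_sub]
      refine mul_ne_zero hnL' ?_
      rw [← sub_one_mul]
      refine mul_ne_zero (sub_ne_zero.mpr fun h => hwL1 ?_) (pow_ne_zero _ haL0)
      rwa [pow_succ, h, one_mul] at hwL)
  exact irreducible_map_of_simple_root_line hg a b rfl h1 h2

/-- Case (A), condition (â): if there is `m` such that `g_t` is irreducible over
`F_{p^m}` and either `gcd(p^m-1,t) ≥ 3` or `gcd(p^m-1,t-1) ≥ 2`, then `g_t` has
an absolutely irreducible factor over `F_p`. -/
theorem gt_has_abs_irred_factor_of_gcd_pm
    (p t : ℕ) [Fact p.Prime] (hp2 : p ≠ 2) (ht : 3 ≤ t) (hpt : ¬ p ∣ t)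
    (g : MvPolynomial (Fin 2) (ZMod p))
    (hg : ((X 0 + 1) ^ t - X 0 ^ t - (X 1 + 1) ^ t + X 1 ^ t : MvPolynomial (Fin 2) (ZMod p))
        = (X 0 - X 1) * g)
    (hte : Even t) (h0 : t % p ≠ 0) (h1 : t % p ≠ 1)
    (m : ℕ) (hm : 0 < m)
    (hirr : Irreducible (MvPolynomial.map (algebraMap (ZMod p) (GaloisField p m)) g))
    (hgcd : 3 ≤ Nat.gcd (p ^ m - 1) t ∨ 2 ≤ Nat.gcd (p ^ m - 1) (t - 1)) :
    ∃ h : MvPolynomial (Fin 2) (ZMod p), 0 < h.totalDegree ∧ h ∣ g ∧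
      Irreducible (MvPolynomial.map (algebraMap (ZMod p) (AlgebraicClosure (ZMod p))) h) := by
  obtain ⟨n, rfl⟩ : ∃ n, t = n + 1 := ⟨t - 1, by omega⟩
  set L := AlgebraicClosure (ZMod p)
  set K := GaloisField p m
  let ι : K →+* L := (IsAlgClosed.lift : K →ₐ[ZMod p] L).toRingHom
  let _ : Algebra K L := ι.toAlgebra
  have hcomp : algebraMap (ZMod p) L = (algebraMap K L).comp (algebraMap (ZMod p) K) :=
    Subsingleton.elim _ _
  have : IsScalarTower (ZMod p) K L := IsScalarTower.of_algebraMap_eq' hcomp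
  have : IsGalois K L := IsGalois.tower_top_of_isGalois (ZMod p) K L
  have hcard : Nat.card K = p ^ m := GaloisField.card p m hm.ne'
  have hcast : ∀ k : ℕ, ¬ p ∣ k → (k : L) ≠ 0 := fun k hk h =>
    hk ((CharP.cast_eq_zero_iff L p k).mp h)
  have hn : ¬ p ∣ n := by
    rintro ⟨c, rfl⟩
    apply h1
    rw [Nat.mul_add_mod, Nat.mod_eq_of_lt (Fact.out : p.Prime).one_lt]
  have hfac := congrArg (MvPolynomial.map (algebraMap (ZMod p) K)) hg
  simp only [map_mul, map_add, map_sub, map_pow, map_one, map_X] at hfac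
  have hirrL : Irreducible (MvPolynomial.map (algebraMap (ZMod p) L) g) := by
    rw [hcomp, ← MvPolynomial.map_map]
    rcases hgcd with hd | hd
    · obtain ⟨w, hw⟩ := exists_orderOf_eq_of_dvd_card_sub_one (K := K)
        (d := Nat.gcd (p ^ m - 1) (n + 1)) (hcard ▸ Nat.gcd_dvd_left _ _)
      have hwn : w ^ (n + 1) = 1 :=
        orderOf_dvd_iff_pow_eq_one.mp (hw ▸ Nat.gcd_dvd_right _ _)
      have hw1 : w ≠ 1 := by
        rintro rfl
        rw [orderOf_one] at hw
        omega
      have hw2 : w ^ 2 ≠ 1 := fun h => by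
        have := orderOf_le_of_pow_eq_one two_pos h
        omega
      refine irreducible_map_of_roots_of_unity (hcast _ hpt) hirr hfac hwn hw1 (v := w ^ 2)
        (by rw [← pow_mul, mul_comm, pow_mul, hwn, one_pow]) hw2 fun h => hw1 ?_
      have hw0 : w ≠ 0 := by rintro rfl; simp at hwn
      rw [sq] at h
      exact (mul_eq_left₀ hw0).mp h.symm
    · rw [Nat.add_sub_cancel] at hd
      obtain ⟨w, hw⟩ := exists_orderOf_eq_of_dvd_card_sub_one (K := K)
        (d := Nat.gcd (p ^ m - 1) n) (hcard ▸ Nat.gcd_dvd_left _ _)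
      refine irreducible_map_of_root_of_unity_pred (hcast _ hn) (hcast _ hpt) hirr hfac
        (w := w) (orderOf_dvd_iff_pow_eq_one.mp (hw ▸ Nat.gcd_dvd_right _ _)) ?_
      rintro rfl
      rw [orderOf_one] at hw
      omega
  refine ⟨g, Nat.pos_of_ne_zero fun h => ?_, dvd_rfl, hirrL⟩
  rw [totalDegree_eq_zero_iff_eq_C.mp h, map_C] at hirrL
  refine hirrL.not_isUnit (IsUnit.map C (isUnit_iff_ne_zero.mpr fun h0 => hirrL.ne_zero ?_))
  rw [h0, map_zero]
end
end

section
/- Assume t is even and t is congruent to neither 0 nor 1 modulo p. Let S_t := {(x,y) ∈ F̄_p × F̄_p : x ≠ y, (x+1)^{t−1} = x^{t−1}, (y+1)^{t−1} = y^{t−1}, x^{t−1} = y^{t−1}}. If 4·|S_t| < (t−2)², then g_t(x,y) has an absolutely irreducible factor over F_p. -/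
open MvPolynomial

noncomputable section

variable {K : Type*} [Field K]

theorem finrank_restrictTotalDegree_fin_two (N : ℕ) :
    Module.finrank K (restrictTotalDegree (Fin 2) K N) = (N + 2).choose 2 := by
  unfold restrictTotalDegree
  rw [Module.finrank_eq_nat_card_basis (basisRestrictSupport K _)]
  have hset : {n : Fin 2 →₀ ℕ | (n.sum fun _ e => e) ≤ N} =
      ((((Finset.range (N + 1)).sigma fun k => Finset.HasAntidiagonal.antidiagonal k).image
        fun x => Finsupp.equivFunOnFinite.symm ![x.2.1, x.2.2] : Finset (Fin 2 →₀ ℕ)) :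
          Set (Fin 2 →₀ ℕ)) := by
    ext n
    simp only [Set.mem_ofPred_eq, Finset.coe_image, Set.mem_image, Finset.mem_coe,
      Finset.mem_sigma, Finset.mem_range, Finset.HasAntidiagonal.mem_antidiagonal]
    rw [Finsupp.sum_fintype _ _ (fun _ => rfl), Fin.sum_univ_two]
    constructor
    · intro h
      refine ⟨⟨n 0 + n 1, (n 0, n 1)⟩, ⟨by simpa using by omega, rfl⟩, ?_⟩
      ext i; fin_cases i <;> simp
    · rintro ⟨⟨k, a, b⟩, ⟨h1, h2⟩, rfl⟩
      simp at h1 h2 ⊢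
      omega
  rw [hset, Nat.card_coe_set_eq, Set.ncard_coe_finset, Finset.card_image_of_injOn, Finset.card_sigma]
  · simp only [Finset.Nat.card_antidiagonal]
    clear hset
    induction N with
    | zero => rfl
    | succ n ih =>
      rw [Finset.sum_range_succ, ih, Nat.choose_succ_succ' (n + 2) 1]
      simp; omega
  · rintro ⟨k, a, b⟩ h ⟨l, c, d⟩ h' he
    simp at h h' he
    obtain ⟨rfl, rfl⟩ := he
    obtain ⟨_, rfl⟩ := h
    obtain ⟨_, rfl⟩ := h'
    rfl

theorem homogeneousComponent_add_mul {σ R : Type*} [CommSemiring R] {P Q : MvPolynomial σ R}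
    {u v : ℕ} (hP : P.totalDegree ≤ u) (hQ : Q.totalDegree ≤ v) :
    homogeneousComponent (u + v) (P * Q) =
      homogeneousComponent u P * homogeneousComponent v Q := by
  classical
  ext d
  rw [coeff_homogeneousComponent, coeff_mul, coeff_mul]
  have key : ∀ {F : MvPolynomial σ R} {n : ℕ} {e : σ →₀ ℕ}, F.totalDegree ≤ n → n < e.degree →
      coeff e F = 0 := fun hF he => coeff_eq_zero_of_totalDegree_lt (by
        simpa [Finsupp.degree_apply] using hF.trans_lt he)
  split_ifs with hd
  · refine Finset.sum_congr rfl fun x hx => ?_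
    rw [Finset.HasAntidiagonal.mem_antidiagonal] at hx
    have hdeg : x.1.degree + x.2.degree = u + v := by rw [← hd, ← hx, map_add]
    simp only [coeff_homogeneousComponent]
    rcases lt_trichotomy x.1.degree u with h | h | h
    · rw [key hQ (by omega)]; simp
    · rw [if_pos h, if_pos (by omega)]
    · rw [key hP h]; simp
  · refine (Finset.sum_eq_zero fun x hx => ?_).symm
    rw [Finset.HasAntidiagonal.mem_antidiagonal] at hx
    simp only [coeff_homogeneousComponent]
    by_cases h1 : x.1.degree = u
    · by_cases h2 : x.2.degree = v
      · exact absurd (by rw [← hx, map_add, h1, h2]) hd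
      · simp [h2]
    · simp [h1]

theorem totalDegree_lt_of_homogeneousComponent_eq_zero {σ R : Type*} [CommSemiring R]
    {P : MvPolynomial σ R} {n : ℕ} (hP : P.totalDegree ≤ n + 1)
    (h : homogeneousComponent (n + 1) P = 0) : P.totalDegree ≤ n := by
  refine Finset.sup_le fun d hd => ?_
  have h1 : d.degree ≤ n + 1 := by
    simpa [Finsupp.degree_apply, Finsupp.sum] using (le_totalDegree hd).trans hP
  have h2 : d.degree ≠ n + 1 := fun he => by
    have := congrArg (coeff d) h
    rw [coeff_homogeneousComponent, if_pos he] at this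
    exact mem_support_iff.1 hd this
  rw [Finsupp.degree_apply] at h1 h2
  exact Nat.le_of_lt_succ (lt_of_le_of_ne h1 h2)

theorem mem_span_X_sub_C (a : Fin 2 → K) (P : MvPolynomial (Fin 2) K) (hP : eval a P = 0) :
    ∃ A B : MvPolynomial (Fin 2) K, P = A * (X 0 - C (a 0)) + B * (X 1 - C (a 1)) := by
  have h : ∀ P : MvPolynomial (Fin 2) K,
      ∃ A B : MvPolynomial (Fin 2) K,
        P = C (eval a P) + A * (X 0 - C (a 0)) + B * (X 1 - C (a 1)) := by
    intro P
    induction P using MvPolynomial.induction_on with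
    | C c => exact ⟨0, 0, by simp⟩
    | add p q hp hq =>
      obtain ⟨A, B, h⟩ := hp
      obtain ⟨A', B', h'⟩ := hq
      refine ⟨A + A', B + B', ?_⟩
      rw [map_add, C_add]
      linear_combination h + h'
    | mul_X p i hp =>
      obtain ⟨A, B, h⟩ := hp
      fin_cases i
      · refine ⟨A * X 0 + C (eval a p), B * X 0, ?_⟩
        simp only [Fin.zero_eta, map_mul, eval_X]
        linear_combination X 0 * h
      · refine ⟨A * X 1, B * X 1 + C (eval a p), ?_⟩
        simp only [Fin.mk_one, map_mul, eval_X]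
        linear_combination X 1 * h
  obtain ⟨A, B, h⟩ := h P
  exact ⟨A, B, by rw [hP] at h; simpa using h⟩

/-- Max Noether's theorem for transversal intersections. -/
theorem mem_span_pair_of_transversal [IsAlgClosed K] {P Q h : MvPolynomial (Fin 2) K}
    (htr : ∀ a : Fin 2 → K, eval a P = 0 → eval a Q = 0 →
      eval a (pderiv 0 P) * eval a (pderiv 1 Q) - eval a (pderiv 1 P) * eval a (pderiv 0 Q) ≠ 0)
    (hh : ∀ a : Fin 2 → K, eval a P = 0 → eval a Q = 0 → eval a h = 0) :
    ∃ A B, h = A * P + B * Q := by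
  have key : h ∈ Ideal.span {P, Q} := by
    by_contra hcon
    have hJ : (Ideal.span {P, Q}).colon {h} ≠ ⊤ := by
      rw [Ne, Ideal.eq_top_iff_one, Submodule.mem_colon_singleton]
      simpa using hcon
    obtain ⟨M, hM, hle⟩ := Ideal.exists_le_maximal _ hJ
    obtain ⟨a, rfl⟩ := isMaximal_iff_eq_vanishingIdeal_singleton.1 hM
    have hmem : ∀ F, F * h ∈ Ideal.span {P, Q} → eval a F = 0 := fun F hF => by
      have := hle (Submodule.mem_colon_singleton.2 hF)
      simpa using this
    have hP := hmem P (Ideal.mul_mem_right _ _ (Ideal.subset_span (by simp)))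
    have hQ := hmem Q (Ideal.mul_mem_right _ _ (Ideal.subset_span (by simp)))
    obtain ⟨A, B, h1⟩ := mem_span_X_sub_C a P hP
    obtain ⟨A', B', h2⟩ := mem_span_X_sub_C a Q hQ
    obtain ⟨U, V, h3⟩ := mem_span_X_sub_C a h (hh a hP hQ)
    refine htr a hP hQ ?_
    have := hmem (A * B' - B * A') (by
      rw [Ideal.mem_span_pair]
      refine ⟨U * B' - V * A', V * A - U * B, ?_⟩
      rw [h1, h2, h3]; ring)
    rw [h1, h2]
    simpa [pderiv_X] using this
  obtain ⟨A, B, h⟩ := Ideal.mem_span_pair.1 key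
  exact ⟨A, B, h.symm⟩

/-- If the top forms of `P` and `Q` are coprime, elements of the ideal `(P, Q)` of degree at most
`u + v` have coefficients of degrees at most `v` and `u`. -/
theorem exists_totalDegree_le_of_isRelPrime {P Q : MvPolynomial (Fin 2) K} {u v : ℕ}
    (hP : P.totalDegree ≤ u) (hQ : Q.totalDegree ≤ v)
    (hrel : IsRelPrime (homogeneousComponent u P) (homogeneousComponent v Q))
    (hQ0 : homogeneousComponent v Q ≠ 0) (n : ℕ)
    {A B : MvPolynomial (Fin 2) K} (hA : A.totalDegree ≤ v + n) (hB : B.totalDegree ≤ u + n)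
    (hAB : (A * P + B * Q).totalDegree ≤ u + v) :
    ∃ A' B' : MvPolynomial (Fin 2) K, A'.totalDegree ≤ v ∧ B'.totalDegree ≤ u ∧
      A' * P + B' * Q = A * P + B * Q := by
  induction n generalizing A B with
  | zero => exact ⟨A, B, hA, hB, rfl⟩
  | succ n ih =>
    have h0 : homogeneousComponent (v + (n + 1)) A * homogeneousComponent u P +
        homogeneousComponent (u + (n + 1)) B * homogeneousComponent v Q = 0 := by
      rw [← homogeneousComponent_add_mul hA hP, ← homogeneousComponent_add_mul hB hQ,
        show v + (n + 1) + u = u + (n + 1) + v by ring, ← map_add]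
      exact homogeneousComponent_eq_zero _ _ (by omega)
    have htop : ∀ (F : MvPolynomial (Fin 2) K) (m : ℕ),
        homogeneousComponent m (homogeneousComponent m F) = homogeneousComponent m F :=
      fun F m => homogeneousComponent_eq_self (homogeneousComponent_isHomogeneous m F)
    obtain ⟨c, hc⟩ : homogeneousComponent v Q ∣ homogeneousComponent (v + (n + 1)) A := by
      refine hrel.symm.dvd_of_dvd_mul_right ⟨-homogeneousComponent (u + (n + 1)) B, ?_⟩
      linear_combination h0
    have hcdeg : c.totalDegree ≤ n + 1 := by
      by_cases hc0 : c = 0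
      · simp [hc0]
      have h1 := totalDegree_mul_of_isDomain hQ0 hc0
      rw [← hc, (homogeneousComponent_isHomogeneous v Q).totalDegree hQ0] at h1
      have := (homogeneousComponent_isHomogeneous (v + (n + 1)) A).totalDegree_le
      omega
    obtain ⟨e, he, hedeg, hetop⟩ : ∃ e, homogeneousComponent (v + (n + 1)) A =
        homogeneousComponent v Q * e ∧ e.totalDegree ≤ n + 1 ∧
        homogeneousComponent (n + 1) e = e := by
      refine ⟨homogeneousComponent (n + 1) c, ?_,
        (homogeneousComponent_isHomogeneous _ _).totalDegree_le, htop _ _⟩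
      have := homogeneousComponent_add_mul
        (homogeneousComponent_isHomogeneous v Q).totalDegree_le hcdeg
      rwa [← hc, htop, htop] at this
    have heB : homogeneousComponent (u + (n + 1)) B = -(homogeneousComponent u P * e) := by
      refine mul_right_cancel₀ hQ0 ?_
      rw [he] at h0
      linear_combination h0
    have key : (A - Q * e) * P + (B + P * e) * Q = A * P + B * Q := by ring
    rw [← key] at hAB ⊢
    refine ih ?_ ?_ hAB
    · refine totalDegree_lt_of_homogeneousComponent_eq_zero (n := v + n)
        ((totalDegree_sub _ _).trans (max_le hA ?_)) ?_
      · exact (totalDegree_mul _ _).trans (by omega)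
      · rw [map_sub, add_assoc, homogeneousComponent_add_mul hQ hedeg, he, hetop, sub_self]
    · refine totalDegree_lt_of_homogeneousComponent_eq_zero (n := u + n)
        ((totalDegree_add _ _).trans (max_le hB ?_)) ?_
      · exact (totalDegree_mul _ _).trans (by omega)
      · rw [map_add, add_assoc, homogeneousComponent_add_mul hP hedeg, heB, hetop,
          neg_add_cancel]

/-- Bézout bound: two plane curves without common points at infinity which meet transversally
have at least as many common points as the product of their degrees. -/
theorem mul_le_card_of_transversal [IsAlgClosed K] {P Q : MvPolynomial (Fin 2) K} {u v : ℕ}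
    (hP : P.totalDegree ≤ u) (hQ : Q.totalDegree ≤ v)
    (hrel : IsRelPrime (homogeneousComponent u P) (homogeneousComponent v Q))
    (hQ0 : homogeneousComponent v Q ≠ 0)
    (htr : ∀ a : Fin 2 → K, eval a P = 0 → eval a Q = 0 →
      eval a (pderiv 0 P) * eval a (pderiv 1 Q) - eval a (pderiv 1 P) * eval a (pderiv 0 Q) ≠ 0)
    (Z : Finset (Fin 2 → K)) (hZ : ∀ a, eval a P = 0 → eval a Q = 0 → a ∈ Z) :
    u * v ≤ Z.card := by
  let V := restrictTotalDegree (Fin 2) K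
  let ev : V (u + v) →ₗ[K] (Z → K) :=
    (LinearMap.pi fun a : Z => (aeval (R := K) (a : Fin 2 → K)).toLinearMap).comp
      (V (u + v)).subtype
  let comb : (V v × V u) →ₗ[K] MvPolynomial (Fin 2) K :=
    ((LinearMap.mulRight K P).comp (V v).subtype).coprod
      ((LinearMap.mulRight K Q).comp (V u).subtype)
  have hcomb : ∀ x, comb x = (x.1 : MvPolynomial (Fin 2) K) * P + x.2 * Q := fun x => rfl
  have hker : (LinearMap.ker ev).map (V (u + v)).subtype ≤ LinearMap.range comb := by
    rintro _ ⟨⟨h, hdeg⟩, hh, rfl⟩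
    rw [mem_restrictTotalDegree] at hdeg
    obtain ⟨A, B, rfl⟩ := mem_span_pair_of_transversal (h := h) htr fun a h1 h2 => by
      have := congrFun (LinearMap.mem_ker.1 hh) ⟨a, hZ a h1 h2⟩
      simpa [ev] using this
    obtain ⟨A', B', hA', hB', he⟩ := exists_totalDegree_le_of_isRelPrime hP hQ hrel hQ0
      (A.totalDegree + B.totalDegree) (A := A) (B := B) (by omega) (by omega) hdeg
    exact ⟨(⟨A', (mem_restrictTotalDegree _ _ _).2 hA'⟩,
      ⟨B', (mem_restrictTotalDegree _ _ _).2 hB'⟩), by rw [hcomb]; exact he⟩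
  have h1 : Module.finrank K (LinearMap.ker ev) ≤ Module.finrank K (LinearMap.range comb) := by
    rw [← Submodule.finrank_map_subtype_eq]
    exact Submodule.finrank_mono hker
  have h2 := LinearMap.finrank_range_add_finrank_ker ev
  have h3 := LinearMap.finrank_range_add_finrank_ker comb
  have h4 : Module.finrank K (LinearMap.range ev) ≤ Z.card := by
    simpa using Submodule.finrank_le (LinearMap.range ev)
  have h5 : 0 < Module.finrank K (LinearMap.ker comb) := by
    have hQne : Q ≠ 0 := by rintro rfl; simp at hQ0
    refine Nat.pos_of_ne_zero fun h => hQne ?_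
    have hmem : ((⟨Q, (mem_restrictTotalDegree _ _ _).2 hQ⟩,
        ⟨-P, (mem_restrictTotalDegree _ _ _).2 (by rwa [totalDegree_neg])⟩) : V v × V u) ∈
          LinearMap.ker comb := by
      rw [LinearMap.mem_ker, hcomb]
      ring
    rw [Submodule.finrank_eq_zero.1 h, Submodule.mem_bot] at hmem
    exact congrArg (fun x => (x.1.1 : MvPolynomial (Fin 2) K)) hmem
  rw [Module.finrank_prod] at h3
  simp only [V, finrank_restrictTotalDegree_fin_two] at h2 h3
  have c : ∀ n : ℕ, 2 * (n + 2).choose 2 = (n + 2) * (n + 1) := fun n => by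
    rw [Nat.choose_two_right, Nat.mul_div_cancel' (Nat.even_mul_pred_self _).two_dvd]; rfl
  have c1 := c u
  have c2 := c v
  have c3 := c (u + v)
  nlinarith

theorem add_one_pow_ne_pow {x : K} {n : ℕ} (hn : n ≠ 0) (h : (x + 1) ^ (n + 1) = x ^ (n + 1)) :
    (x + 1) ^ n ≠ x ^ n := by
  intro he
  have h0 : x ^ n = 0 := by
    rw [pow_succ, pow_succ, he] at h
    linear_combination h
  have hx : x = 0 := pow_eq_zero_iff hn |>.1 h0
  rw [h0, pow_eq_zero_iff hn, hx] at he
  simp at he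

/-- The polynomial `(x+1)^t - x^t - (y+1)^t + y^t`. -/
def diffPoly (K : Type*) [Field K] (t : ℕ) : MvPolynomial (Fin 2) K :=
  (X 0 + 1) ^ t - X 0 ^ t - (X 1 + 1) ^ t + X 1 ^ t

theorem pderiv_zero_diffPoly (t : ℕ) :
    pderiv 0 (diffPoly K t) = C (t : K) * ((X 0 + 1) ^ (t - 1) - X 0 ^ (t - 1)) := by
  simp [diffPoly, Derivation.leibniz_pow, pderiv_X]
  ring

theorem pderiv_one_diffPoly (t : ℕ) :
    pderiv 1 (diffPoly K t) = -(C (t : K) * ((X 1 + 1) ^ (t - 1) - X 1 ^ (t - 1))) := by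
  simp [diffPoly, Derivation.leibniz_pow, pderiv_X]
  ring

theorem pderiv_zero_zero_diffPoly (t : ℕ) :
    pderiv 0 (pderiv 0 (diffPoly K t)) =
      C ((t : K) * (t - 1 : ℕ)) * ((X 0 + 1) ^ (t - 2) - X 0 ^ (t - 2)) := by
  rw [pderiv_zero_diffPoly]
  simp [Derivation.leibniz_pow, pderiv_X, Nat.sub_sub]
  ring

theorem pderiv_one_one_diffPoly (t : ℕ) :
    pderiv 1 (pderiv 1 (diffPoly K t)) =
      -(C ((t : K) * (t - 1 : ℕ)) * ((X 1 + 1) ^ (t - 2) - X 1 ^ (t - 2))) := by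
  rw [pderiv_one_diffPoly]
  simp [Derivation.leibniz_pow, pderiv_X, Nat.sub_sub]
  ring

theorem pderiv_one_zero_diffPoly (t : ℕ) : pderiv 1 (pderiv 0 (diffPoly K t)) = 0 := by
  rw [pderiv_zero_diffPoly]
  simp [Derivation.leibniz_pow, pderiv_X]

theorem eval_pderiv_zero_zero_diffPoly_ne_zero {t : ℕ} (ht : 3 ≤ t) (h0 : (t : K) ≠ 0)
    (h1 : ((t - 1 : ℕ) : K) ≠ 0) {a : Fin 2 → K}
    (ha : eval a (pderiv 0 (diffPoly K t)) = 0) :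
    eval a (pderiv 0 (pderiv 0 (diffPoly K t))) ≠ 0 := by
  obtain ⟨n, rfl⟩ : ∃ n, t = n + 2 := ⟨t - 2, by omega⟩
  rw [pderiv_zero_diffPoly] at ha
  rw [pderiv_zero_zero_diffPoly]
  simp only [map_mul, map_sub, map_pow, map_add, eval_X, eval_C, map_one] at ha ⊢
  refine mul_ne_zero (mul_ne_zero h0 h1) (sub_ne_zero.2 (add_one_pow_ne_pow (by omega) ?_))
  exact sub_eq_zero.1 ((mul_eq_zero.1 ha).resolve_left h0)

theorem eval_pderiv_one_one_diffPoly_ne_zero {t : ℕ} (ht : 3 ≤ t) (h0 : (t : K) ≠ 0)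
    (h1 : ((t - 1 : ℕ) : K) ≠ 0) {a : Fin 2 → K}
    (ha : eval a (pderiv 1 (diffPoly K t)) = 0) :
    eval a (pderiv 1 (pderiv 1 (diffPoly K t))) ≠ 0 := by
  obtain ⟨n, rfl⟩ : ∃ n, t = n + 2 := ⟨t - 2, by omega⟩
  rw [pderiv_one_diffPoly] at ha
  rw [pderiv_one_one_diffPoly]
  simp only [map_neg, neg_ne_zero, neg_eq_zero, map_mul, map_sub, map_pow, map_add, eval_X,
    eval_C, map_one] at ha ⊢
  refine mul_ne_zero (mul_ne_zero h0 h1) (sub_ne_zero.2 (add_one_pow_ne_pow (by omega) ?_))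
  exact sub_eq_zero.1 ((mul_eq_zero.1 ha).resolve_left h0)

theorem not_three_factors_vanish {t : ℕ} (ht : 3 ≤ t) (h0 : (t : K) ≠ 0)
    (h1 : ((t - 1 : ℕ) : K) ≠ 0) {A B D E : MvPolynomial (Fin 2) K}
    (hF : diffPoly K t = A * B * D * E) {a : Fin 2 → K} (hA : eval a A = 0) (hB : eval a B = 0)
    (hD : eval a D = 0) : False := by
  refine eval_pderiv_zero_zero_diffPoly_ne_zero ht h0 h1 (a := a) ?_ ?_ <;>
  · rw [hF]
    simp [Derivation.leibniz, hA, hB, hD]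

/-- A common zero of two complementary factors of `g_t` is a point of `S_t`, and the two factors
meet transversally there. -/
theorem transversal_of_two_factors_vanish {t : ℕ} (ht : 3 ≤ t) (h0 : (t : K) ≠ 0)
    (h1 : ((t - 1 : ℕ) : K) ≠ 0) (h2 : (2 : K) ≠ 0) {A B : MvPolynomial (Fin 2) K}
    (hF : diffPoly K t = (X 0 - X 1) * (A * B)) {a : Fin 2 → K}
    (hA : eval a A = 0) (hB : eval a B = 0) :
    (a 0 ≠ a 1 ∧ (a 0 + 1) ^ (t - 1) = a 0 ^ (t - 1) ∧ (a 1 + 1) ^ (t - 1) = a 1 ^ (t - 1) ∧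
      a 0 ^ (t - 1) = a 1 ^ (t - 1)) ∧
    eval a (pderiv 0 A) * eval a (pderiv 1 B) - eval a (pderiv 1 A) * eval a (pderiv 0 B) ≠ 0 := by
  have hne : a 0 ≠ a 1 := fun h =>
    not_three_factors_vanish ht h0 h1 (A := X 0 - X 1) (B := A) (D := B) (E := 1) (a := a)
      (by rw [hF]; ring) (by simp [h]) hA hB
  have d0 : eval a (pderiv 0 (diffPoly K t)) = 0 := by
    rw [hF]; simp [Derivation.leibniz, hA, hB]
  have d1 : eval a (pderiv 1 (diffPoly K t)) = 0 := by
    rw [hF]; simp [Derivation.leibniz, hA, hB]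
  have d00 := eval_pderiv_zero_zero_diffPoly_ne_zero ht h0 h1 d0
  have d11 := eval_pderiv_one_one_diffPoly_ne_zero ht h0 h1 d1
  have d10 : eval a (pderiv 1 (pderiv 0 (diffPoly K t))) = 0 := by
    rw [pderiv_one_zero_diffPoly, map_zero]
  have hv : eval a (diffPoly K t) = 0 := by rw [hF]; simp [hA]
  refine ⟨?_, fun hj => ?_⟩
  · rw [pderiv_zero_diffPoly] at d0
    rw [pderiv_one_diffPoly] at d1
    simp only [map_neg, neg_eq_zero, map_mul, map_sub, map_pow, map_add, eval_X,
      eval_C, map_one, h0, mul_eq_zero, false_or, sub_eq_zero] at d0 d1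
    refine ⟨hne, d0, d1, ?_⟩
    obtain ⟨n, rfl⟩ : ∃ n, t = n + 1 := ⟨t - 1, by omega⟩
    simp only [diffPoly, map_sub, map_pow, map_add, eval_X, map_one] at hv
    rw [Nat.add_sub_cancel] at d0 d1 ⊢
    rw [pow_succ, pow_succ, pow_succ, pow_succ, d0, d1] at hv
    linear_combination hv
  · rw [hF] at d00 d11 d10
    have hd : ∀ i j, eval a (pderiv i (pderiv j ((X 0 - X 1) * (A * B)))) = (a 0 - a 1) *
        (eval a (pderiv i A) * eval a (pderiv j B) + eval a (pderiv j A) * eval a (pderiv i B)) := by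
      intro i j
      simp only [Derivation.leibniz, smul_eq_mul, map_add, map_mul, hA, hB, map_sub, eval_X]
      ring
    rw [hd] at d00 d11 d10
    have hs := (mul_eq_zero.1 d10).resolve_left (sub_ne_zero.2 hne)
    have hz : 2 * (eval a (pderiv 0 A) * eval a (pderiv 1 B)) = 0 := by linear_combination hs + hj
    rcases mul_eq_zero.1 ((mul_eq_zero.1 hz).resolve_left h2) with h | h
    · exact d00 (by rw [h]; ring)
    · exact d11 (by rw [h]; ring)

theorem top_add_one_pow_sub_pow {σ : Type*} (i : σ) (n : ℕ) :
    ((X i + 1) ^ (n + 1) - X i ^ (n + 1) : MvPolynomial σ K).totalDegree ≤ n ∧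
    homogeneousComponent n ((X i + 1) ^ (n + 1) - X i ^ (n + 1) : MvPolynomial σ K) =
      C ((n + 1 : ℕ) : K) * X i ^ n := by
  have h : ((X i + 1) ^ (n + 1) - X i ^ (n + 1) : MvPolynomial σ K) =
      ∑ k ∈ Finset.range (n + 1), C ((n + 1).choose k : K) * X i ^ k := by
    rw [add_pow, Finset.sum_range_succ]
    simp [mul_comm]
  have hom : ∀ k, (C ((n + 1).choose k : K) * X i ^ k : MvPolynomial σ K).IsHomogeneous k :=
    fun k => by
      simpa using (isHomogeneous_C σ ((n + 1).choose k : K)).mul ((isHomogeneous_X K i).pow k)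
  rw [h]
  constructor
  · refine totalDegree_finsetSum_le fun k hk => (hom k).totalDegree_le.trans ?_
    rw [Finset.mem_range] at hk
    omega
  · rw [map_sum, Finset.sum_range_succ, Finset.sum_eq_zero, zero_add,
      homogeneousComponent_eq_self (hom n)]
    · simp
    · intro k hk
      rw [homogeneousComponent_of_mem ((mem_homogeneousSubmodule _ _).2 (hom k)), if_neg]
      rw [Finset.mem_range] at hk
      omega

theorem isUnit_of_sq_dvd_X_pow_sub_X_pow {n : ℕ} (hn : (n : K) ≠ 0) {d : MvPolynomial (Fin 2) K}
    (hd : d * d ∣ X 0 ^ n - X 1 ^ n) : IsUnit d := by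
  obtain ⟨e, he⟩ := hd
  have hX : IsRelPrime (X 0 : MvPolynomial (Fin 2) K) (X 1) := by
    rw [(X_prime (i := (0 : Fin 2))).irreducible.isRelPrime_iff_not_dvd, X_dvd_X]
    simp
  have hCn : IsUnit (C (n : K) : MvPolynomial (Fin 2) K) := (isUnit_iff_ne_zero.2 hn).map C
  refine (hX.pow (m := n - 1) (n := n - 1)) ?_ ?_
  · have h := congrArg (pderiv 0) he
    simp [Derivation.leibniz, Derivation.leibniz_pow, pderiv_X] at h
    refine hCn.dvd_mul_left.1 ⟨d * pderiv 0 e + 2 * e * pderiv 0 d, ?_⟩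
    simp
    linear_combination h
  · have h := congrArg (pderiv 1) he
    simp [Derivation.leibniz, Derivation.leibniz_pow, pderiv_X] at h
    refine hCn.dvd_mul_left.1 ⟨-(d * pderiv 1 e + 2 * e * pderiv 1 d), ?_⟩
    simp
    linear_combination -h

theorem top_of_eq_diffPoly {t : ℕ} (ht : 3 ≤ t) (h0 : (t : K) ≠ 0) {G : MvPolynomial (Fin 2) K}
    (hG : diffPoly K t = (X 0 - X 1) * G) :
    G ≠ 0 ∧ G.totalDegree = t - 2 ∧
    (X 0 - X 1) * homogeneousComponent (t - 2) G = C (t : K) * (X 0 ^ (t - 1) - X 1 ^ (t - 1)) := by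
  obtain ⟨n, rfl⟩ : ∃ n, t = n + 2 := ⟨t - 2, by omega⟩
  obtain ⟨d0, c0⟩ := top_add_one_pow_sub_pow (K := K) (0 : Fin 2) (n + 1)
  obtain ⟨d1, c1⟩ := top_add_one_pow_sub_pow (K := K) (1 : Fin 2) (n + 1)
  have hF : diffPoly K (n + 2) = ((X 0 + 1) ^ (n + 2) - X 0 ^ (n + 2)) -
    ((X 1 + 1) ^ (n + 2) - X 1 ^ (n + 2)) := by rw [diffPoly]; ring
  have hFd : (diffPoly K (n + 2)).totalDegree ≤ n + 1 := by
    rw [hF]; exact (totalDegree_sub _ _).trans (max_le d0 d1)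
  have hFc : homogeneousComponent (n + 1) (diffPoly K (n + 2)) =
      C ((n + 2 : ℕ) : K) * (X 0 ^ (n + 1) - X 1 ^ (n + 1)) := by
    rw [hF, map_sub, c0, c1, mul_sub]
  have hne : (C ((n + 2 : ℕ) : K) * (X 0 ^ (n + 1) - X 1 ^ (n + 1)) :
      MvPolynomial (Fin 2) K) ≠ 0 := fun h => by
    have := congrArg (eval ![1, 0]) h
    simp at this
    exact h0 (by exact_mod_cast this)
  have hL : (X 0 - X 1 : MvPolynomial (Fin 2) K).IsHomogeneous 1 :=
    (isHomogeneous_X K 0).sub (isHomogeneous_X K 1)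
  have hL0 : (X 0 - X 1 : MvPolynomial (Fin 2) K) ≠ 0 :=
    sub_ne_zero.2 fun h => by simpa using X_injective h
  have hG0 : G ≠ 0 := by rintro rfl; exact hne (by rw [← hFc, hG, mul_zero, map_zero])
  have hdeg := totalDegree_mul_of_isDomain hL0 hG0
  rw [← hG, hL.totalDegree hL0] at hdeg
  have hGd : G.totalDegree ≤ n := by omega
  have hc : (X 0 - X 1) * homogeneousComponent n G =
      C ((n + 2 : ℕ) : K) * (X 0 ^ (n + 1) - X 1 ^ (n + 1)) := by
    rw [← hFc, hG, add_comm n 1, homogeneousComponent_add_mul hL.totalDegree_le hGd,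
      homogeneousComponent_eq_self hL]
  refine ⟨hG0, le_antisymm hGd (not_lt.1 fun hlt => hne ?_), hc⟩
  rw [← hc, homogeneousComponent_eq_zero n _ hlt, mul_zero]

theorem isRelPrime_top_of_mul {t : ℕ} (ht : 3 ≤ t) (h0 : (t : K) ≠ 0)
    (h1 : ((t - 1 : ℕ) : K) ≠ 0) {P Q : MvPolynomial (Fin 2) K}
    (hG : diffPoly K t = (X 0 - X 1) * (P * Q)) :
    IsRelPrime (homogeneousComponent P.totalDegree P) (homogeneousComponent Q.totalDegree Q) := by
  obtain ⟨hne, hdeg, htop⟩ := top_of_eq_diffPoly ht h0 hG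
  rw [← hdeg, totalDegree_mul_of_isDomain (left_ne_zero_of_mul hne) (right_ne_zero_of_mul hne),
    homogeneousComponent_add_mul le_rfl le_rfl] at htop
  intro d hdP hdQ
  refine isUnit_of_sq_dvd_X_pow_sub_X_pow h1 ?_
  have hCt : IsUnit (C (t : K) : MvPolynomial (Fin 2) K) := (isUnit_iff_ne_zero.2 h0).map C
  rw [← hCt.dvd_mul_left, ← htop]
  exact (mul_dvd_mul hdP hdQ).mul_left _

theorem homogeneousComponent_totalDegree_ne_zero {σ R : Type*} [CommSemiring R]
    {P : MvPolynomial σ R} (hP : P ≠ 0) : homogeneousComponent P.totalDegree P ≠ 0 := by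
  obtain ⟨d, hd, he⟩ := Finset.exists_mem_eq_sup P.support (support_nonempty.2 hP)
    fun s => s.sum fun _ e => e
  intro h
  have := congrArg (coeff d) h
  rw [coeff_homogeneousComponent,
    if_pos (by rw [totalDegree, he]; simp [Finsupp.degree_apply, Finsupp.sum])] at this
  exact mem_support_iff.1 hd this

theorem squarefree_of_eq_diffPoly {t : ℕ} (ht : 3 ≤ t) (h0 : (t : K) ≠ 0)
    (h1 : ((t - 1 : ℕ) : K) ≠ 0) {G : MvPolynomial (Fin 2) K}
    (hG : diffPoly K t = (X 0 - X 1) * G) : Squarefree G := by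
  rintro d ⟨e, rfl⟩
  have hne := (top_of_eq_diffPoly ht h0 hG).1
  have hd : d ≠ 0 := by rintro rfl; simp at hne
  have he : e ≠ 0 := right_ne_zero_of_mul hne
  rw [mul_assoc] at hG
  have h := isRelPrime_top_of_mul ht h0 h1 hG
  rw [totalDegree_mul_of_isDomain hd he, homogeneousComponent_add_mul le_rfl le_rfl] at h
  have hu := h (dvd_refl _) (dvd_mul_right _ _)
  obtain ⟨c, hc, hdc⟩ := isUnit_iff_eq_C_of_isReduced.1 hu
  have h2 := (homogeneousComponent_isHomogeneous d.totalDegree d).totalDegree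
    (homogeneousComponent_totalDegree_ne_zero hd)
  rw [hdc, totalDegree_C] at h2
  rw [totalDegree_eq_zero_iff_eq_C.1 h2.symm] at hd ⊢
  exact (isUnit_iff_ne_zero.2 fun h => hd (by rw [h, C_0])).map C

theorem monic_map_of_injective {σ : Type*} (m : MonomialOrder σ) {f : K →+* K}
    (hf : Function.Injective f) {P : MvPolynomial σ K} (hP : m.Monic P) : m.Monic (map f P) := by
  have hd : m.degree (map f P) = m.degree P := by
    rw [MonomialOrder.degree, MonomialOrder.degree, support_map_of_injective _ hf]
  rw [MonomialOrder.Monic, MonomialOrder.leadingCoeff, hd, coeff_map, hP.coeff_degree, map_one]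

theorem exists_finset_monic_irreducible_dvd {σ : Type*} (m : MonomialOrder σ) {G : MvPolynomial σ K}
    (hG : Squarefree G) (hG0 : G ≠ 0) :
    ∃ Φ : Finset (MvPolynomial σ K), (∀ P, P ∈ Φ ↔ Irreducible P ∧ m.Monic P ∧ P ∣ G) ∧
      Associated (∏ P ∈ Φ, P) G := by
  classical
  let N : MvPolynomial σ K → MvPolynomial σ K := fun P => C (m.leadingCoeff P)⁻¹ * P
  have hunit : ∀ {P : MvPolynomial σ K}, P ≠ 0 →
      IsUnit (C (m.leadingCoeff P)⁻¹ : MvPolynomial σ K) := fun hP =>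
    (isUnit_iff_ne_zero.2 (inv_ne_zero (m.leadingCoeff_ne_zero_iff.2 hP))).map C
  have hassoc : ∀ {P : MvPolynomial σ K}, P ≠ 0 → Associated (N P) P := fun hP =>
    associated_unit_mul_left _ _ (hunit hP)
  have hmonic : ∀ {P : MvPolynomial σ K}, P ≠ 0 → m.Monic (N P) := fun hP => by
    rw [MonomialOrder.Monic, m.leadingCoeff_mul, m.leadingCoeff_C,
      inv_mul_cancel₀ (m.leadingCoeff_ne_zero_iff.2 hP)]
  have huniq : ∀ {P Q : MvPolynomial σ K}, m.Monic P → m.Monic Q → Associated P Q → P = Q := by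
    rintro P _ hP hQ ⟨u, rfl⟩
    obtain ⟨c, -, hc⟩ := isUnit_iff_eq_C_of_isReduced.1 u.isUnit
    rw [hc] at hQ ⊢
    rw [MonomialOrder.Monic, m.leadingCoeff_mul, hP.leadingCoeff_eq_one, m.leadingCoeff_C,
      one_mul] at hQ
    rw [hQ, C_1, mul_one]
  let s := (UniqueFactorizationMonoid.factors G).map N
  have hirr : ∀ P ∈ UniqueFactorizationMonoid.factors G, Irreducible P :=
    UniqueFactorizationMonoid.irreducible_of_factor
  have hprod : Associated s.prod G := by
    refine Associated.trans ?_ (UniqueFactorizationMonoid.factors_prod hG0)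
    have : ∀ r : Multiset (MvPolynomial σ K), (∀ P ∈ r, P ≠ 0) →
        Associated (r.map N).prod r.prod := by
      intro r
      induction r using Multiset.induction_on with
      | empty => intro; simp
      | cons a r ih =>
        intro h
        rw [Multiset.map_cons, Multiset.prod_cons, Multiset.prod_cons]
        exact (hassoc (h a (by simp))).mul_mul (ih fun P hP => h P (by simp [hP]))
    exact this _ fun P hP => (hirr P hP).ne_zero
  have hs : ∀ P ∈ s, Irreducible P ∧ m.Monic P := by
    intro P hP
    obtain ⟨Q, hQ, rfl⟩ := Multiset.mem_map.1 hP
    have := hirr Q hQ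
    exact ⟨(hassoc this.ne_zero).irreducible_iff.2 this, hmonic this.ne_zero⟩
  have hnodup : s.Nodup := by
    rw [Multiset.nodup_iff_le]
    intro a ha
    have hdvd := (Multiset.prod_dvd_prod_of_le ha).trans hprod.dvd
    rw [Multiset.prod_cons, Multiset.prod_cons, Multiset.prod_zero, mul_one] at hdvd
    exact (hs a (Multiset.mem_of_le ha (by simp))).1.not_isUnit (hG a hdvd)
  refine ⟨⟨s, hnodup⟩, fun P => ⟨fun hP => ?_, fun ⟨h1, h2, h3⟩ => ?_⟩, ?_⟩
  · exact ⟨(hs P hP).1, (hs P hP).2, (Multiset.dvd_prod hP).trans hprod.dvd⟩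
  · obtain ⟨Q, hQ, hPQ⟩ := UniqueFactorizationMonoid.exists_mem_factors_of_dvd hG0 h1 h3
    have hQ0 := (hirr Q hQ).ne_zero
    rw [huniq h2 (hmonic hQ0) (hPQ.trans (hassoc hQ0).symm)]
    exact Multiset.mem_map_of_mem N hQ
  · simpa [Finset.prod] using hprod

theorem totalDegree_prod_of_ne_zero {ι σ : Type*} (s : Finset ι) (f : ι → MvPolynomial σ K)
    (hf : ∀ i ∈ s, f i ≠ 0) : (∏ i ∈ s, f i).totalDegree = ∑ i ∈ s, (f i).totalDegree := by
  classical
  induction s using Finset.induction_on with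
  | empty => simp
  | insert i s hi ih =>
    rw [Finset.prod_insert hi, Finset.sum_insert hi, totalDegree_mul_of_isDomain (hf i (by simp))
      (Finset.prod_ne_zero_iff.2 fun j hj => hf j (by simp [hj])),
      ih fun j hj => hf j (by simp [hj])]

theorem two_mul_sum_sq_le_sq_sum {ι : Type*} {s : Finset ι} {d : ι → ℕ}
    (h : ∀ i ∈ s, ∃ j ∈ s, j ≠ i ∧ d j = d i) :
    2 * ∑ i ∈ s, d i ^ 2 ≤ (∑ i ∈ s, d i) ^ 2 := by
  classical
  rw [sq, Finset.sum_mul, Finset.mul_sum]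
  refine Finset.sum_le_sum fun i hi => ?_
  obtain ⟨j, hj, hji, hd⟩ := h i hi
  have : d i + d j ≤ ∑ k ∈ s, d k := by
    rw [← Finset.sum_pair hji.symm]
    exact Finset.sum_le_sum_of_subset (by simp [Finset.insert_subset_iff, hi, hj])
  calc 2 * d i ^ 2 = d i * (d i + d j) := by rw [hd]; ring
    _ ≤ _ := Nat.mul_le_mul_left _ this

/-- If every irreducible factor of `g_t` is accompanied by another one of the same degree, then
`g_t` has at least `(t - 2)² / 4` singular points. -/
theorem sq_le_four_mul_card_of_paired_factors [IsAlgClosed K] {t : ℕ} (ht : 3 ≤ t)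
    (h0 : (t : K) ≠ 0) (h1 : ((t - 1 : ℕ) : K) ≠ 0) (h2 : (2 : K) ≠ 0)
    {G : MvPolynomial (Fin 2) K} (hG : diffPoly K t = (X 0 - X 1) * G)
    {Φ : Finset (MvPolynomial (Fin 2) K)} (hirr : ∀ P ∈ Φ, Irreducible P)
    (hprod : Associated (∏ P ∈ Φ, P) G)
    (hpair : ∀ P ∈ Φ, ∃ P' ∈ Φ, P' ≠ P ∧ P'.totalDegree = P.totalDegree)
    (S : Finset (Fin 2 → K))
    (hS : ∀ a : Fin 2 → K, a 0 ≠ a 1 → (a 0 + 1) ^ (t - 1) = a 0 ^ (t - 1) →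
      (a 1 + 1) ^ (t - 1) = a 1 ^ (t - 1) → a 0 ^ (t - 1) = a 1 ^ (t - 1) → a ∈ S) :
    (t - 2) ^ 2 ≤ 4 * S.card := by
  classical
  obtain ⟨hG0, hdeg, -⟩ := top_of_eq_diffPoly ht h0 hG
  have hsum : ∑ P ∈ Φ, P.totalDegree = t - 2 := by
    rw [← totalDegree_prod_of_ne_zero Φ (fun P => P) fun P hP => (hirr P hP).ne_zero, ← hdeg]
    have := hprod.ne_zero_iff.2 hG0
    exact le_antisymm (totalDegree_le_of_dvd_of_isDomain hprod.dvd hG0)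
      (totalDegree_le_of_dvd_of_isDomain hprod.symm.dvd this)
  have hpt : ∀ P ∈ Φ, P.totalDegree * (t - 2 - P.totalDegree) ≤ {a ∈ S | eval a P = 0}.card := by
    intro P hP
    obtain ⟨Q, rfl⟩ : P ∣ G := (Finset.dvd_prod_of_mem (fun P => P) hP).trans hprod.dvd
    have hQ0 : Q ≠ 0 := right_ne_zero_of_mul hG0
    rw [← hdeg, totalDegree_mul_of_isDomain (left_ne_zero_of_mul hG0) hQ0, Nat.add_sub_cancel_left]
    refine mul_le_card_of_transversal le_rfl le_rfl (isRelPrime_top_of_mul ht h0 h1 hG)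
      (homogeneousComponent_totalDegree_ne_zero hQ0)
      (fun a ha hb => (transversal_of_two_factors_vanish ht h0 h1 h2 hG ha hb).2) _
      fun a ha hb => ?_
    obtain ⟨⟨e1, e2, e3, e4⟩, -⟩ := transversal_of_two_factors_vanish ht h0 h1 h2 hG ha hb
    exact Finset.mem_filter.2 ⟨hS a e1 e2 e3 e4, ha⟩
  have hle : ∀ a : Fin 2 → K, {P ∈ Φ | eval a P = 0}.card ≤ 2 := by
    intro a
    by_contra! hcard
    obtain ⟨A, hA, B, hB, D, hD, hAB, hAD, hBD⟩ := Finset.two_lt_card.1 hcard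
    simp only [Finset.mem_filter] at hA hB hD
    obtain ⟨E, hE⟩ : A * (B * D) ∣ G := by
      refine dvd_trans ?_ hprod.dvd
      have h3 : ({A, B, D} : Finset (MvPolynomial (Fin 2) K)) ⊆ Φ := by
        simp [Finset.insert_subset_iff, hA, hB, hD]
      have := Finset.prod_dvd_prod_of_subset _ _ (fun P => P) h3
      rwa [Finset.prod_insert (by simp [hAB, hAD]), Finset.prod_pair hBD] at this
    exact not_three_factors_vanish ht h0 h1 (E := E * (X 0 - X 1))
      (by rw [hG, hE]; ring) hA.2 hB.2 hD.2
  have hcount : ∑ P ∈ Φ, P.totalDegree * (t - 2 - P.totalDegree) ≤ 2 * S.card := by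
    calc _ ≤ ∑ P ∈ Φ, {a ∈ S | eval a P = 0}.card := Finset.sum_le_sum hpt
      _ = ∑ a ∈ S, {P ∈ Φ | eval a P = 0}.card :=
          Finset.sum_card_bipartiteAbove_eq_sum_card_bipartiteBelow _
      _ ≤ ∑ a ∈ S, 2 := Finset.sum_le_sum fun a _ => hle a
      _ = 2 * S.card := by simp [mul_comm]
  have hsplit : ∑ P ∈ Φ, P.totalDegree * (t - 2 - P.totalDegree) + ∑ P ∈ Φ, P.totalDegree ^ 2 =
      (t - 2) ^ 2 := by
    rw [← Finset.sum_add_distrib, sq (t - 2)]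
    nth_rewrite 2 [← hsum]
    rw [Finset.sum_mul]
    refine Finset.sum_congr rfl fun P hP => ?_
    have hPle : P.totalDegree ≤ t - 2 := hsum ▸
      Finset.single_le_sum (f := fun P : MvPolynomial (Fin 2) K => P.totalDegree)
        (fun _ _ => Nat.zero_le _) hP
    rw [sq, ← mul_add, Nat.sub_add_cancel hPle]
  have hsq := two_mul_sum_sq_le_sq_sum hpair
  rw [hsum] at hsq
  omega

theorem finite_add_one_pow_eq_pow {n : ℕ} (hn : n ≠ 0) :
    {x : K | (x + 1) ^ n = x ^ n}.Finite := by
  have h : ((Polynomial.X + 1) ^ n - Polynomial.X ^ n : Polynomial K) ≠ 0 := by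
    intro h
    simpa [hn] using congrArg (Polynomial.eval 0) h
  refine (Polynomial.finite_setOfPred_isRoot h).subset fun x hx => ?_
  simpa [Polynomial.IsRoot, sub_eq_zero] using hx

theorem mem_range_map_of_map_frobenius_eq {σ L : Type*} (p : ℕ) [Fact p.Prime] [Field L]
    [Algebra (ZMod p) L] [CharP L p] {P : MvPolynomial σ L}
    (hP : map (frobenius L p) P = P) : ∃ Q, map (algebraMap (ZMod p) L) Q = P := by
  refine mem_range_map_iff_coeffs_subset.2 fun c hc => ?_
  obtain ⟨d, -, rfl⟩ := mem_coeffs_iff.1 hc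
  have h : coeff d P ^ p = coeff d P := by
    have := congrArg (coeff d) hP
    rwa [coeff_map, frobenius_def] at this
  rw [← Subfield.mem_bot_iff_pow_eq_self] at h
  have hle : (⊥ : Subfield L) ≤ (algebraMap (ZMod p) L).fieldRange := bot_le
  exact hle h

/-- Case (A), condition (b): if the number of singular points of the curve
`g_t = 0` is less than `(t-2)²/4`, then `g_t` has an absolutely irreducible
factor over `F_p`. -/
theorem gt_has_abs_irred_factor_of_few_singular_points
    (p t : ℕ) [Fact p.Prime] (hp2 : p ≠ 2) (ht : 3 ≤ t) (hpt : ¬ p ∣ t)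
    (g : MvPolynomial (Fin 2) (ZMod p))
    (hg : ((X 0 + 1) ^ t - X 0 ^ t - (X 1 + 1) ^ t + X 1 ^ t : MvPolynomial (Fin 2) (ZMod p))
        = (X 0 - X 1) * g)
    (hte : Even t) (h0 : t % p ≠ 0) (h1 : t % p ≠ 1)
    (hS : 4 * ({P : AlgebraicClosure (ZMod p) × AlgebraicClosure (ZMod p) |
        P.1 ≠ P.2 ∧ (P.1 + 1) ^ (t - 1) = P.1 ^ (t - 1) ∧
        (P.2 + 1) ^ (t - 1) = P.2 ^ (t - 1) ∧
        P.1 ^ (t - 1) = P.2 ^ (t - 1)}.ncard) < (t - 2) ^ 2) :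
    ∃ h : MvPolynomial (Fin 2) (ZMod p), 0 < h.totalDegree ∧ h ∣ g ∧
      Irreducible (MvPolynomial.map (algebraMap (ZMod p) (AlgebraicClosure (ZMod p))) h) := by
  classical
  by_contra! hcon
  set L := AlgebraicClosure (ZMod p)
  have ht0 : (t : L) ≠ 0 := fun h => hpt ((CharP.cast_eq_zero_iff L p t).1 h)
  have ht1 : ((t - 1 : ℕ) : L) ≠ 0 := fun h => by
    obtain ⟨k, hk⟩ := (CharP.cast_eq_zero_iff L p (t - 1)).1 h
    have hp := (Fact.out : p.Prime).one_lt
    rw [show t = 1 + p * k by omega, Nat.add_mul_mod_self_left, Nat.mod_eq_of_lt hp] at h1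
    exact h1 rfl
  have ht2 : (2 : L) ≠ 0 := Ring.two_ne_zero (by rwa [ringChar.eq L p])
  set ι := algebraMap (ZMod p) L
  have hι : Function.Injective ι := ι.injective
  set G := map ι g with hGdef
  have hG : diffPoly L t = (X 0 - X 1) * G := by
    have := congrArg (map ι) hg
    simpa [diffPoly] using this
  have hG0 := (top_of_eq_diffPoly ht ht0 hG).1
  let m : MonomialOrder (Fin 2) := MonomialOrder.lex
  obtain ⟨Φ, hΦ, hprod⟩ := exists_finset_monic_irreducible_dvd m
    (squarefree_of_eq_diffPoly ht ht0 ht1 hG) hG0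
  let φ := map (σ := Fin 2) (frobenius L p)
  have hφι : ∀ q, φ (map ι q) = map ι q := fun q => by
    have : (frobenius L p).comp ι = ι := RingHom.ext_zmod _ _
    rw [MvPolynomial.map_map, this]
  have hφG : φ G = G := hφι g
  have hpair : ∀ P ∈ Φ, ∃ P' ∈ Φ, P' ≠ P ∧ P'.totalDegree = P.totalDegree := by
    intro P hP
    obtain ⟨hirr, hmon, Q, hQ⟩ := (hΦ P).1 hP
    refine ⟨φ P, (hΦ _).2 ⟨?_, ?_, φ Q, ?_⟩, fun hfix => ?_, ?_⟩
    · exact (MulEquiv.irreducible_iff (mapEquiv (Fin 2) (frobeniusEquiv L p))).2 hirr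
    · exact monic_map_of_injective m (frobenius_inj L p) hmon
    · rw [← hφG, hQ, map_mul]
    · have hfixQ : φ Q = Q := by
        refine mul_left_cancel₀ hirr.ne_zero ?_
        rw [← hQ, ← hφG, hQ, map_mul, hfix]
      obtain ⟨P₀, rfl⟩ := mem_range_map_of_map_frobenius_eq p hfix
      obtain ⟨Q₀, rfl⟩ := mem_range_map_of_map_frobenius_eq p hfixQ
      refine hcon P₀ (Nat.pos_of_ne_zero fun h => hirr.not_isUnit ?_) ⟨Q₀, ?_⟩ hirr
      · have hP0 := hirr.ne_zero
        rw [totalDegree_eq_zero_iff_eq_C.1 h, map_C] at hP0 ⊢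
        exact (isUnit_iff_ne_zero.2 fun h => hP0 (by rw [h, C_0])).map C
      · exact map_injective ι hι (by rw [map_mul, ← hQ])
    · rw [totalDegree, totalDegree, support_map_of_injective _ (frobenius_inj L p)]
  have hfin := finite_add_one_pow_eq_pow (K := L) (n := t - 1) (by omega)
  set S := {P : L × L | P.1 ≠ P.2 ∧ (P.1 + 1) ^ (t - 1) = P.1 ^ (t - 1) ∧
        (P.2 + 1) ^ (t - 1) = P.2 ^ (t - 1) ∧ P.1 ^ (t - 1) = P.2 ^ (t - 1)}
  have hSfin : S.Finite := (hfin.prod hfin).subset fun P hP => ⟨hP.2.1, hP.2.2.1⟩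
  have hmain := sq_le_four_mul_card_of_paired_factors ht ht0 ht1 ht2 hG
    (fun P hP => ((hΦ P).1 hP).1) hprod hpair (hSfin.toFinset.image fun P => ![P.1, P.2])
    fun a e1 e2 e3 e4 => Finset.mem_image.2
      ⟨(a 0, a 1), hSfin.mem_toFinset.2 ⟨e1, e2, e3, e4⟩, by ext i; fin_cases i <;> rfl⟩
  rw [Set.ncard_eq_toFinset_card S hSfin] at hS
  have := Finset.card_image_le (s := hSfin.toFinset) (f := fun P => ![P.1, P.2])
  omega
end
end

section
/- Assume t is even and t is congruent to neither 0 nor 1 modulo p. Suppose that for every s ∈ F̄_p with s^{t−1} = 1 and s ≠ 1 one has (s−1)^{t−1} ∉ F_p and (s−1)^{(t−1)(p−1)} ≠ −1. Then g_t(x,y) has an absolutely irreducible factor over F_p. -/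
section

open Polynomial

theorem natDegree_resultant_le {R : Type*} [CommRing R] (A B : R[X][X]) (d e : ℕ)
    (hA : ∀ i, A.coeff i ≠ 0 → (A.coeff i).natDegree + i ≤ d)
    (hB : ∀ i, B.coeff i ≠ 0 → (B.coeff i).natDegree + i ≤ e) :
    (A.resultant B d e).natDegree ≤ d * e := by
  rw [resultant, Matrix.det_apply]
  refine natDegree_sum_le_of_forall_le _ _ fun σ _ ↦ ?_
  refine (natDegree_smul_le _ _).trans ?_
  by_cases h0 : ∀ i, A.sylvester B d e (σ i) i ≠ 0
  · refine (natDegree_prod_le _ _).trans ?_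
    have key : ∀ i : Fin (d + e), ((A.sylvester B d e (σ i) i).natDegree : ℤ) ≤
        (i : ℕ) - (σ i : ℕ) + Fin.addCases (fun _ : Fin d ↦ (e : ℤ)) (fun _ : Fin e ↦ 0) i := by
      intro i
      have h := h0 i
      simp only [sylvester, Matrix.of_apply] at h ⊢
      induction i using Fin.addCases with
      | left j =>
        simp only [Fin.addCases_left, Fin.val_castAdd] at h ⊢
        split_ifs at h ⊢ with h1
        · have := hB _ h
          simp only [Set.mem_Icc] at h1
          lia
        · exact (h rfl).elim
      | right j =>
        simp only [Fin.addCases_right, Fin.val_natAdd] at h ⊢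
        split_ifs at h ⊢ with h1
        · have := hA _ h
          simp only [Set.mem_Icc] at h1
          lia
        · exact (h rfl).elim
    zify
    refine (Finset.sum_le_sum fun i _ ↦ key i).trans ?_
    rw [Finset.sum_add_distrib, Finset.sum_sub_distrib,
      Equiv.sum_comp σ (fun i : Fin (d + e) ↦ ((i : ℕ) : ℤ)), sub_self, zero_add, Fin.sum_univ_add]
    simp only [Fin.addCases_left, Fin.addCases_right]
    simp
  · push Not at h0
    obtain ⟨i, hi⟩ := h0
    have : ∏ i, A.sylvester B d e (σ i) i = 0 := Finset.prod_eq_zero (Finset.mem_univ i) hi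
    simp [this]

theorem resultant_mul_right_of_natDegree_le {R : Type*} [CommRing R] (f g₁ g₂ : R[X])
    {m n₁ n₂ : ℕ} (hf : f.natDegree ≤ m) (h₁ : g₁.natDegree ≤ n₁) (h₂ : g₂.natDegree ≤ n₂) :
    f.resultant (g₁ * g₂) m (n₁ + n₂) = f.resultant g₁ m n₁ * f.resultant g₂ m n₂ := by
  obtain ⟨k₁, rfl⟩ := Nat.exists_eq_add_of_le h₁
  obtain ⟨k₂, rfl⟩ := Nat.exists_eq_add_of_le h₂
  rw [add_add_add_comm, resultant_add_right_deg _ _ _ _ _ natDegree_mul_le,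
    resultant_add_right_deg _ _ _ _ _ le_rfl, resultant_add_right_deg _ _ _ _ _ le_rfl,
    resultant_mul_right _ _ _ _ hf]
  ring

theorem resultant_derivative_mul {R : Type*} [CommRing R] (f g : R[X]) {m n : ℕ}
    (hm : 0 < m) (hn : 0 < n) (hf : f.natDegree ≤ m) (hg : g.natDegree ≤ n) :
    f.resultant (derivative (f * g)) m (m + n - 1) =
      f.resultant (derivative f) m (m - 1) * f.resultant g m n := by
  have hg' : (derivative g).natDegree ≤ n - 1 :=
    (natDegree_derivative_le _).trans (Nat.sub_le_sub_right hg 1)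
  have hf' : (derivative f).natDegree ≤ m - 1 :=
    (natDegree_derivative_le _).trans (Nat.sub_le_sub_right hf 1)
  rw [derivative_mul, resultant_add_mul_right _ _ _ _ _ (by lia) hf,
    show m + n - 1 = m - 1 + n by lia, resultant_mul_right_of_natDegree_le f _ _ hf hf' hg]

variable {K : Type*} [Field K]

theorem rootMultiplicity_sub_C_eval_le_two (F : K[X]) (hsep : (derivative F).Separable)
    (hF : 0 < F.natDegree) (v x : K) : (F - C v).rootMultiplicity x ≤ 2 := by
  have hne : F - C v ≠ 0 := fun h ↦ by
    have := natDegree_sub_C (p := F) (a := v)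
    simp only [h, natDegree_zero] at this
    lia
  by_contra! h
  have h1 := pow_sub_one_dvd_derivative_of_pow_dvd ((le_rootMultiplicity_iff hne).1 h)
  rw [derivative_sub, derivative_C, sub_zero, ← le_rootMultiplicity_iff hsep.ne_zero] at h1
  exact absurd (h1.trans (rootMultiplicity_le_one_of_separable hsep x)) (by norm_num)

theorem count_roots_prod_sub_le (F : K[X]) (hsep : (derivative F).Separable)
    (hF : 0 < F.natDegree) [DecidableEq K] (s : Multiset K) (x : K) :
    (s.map fun η ↦ F - C (F.eval η)).prod.roots.count x ≤
      2 * (s.filter fun η ↦ F.eval η = F.eval x).card := by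
  have hne : ∀ v, F - C v ≠ 0 := fun v h ↦ by
    have := natDegree_sub_C (p := F) (a := v)
    rw [h] at this
    simp at this
    lia
  induction s using Multiset.induction_on with
  | empty => simp
  | cons a s ih =>
    have h0 : (s.map fun η ↦ F - C (F.eval η)).prod ≠ 0 := by
      simp [Multiset.prod_eq_zero_iff, hne]
    rw [Multiset.map_cons, Multiset.prod_cons, roots_mul (mul_ne_zero (hne _) h0),
      Multiset.count_add, count_roots]
    by_cases ha : F.eval a = F.eval x
    · rw [Multiset.filter_cons_of_pos (p := fun η ↦ F.eval η = F.eval x) _ ha, Multiset.card_cons]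
      have := rootMultiplicity_sub_C_eval_le_two F hsep hF (F.eval a) x
      lia
    · rw [Multiset.filter_cons_of_neg (p := fun η ↦ F.eval η = F.eval x) _ ha,
        rootMultiplicity_eq_zero]
      · lia
      · exact fun h ↦ ha (sub_eq_zero.1 (by simpa [IsRoot] using h)).symm

theorem exists_common_root_of_eval_resultant_eq_zero [IsAlgClosed K] {A B : K[X][X]} {x : K}
    (hA : A.leadingCoeff.eval x ≠ 0) (hB : B.leadingCoeff.eval x ≠ 0)
    (h : (A.resultant B).eval x = 0) :
    ∃ y, (A.map (evalRingHom x)).eval y = 0 ∧ (B.map (evalRingHom x)).eval y = 0 := by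
  have h1 : (A.map (evalRingHom x)).resultant (B.map (evalRingHom x)) = 0 := by
    rw [natDegree_map_of_leadingCoeff_ne_zero _ (by simpa using hA),
      natDegree_map_of_leadingCoeff_ne_zero _ (by simpa using hB), resultant_map_map]
    simpa using h
  have h2 := (resultant_eq_zero_iff.1 h1).2
  contrapose! h2
  exact isCoprime_of_irreducible_dvd (by
    rintro ⟨h3, -⟩
    apply hA
    have := congr(($h3).coeff A.natDegree)
    simpa using this) fun z hz hzA hzB ↦ by
      obtain ⟨y, hy⟩ := IsAlgClosed.exists_root z (degree_pos_of_irreducible hz).ne'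
      exact h2 y (hy.dvd hzA) (hy.dvd hzB)

theorem derivative_eval_eq_zero_of_common_root {F : K[X]} {A B D : K[X][X]}
    (hF : C F - F.map C = D * (A * B)) {x y : K}
    (hA : (A.map (evalRingHom x)).eval y = 0) (hB : (B.map (evalRingHom x)).eval y = 0) :
    (derivative F).eval x = 0 := by
  have h := congr(((derivative (($hF).eval (C y))).eval x))
  have hA' : (A.eval (C y)).eval x = 0 := by
    rw [← hA, eval_map, eval₂_evalRingHom]
  have hB' : (B.eval (C y)).eval x = 0 := by
    rw [← hB, eval_map, eval₂_evalRingHom]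
  simpa [derivative_mul, hA', hB', eval_map, eval₂_at_apply] using h

theorem natDegree_C_sub_map_C (F : K[X]) (hF : 0 < F.natDegree) :
    (C F - F.map C).natDegree = F.natDegree := by
  rw [natDegree_sub_eq_right_of_natDegree_lt]
  · exact natDegree_map_eq_of_injective C_injective F
  · rw [natDegree_map_eq_of_injective C_injective F]
    simpa

theorem resultant_derivative_C_sub_map_C [IsAlgClosed K] (F : K[X]) {n : ℕ} (hn : 0 < n)
    (hF : F.natDegree = n) (hF' : (derivative F).natDegree = n - 1) (h0 : derivative F ≠ 0) :
    ∃ a : K, a ≠ 0 ∧ (C F - F.map C).resultant (derivative (C F - F.map C)) n (n - 1) =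
      C a * ((derivative F).roots.map fun η ↦ F - C (F.eval η)).prod := by
  have hinj : Function.Injective (C : K →+* K[X]) := C_injective
  have hd : derivative (C F - F.map C) = C (-1) * (derivative F).map C := by
    simp only [derivative_sub, derivative_C, derivative_map, C_neg, C_1, zero_sub]
    exact (neg_one_mul ((derivative F).map C)).symm
  have hs := IsAlgClosed.splits (derivative F)
  have h1 := resultant_eq_prod_eval ((derivative F).map C) (C F - F.map C) n
    ((natDegree_C_sub_map_C F (by lia)).trans hF).le (hs.map C)
  rw [natDegree_map_eq_of_injective hinj, hF'] at h1
  refine ⟨(-1) ^ n * ((-1) ^ (n * (n - 1)) * (derivative F).leadingCoeff ^ n), ?_, ?_⟩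
  · simp [h0]
  · rw [hd, resultant_C_mul_right, resultant_comm, h1, hs.roots_map]
    simp [leadingCoeff_map_of_injective hinj, eval_map, eval₂_at_apply, mul_assoc]

theorem false_of_factorization_of_critical_values [IsAlgClosed K] (F : K[X]) {n : ℕ} (hn : 2 ≤ n)
    (hF : F.natDegree = n) (hF' : (derivative F).natDegree = n - 1)
    (hsep : (derivative F).Separable) [DecidableEq K]
    (hcrit : ∀ x, (derivative F).eval x = 0 →
      4 * ((derivative F).roots.filter fun η ↦ F.eval η = F.eval x).card ≤ n)
    {ι : Type*} [Fintype ι] (B : ι → K[X][X])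
    (hB : ∀ i j, ((B i).coeff j) ≠ 0 → ((B i).coeff j).natDegree + j ≤ (B i).natDegree)
    (hB1 : ∀ i, 0 < (B i).natDegree) (hB2 : ∀ i, 2 * (B i).natDegree ≤ n)
    {c : K} (hc : c ≠ 0) (hf : C F - F.map C = C (C c) * ∏ i, B i) : False := by
  classical
  have hF'0 : derivative F ≠ 0 := hsep.ne_zero
  have hB0 : ∀ i, B i ≠ 0 := fun i h ↦ by simpa [h] using hB1 i
  have hlc : ∀ i, ∃ a : K, a ≠ 0 ∧ (B i).leadingCoeff = C a := by
    intro i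
    have h1 := hB i _ (leadingCoeff_ne_zero.2 (hB0 i))
    have h2 : ((B i).leadingCoeff).natDegree = 0 := by rw [leadingCoeff]; lia
    obtain ⟨a, ha⟩ := natDegree_eq_zero.1 h2
    refine ⟨a, ?_, ha.symm⟩
    rintro rfl
    exact leadingCoeff_ne_zero.2 (hB0 i) (by simp [← ha])
  have hsum : ∑ i, (B i).natDegree = n := by
    rw [← natDegree_prod _ _ fun i _ ↦ hB0 i, ← hF, ← natDegree_C_sub_map_C F (by lia), hf,
      natDegree_C_mul (by simpa using hc)]
  let q : ι → K[X][X] := fun i ↦ ∏ j ∈ Finset.univ.erase i, B j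
  have hq : ∀ i, B i * q i = ∏ j, B j := fun i ↦ Finset.mul_prod_erase _ _ (Finset.mem_univ i)
  have hq0 : ∀ i, q i ≠ 0 := fun i ↦ Finset.prod_ne_zero_iff.2 fun j _ ↦ hB0 j
  have hqd : ∀ i, (B i).natDegree + (q i).natDegree = n := fun i ↦ by
    rw [← natDegree_mul (hB0 i) (hq0 i), hq, natDegree_prod _ _ fun i _ ↦ hB0 i, hsum]
  have hqlc : ∀ i x, ((q i).leadingCoeff).eval x ≠ 0 := by
    intro i x
    rw [leadingCoeff_prod, eval_prod]
    refine Finset.prod_ne_zero_iff.2 fun j _ ↦ ?_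
    obtain ⟨a, ha, h⟩ := hlc j
    simpa [h] using ha
  set T : K[X] := ∏ i, (B i).resultant (q i) with hT
  set U : K[X] := ∏ i, (B i).resultant (derivative (B i)) (B i).natDegree ((B i).natDegree - 1)
    with hU
  set E : K[X] := ((derivative F).roots.map fun η ↦ F - C (F.eval η)).prod with hE
  obtain ⟨a, ha, hTU⟩ : ∃ a : K, a ≠ 0 ∧ C a * (U * T) = E := by
    obtain ⟨b, hb, h⟩ := resultant_derivative_C_sub_map_C F (by lia) hF hF' hF'0
    have hPd : (derivative (∏ i, B i)).natDegree ≤ n - 1 := by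
      refine (natDegree_derivative_le _).trans ?_
      rw [natDegree_prod _ _ fun i _ ↦ hB0 i, hsum]
    have h2 : (∏ i, B i).resultant (derivative (∏ i, B i)) n (n - 1) = U * T := by
      have := resultant_prod_left Finset.univ B (derivative (∏ i, B i)) (n - 1)
        (Finset.prod_ne_zero_iff.2 fun i _ ↦ leadingCoeff_ne_zero.2 (hB0 i)) hPd
      rw [natDegree_prod _ _ fun i _ ↦ hB0 i, hsum] at this
      rw [this, hU, hT, ← Finset.prod_mul_distrib]
      refine Finset.prod_congr rfl fun i _ ↦ ?_
      have h3 := hqd i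
      have h4 := hB2 i
      rw [← resultant_derivative_mul (B i) (q i) (hB1 i) (by lia) le_rfl le_rfl, hq, h3]
    rw [hf, derivative_C_mul, resultant_C_mul_left, resultant_C_mul_right, h2] at h
    refine ⟨b⁻¹ * (c ^ (n - 1) * c ^ n), by simp [hb, hc], ?_⟩
    have hbb : C b⁻¹ * C b = 1 := by rw [← C_mul, inv_mul_cancel₀ hb, C_1]
    calc _ = C b⁻¹ * (C c ^ (n - 1) * (C c ^ n * (U * T))) := by simp [mul_assoc]
      _ = E := by rw [h, ← mul_assoc, hbb, one_mul]
  have hne : ∀ v, F - C v ≠ 0 := fun v h ↦ by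
    have := natDegree_sub_C (p := F) (a := v)
    rw [h] at this
    simp at this
    lia
  have hE0 : E ≠ 0 := by
    rw [hE]
    simp [Multiset.prod_eq_zero_iff, hne]
  have hUT0 : U * T ≠ 0 := fun h ↦ hE0 (by simpa [h] using hTU.symm)
  have hT0 : T ≠ 0 := right_ne_zero_of_mul hUT0
  have hU0 : U ≠ 0 := left_ne_zero_of_mul hUT0
  have hEd : E.natDegree = (n - 1) * n := by
    rw [hE, natDegree_multiset_prod _ (by simp [hne])]
    simp [hF, ← hF', IsAlgClosed.card_roots_eq_natDegree]
  have hUd : 2 * U.natDegree ≤ n * (n - 2) := by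
    have h1 : U.natDegree ≤ ∑ i, (B i).natDegree * ((B i).natDegree - 1) := by
      refine (natDegree_prod_le _ _).trans (Finset.sum_le_sum fun i _ ↦ ?_)
      refine natDegree_resultant_le _ _ _ _ (hB i) fun j hj ↦ ?_
      rw [coeff_derivative] at hj ⊢
      have h2 := hB i _ (left_ne_zero_of_mul hj)
      have h3 : ((B i).coeff (j + 1) * ((j : K[X]) + 1)).natDegree ≤
          ((B i).coeff (j + 1)).natDegree := by
        have := natDegree_mul_C_le ((B i).coeff (j + 1)) ((j : K) + 1)
        simpa using this
      lia
    calc 2 * U.natDegree ≤ ∑ i, 2 * ((B i).natDegree * ((B i).natDegree - 1)) := by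
          rw [← Finset.mul_sum]; lia
      _ ≤ ∑ i, (B i).natDegree * (n - 2) := Finset.sum_le_sum fun i _ ↦ by
          have := hB2 i
          rw [mul_left_comm]
          exact Nat.mul_le_mul_left _ (by lia)
      _ = n * (n - 2) := by rw [← Finset.sum_mul, hsum]
  have hTd : 2 * T.natDegree ≤ (n - 1) * n := by
    have hsub : T.roots.toFinset ⊆ (derivative F).roots.toFinset := by
      intro x hx
      rw [Multiset.mem_toFinset, mem_roots hT0, IsRoot, eval_prod, Finset.prod_eq_zero_iff] at hx
      obtain ⟨i, -, hi⟩ := hx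
      obtain ⟨b, hb, hbi⟩ := hlc i
      obtain ⟨y, hy1, hy2⟩ := exists_common_root_of_eval_resultant_eq_zero
        (by simpa [hbi] using hb) (hqlc i x) hi
      rw [Multiset.mem_toFinset, mem_roots hF'0]
      exact derivative_eval_eq_zero_of_common_root (D := C (C c)) (by rw [hf, hq]) hy1 hy2
    have hcount : ∀ x ∈ (derivative F).roots.toFinset, 2 * T.roots.count x ≤ n := by
      intro x hx
      rw [Multiset.mem_toFinset, mem_roots hF'0] at hx
      have h1 := hcrit x hx
      have h2 := count_roots_prod_sub_le F hsep (by lia) (derivative F).roots x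
      have h3 : T.roots.count x ≤ E.roots.count x :=
        Multiset.count_le_of_le x (roots.le_of_dvd hE0 ⟨C a * U, by rw [← hTU]; ring⟩)
      lia
    calc 2 * T.natDegree = ∑ x ∈ T.roots.toFinset, 2 * T.roots.count x := by
          rw [← Finset.mul_sum, Multiset.toFinset_sum_count_eq, IsAlgClosed.card_roots_eq_natDegree]
      _ ≤ ∑ x ∈ (derivative F).roots.toFinset, 2 * T.roots.count x :=
          Finset.sum_le_sum_of_subset hsub
      _ ≤ (derivative F).roots.toFinset.card * n := Finset.sum_le_card_nsmul _ _ _ hcount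
      _ ≤ (n - 1) * n := by
          refine Nat.mul_le_mul_right _ ?_
          rw [← hF']
          exact (Multiset.toFinset_card_le _).trans (card_roots' _)
  have hdeg : U.natDegree + T.natDegree = (n - 1) * n := by
    rw [← natDegree_mul hU0 hT0, ← hEd, ← hTU, natDegree_C_mul ha]
  obtain ⟨m, rfl⟩ := Nat.exists_eq_add_of_le hn
  simp only [show 2 + m - 1 = m + 1 by lia, show 2 + m - 2 = m by lia] at hdeg hTd hUd
  nlinarith

/-- Read a polynomial in two variables as a polynomial in the first variable with coefficients
that are polynomials in the second. -/
noncomputable def toBivariate (K : Type*) [CommRing K] : MvPolynomial (Fin 2) K →+* K[X][X] :=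
  (mapRingHom (MvPolynomial.aeval fun _ : Fin 1 ↦ (X : K[X])).toRingHom).comp
    (MvPolynomial.finSuccEquiv K 1).toRingEquiv.toRingHom

theorem toBivariate_C (c : K) : toBivariate K (MvPolynomial.C c) = C (C c) := by
  simp [toBivariate, MvPolynomial.finSuccEquiv_apply]

theorem toBivariate_X_zero : toBivariate K (MvPolynomial.X 0) = X := by
  simp [toBivariate, MvPolynomial.finSuccEquiv_apply]

theorem toBivariate_X_one : toBivariate K (MvPolynomial.X 1) = C X := by
  have := MvPolynomial.finSuccEquiv_X_succ (R := K) (n := 1) (j := 0)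
  simp only [Fin.succ_zero_eq_one] at this
  simp [toBivariate, this]

theorem toBivariate_aeval_X_zero (F : K[X]) :
    toBivariate K (aeval (MvPolynomial.X 0) F) = F.map C := by
  induction F using Polynomial.induction_on' with
  | add p q hp hq => simp only [map_add, hp, hq, Polynomial.map_add]
  | monomial n a =>
    rw [aeval_monomial, map_mul, ← MvPolynomial.C_eq_algebraMap, toBivariate_C, map_pow,
      toBivariate_X_zero, map_monomial, C_mul_X_pow_eq_monomial]

theorem toBivariate_aeval_X_one (F : K[X]) :
    toBivariate K (aeval (MvPolynomial.X 1) F) = C F := by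
  induction F using Polynomial.induction_on' with
  | add p q hp hq => simp only [map_add, hp, hq]
  | monomial n a =>
    rw [aeval_monomial, map_mul, ← MvPolynomial.C_eq_algebraMap, toBivariate_C, map_pow,
      toBivariate_X_one, ← C_pow, ← C_mul, C_mul_X_pow_eq_monomial]

theorem natDegree_coeff_toBivariate_add_le (h : MvPolynomial (Fin 2) K) (j : ℕ)
    (hj : (toBivariate K h).coeff j ≠ 0) :
    ((toBivariate K h).coeff j).natDegree + j ≤ h.totalDegree := by
  have hco : (toBivariate K h).coeff j = MvPolynomial.aeval (fun _ : Fin 1 ↦ (X : K[X]))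
      ((MvPolynomial.finSuccEquiv K 1 h).coeff j) := by
    simp [toBivariate]
  rw [hco] at hj ⊢
  have h1 := MvPolynomial.totalDegree_coeff_finSuccEquiv_add_le h j fun h0 ↦ hj (by simp [h0])
  have h2 := MvPolynomial.aeval_natDegree_le ((MvPolynomial.finSuccEquiv K 1 h).coeff j) le_rfl
    (fun _ : Fin 1 ↦ (X : K[X])) fun _ ↦ natDegree_X_le
  lia

theorem natDegree_toBivariate_le (h : MvPolynomial (Fin 2) K) :
    (toBivariate K h).natDegree ≤ h.totalDegree := by
  rw [natDegree_le_iff_coeff_eq_zero]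
  intro j hj
  by_contra h0
  have := natDegree_coeff_toBivariate_add_le h j h0
  lia

theorem totalDegree_aeval_X_le (F : K[X]) {σ : Type*} (i : σ) :
    (aeval (MvPolynomial.X i : MvPolynomial σ K) F).totalDegree ≤ F.natDegree := by
  rw [aeval_eq_sum_range]
  refine MvPolynomial.totalDegree_finsetSum_le fun j hj ↦ ?_
  refine (MvPolynomial.totalDegree_smul_le _ _).trans ?_
  rw [MvPolynomial.totalDegree_X_pow]
  simpa [Nat.lt_succ_iff] using hj

theorem MvPolynomial.totalDegree_prod_of_isDomain {R σ ι : Type*} [CommRing R] [IsDomain R]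
    (s : Finset ι) (h : ι → MvPolynomial σ R) (h0 : ∀ i ∈ s, h i ≠ 0) :
    (∏ i ∈ s, h i).totalDegree = ∑ i ∈ s, (h i).totalDegree := by
  classical
  induction s using Finset.induction_on with
  | empty => simp
  | insert a s ha ih =>
    rw [Finset.prod_insert ha, Finset.sum_insert ha, totalDegree_mul_of_isDomain
      (h0 a (Finset.mem_insert_self a s)) (Finset.prod_ne_zero_iff.2 fun i hi ↦
        h0 i (Finset.mem_insert_of_mem hi)), ih fun i hi ↦ h0 i (Finset.mem_insert_of_mem hi)]

theorem MvPolynomial.totalDegree_pos_of_irreducible {σ : Type*} {h : MvPolynomial σ K}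
    (hh : Irreducible h) : 0 < h.totalDegree := by
  by_contra! h0
  have hC := totalDegree_eq_zero_iff_eq_C.1 (Nat.le_zero.1 h0)
  refine hh.not_isUnit (isUnit_iff_totalDegree_of_isReduced.2 ⟨?_, Nat.le_zero.1 h0⟩)
  exact isUnit_iff_ne_zero.2 fun h1 ↦ hh.ne_zero (by rw [hC, h1, C_0])

theorem exists_irreducible_dvd_of_critical_values [IsAlgClosed K] (F : K[X]) {n : ℕ} (hn : 2 ≤ n)
    (hF : F.natDegree = n) (hF' : (derivative F).natDegree = n - 1)
    (hsep : (derivative F).Separable) [DecidableEq K]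
    (hcrit : ∀ x, (derivative F).eval x = 0 →
      4 * ((derivative F).roots.filter fun η ↦ F.eval η = F.eval x).card ≤ n) :
    ∃ h : MvPolynomial (Fin 2) K, Irreducible h ∧
      h ∣ aeval (MvPolynomial.X 0) F - aeval (MvPolynomial.X 1) F ∧ n < 2 * h.totalDegree := by
  by_contra! hcon
  set f : MvPolynomial (Fin 2) K := aeval (MvPolynomial.X 0) F - aeval (MvPolynomial.X 1) F with hf
  have hΦf : toBivariate K f = -(C F - F.map C) := by
    rw [hf, map_sub, toBivariate_aeval_X_zero, toBivariate_aeval_X_one, neg_sub]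
  have hΦd : (toBivariate K f).natDegree = n := by
    rw [hΦf, natDegree_neg, natDegree_C_sub_map_C F (by lia), hF]
  have hΦ0 : toBivariate K f ≠ 0 := fun h ↦ by simp [h] at hΦd; lia
  have hf0 : f ≠ 0 := fun h ↦ hΦ0 (by simp [h])
  have hfd : f.totalDegree ≤ n :=
    (MvPolynomial.totalDegree_sub _ _).trans <| max_le ((totalDegree_aeval_X_le F _).trans hF.le)
      ((totalDegree_aeval_X_le F _).trans hF.le)
  obtain ⟨s, hs, u, hu⟩ := WfDvdMonoid.exists_factors f hf0
  obtain ⟨l, rfl⟩ : ∃ l : List (MvPolynomial (Fin 2) K), (l : Multiset _) = s :=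
    ⟨s.toList, s.coe_toList⟩
  have hirr : ∀ i : Fin l.length, Irreducible (l.get i) := fun i ↦ hs _ (List.get_mem l i)
  obtain ⟨c, hc, hcu⟩ := MvPolynomial.isUnit_iff_eq_C_of_isReduced.1 u.isUnit
  have hprod : f = MvPolynomial.C c * ∏ i, l.get i := by
    rw [← hu, ← hcu, Multiset.prod_coe, mul_comm, ← List.prod_ofFn, List.ofFn_get]
  have hΦ : toBivariate K f = C (C c) * ∏ i, toBivariate K (l.get i) := by
    rw [hprod, map_mul, toBivariate_C, map_prod]
  have hΦi : ∀ i, toBivariate K (l.get i) ≠ 0 := by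
    have := right_ne_zero_of_mul (hΦ ▸ hΦ0)
    exact fun i ↦ Finset.prod_ne_zero_iff.1 this i (Finset.mem_univ i)
  have hsumT : ∑ i, (l.get i).totalDegree ≤ n := by
    rw [← MvPolynomial.totalDegree_prod_of_isDomain _ _ fun i _ ↦ (hirr i).ne_zero]
    exact (MvPolynomial.totalDegree_le_of_dvd_of_isDomain ⟨_, by rw [hprod, mul_comm]⟩ hf0).trans
      hfd
  have hsumN : ∑ i, (toBivariate K (l.get i)).natDegree = n := by
    rw [← natDegree_prod _ _ fun i _ ↦ hΦi i, ← hΦd, hΦ,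
      natDegree_C_mul (by simpa using hc.ne_zero)]
  have hdeg : ∀ i, (toBivariate K (l.get i)).natDegree = (l.get i).totalDegree := by
    have h1 := Finset.sum_le_sum fun i (_ : i ∈ Finset.univ) ↦ natDegree_toBivariate_le (l.get i)
    have h2 := (Finset.sum_eq_sum_iff_of_le fun i (_ : i ∈ Finset.univ) ↦
      natDegree_toBivariate_le (l.get i)).1 (le_antisymm h1 (by rw [hsumN]; exact hsumT))
    exact fun i ↦ h2 i (Finset.mem_univ i)
  refine false_of_factorization_of_critical_values F hn hF hF' hsep hcrit
    (fun i ↦ toBivariate K (l.get i)) (fun i j hj ↦ ?_) (fun i ↦ ?_) (fun i ↦ ?_)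
    (neg_ne_zero.2 hc.ne_zero) (c := -c) ?_
  · exact (natDegree_coeff_toBivariate_add_le _ j hj).trans (hdeg i).ge
  · rw [hdeg]
    exact MvPolynomial.totalDegree_pos_of_irreducible (hirr i)
  · rw [hdeg]
    exact hcon _ (hirr i) ((Finset.dvd_prod_of_mem _ (Finset.mem_univ i)).trans
      ⟨_, by rw [hprod, mul_comm]⟩)
  · rw [← neg_neg (C F - F.map C), ← hΦf, hΦ, C_neg, C_neg]
    exact (neg_mul (C (C c)) _).symm

theorem exists_algebraMap_eq_of_pow_eq_self (p : ℕ) [Fact p.Prime] [Algebra (ZMod p) K] {x : K}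
    (hx : x ^ p = x) : ∃ c : ZMod p, algebraMap (ZMod p) K c = x := by
  have : CharP K p := charP_of_injective_algebraMap (algebraMap (ZMod p) K).injective p
  have h := (Subfield.mem_bot_iff_pow_eq_self (F := K) (p := p)).2 hx
  rw [← ZMod.fieldRange_castHom_eq_bot p] at h
  obtain ⟨c, hc⟩ := h
  exact ⟨c, by rw [← hc]; congr 1; exact Subsingleton.elim _ _⟩

open MvPolynomial in
theorem MvPolynomial.exists_map_eq_of_map_frobenius_eq_self (p : ℕ) [Fact p.Prime]
    [Algebra (ZMod p) K] [ExpChar K p] {σ : Type*} {h : MvPolynomial σ K}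
    (hh : map (frobenius K p) h = h) :
    ∃ h₀ : MvPolynomial σ (ZMod p), map (algebraMap (ZMod p) K) h₀ = h := by
  refine mem_range_map_iff_coeffs_subset.2 fun x hx ↦ ?_
  obtain ⟨m, -, rfl⟩ := mem_coeffs_iff.1 (Finset.mem_coe.1 hx)
  refine exists_algebraMap_eq_of_pow_eq_self p ?_
  have := congr(coeff m $hh)
  rwa [coeff_map, frobenius_def] at this

open MvPolynomial in
theorem MvPolynomial.two_mul_totalDegree_le_or_exists_map_dvd (p : ℕ) [Fact p.Prime]
    [Algebra (ZMod p) K] [ExpChar K p] [PerfectRing K p] {σ : Type*} {g : MvPolynomial σ (ZMod p)}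
    (hg : g ≠ 0) {h : MvPolynomial σ K} (hh : Irreducible h)
    (hd : h ∣ map (algebraMap (ZMod p) K) g) :
    2 * h.totalDegree ≤ (map (algebraMap (ZMod p) K) g).totalDegree ∨
      ∃ h₀ : MvPolynomial σ (ZMod p), h₀ ∣ g ∧
        Irreducible (map (algebraMap (ZMod p) K) h₀) := by
  have hinj := map_injective (σ := σ) _ (algebraMap (ZMod p) K).injective
  have hg' : map (algebraMap (ZMod p) K) g ≠ 0 := (map_ne_zero_iff _ hinj).2 hg
  have hfix : ∀ r : MvPolynomial σ (ZMod p), map (frobenius K p) (map (algebraMap (ZMod p) K) r) =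
      map (algebraMap (ZMod p) K) r := by
    intro r
    rw [map_map]
    congr 1
    exact congrArg _ (Subsingleton.elim _ _)
  obtain ⟨m, hm⟩ := exists_coeff_ne_zero hh.ne_zero
  wlog hm1 : coeff m h = 1 generalizing h
  · have hu : IsUnit (C (coeff m h)⁻¹ : MvPolynomial σ K) :=
      (isUnit_iff_ne_zero.2 (inv_ne_zero hm)).map C
    have hass : Associated h (C (coeff m h)⁻¹ * h) := ⟨hu.unit, mul_comm _ _⟩
    have hc : coeff m (C (coeff m h)⁻¹ * h) = 1 := by rw [coeff_C_mul, inv_mul_cancel₀ hm]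
    have := this (hass.irreducible hh) (hass.symm.dvd.trans hd) (by rw [hc]; exact one_ne_zero) hc
    rwa [totalDegree_mul_of_isDomain hu.ne_zero hh.ne_zero, totalDegree_C, zero_add] at this
  have hirr : Irreducible (map (frobenius K p) h) :=
    (MulEquiv.irreducible_iff (mapEquiv σ (frobeniusEquiv K p))).2 hh
  have hdvd : map (frobenius K p) h ∣ map (algebraMap (ZMod p) K) g := by
    rw [← hfix g]
    exact map_dvd _ hd
  have hT : (map (frobenius K p) h).totalDegree = h.totalDegree := by
    rw [totalDegree, totalDegree, support_map_of_injective _ (frobenius K p).injective]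
  by_cases hass : Associated h (map (frobenius K p) h)
  · right
    obtain ⟨u, hu⟩ := hass
    obtain ⟨c, -, hc⟩ := isUnit_iff_eq_C_of_isReduced.1 u.isUnit
    have hself : map (frobenius K p) h = h := by
      have h1 := congr(coeff m $hu)
      rw [hc, mul_comm, coeff_C_mul, coeff_map, hm1, map_one, mul_one] at h1
      rw [← hu, hc, h1, C_1, mul_one]
    obtain ⟨h₀, rfl⟩ := exists_map_eq_of_map_frobenius_eq_self p hself
    refine ⟨h₀, ?_, hh⟩
    obtain ⟨q, hq⟩ := hd
    have hqself : map (frobenius K p) q = q := by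
      have h1 := congr(map (frobenius K p) $hq)
      rw [map_mul, hfix, hself, hq] at h1
      exact (mul_left_cancel₀ hh.ne_zero h1).symm
    obtain ⟨q₀, rfl⟩ := exists_map_eq_of_map_frobenius_eq_self p hqself
    exact ⟨q₀, hinj (by rw [hq, map_mul])⟩
  · left
    have hmul : h * map (frobenius K p) h ∣ map (algebraMap (ZMod p) K) g :=
      ((hh.isRelPrime_iff_not_dvd).2 fun hdv ↦ hass (hh.associated_of_dvd hirr hdv)).mul_dvd
        hd hdvd
    have := totalDegree_le_of_dvd_of_isDomain hmul hg'
    rw [totalDegree_mul_of_isDomain hh.ne_zero hirr.ne_zero, hT] at this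
    lia

theorem natDegree_X_add_one_pow_sub_X_pow {m : ℕ} (hm : (m : K) ≠ 0) :
    ((X + 1 : K[X]) ^ m - X ^ m).natDegree = m - 1 := by
  have hm0 : m ≠ 0 := by rintro rfl; simp at hm
  refine natDegree_eq_of_le_of_coeff_ne_zero ?_ ?_
  · rw [natDegree_le_iff_coeff_eq_zero]
    intro j hj
    rw [coeff_sub, coeff_X_add_one_pow, coeff_X_pow]
    split_ifs with h
    · simp [h]
    · rw [Nat.choose_eq_zero_of_lt (by lia)]; simp
  · rw [coeff_sub, coeff_X_add_one_pow, coeff_X_pow, if_neg (by lia),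
      Nat.choose_symm_of_eq_add (show m = (m - 1) + 1 by lia)]
    simpa using hm

theorem separable_X_add_one_pow_sub_X_pow {m : ℕ} (hm : (m : K) ≠ 0) :
    ((X + 1 : K[X]) ^ m - X ^ m).Separable := by
  obtain ⟨k, rfl⟩ := Nat.exists_eq_succ_of_ne_zero (show m ≠ 0 by rintro rfl; simp at hm)
  have hc : IsCoprime (X ^ k : K[X]) ((X + 1) ^ k) :=
    IsCoprime.pow ⟨-1, 1, by ring⟩
  obtain ⟨a, b, hab⟩ := hc
  have hm' : (C ((k.succ : K)⁻¹) : K[X]) * (k.succ : K[X]) = 1 := by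
    rw [← C_eq_natCast, ← C_mul, inv_mul_cancel₀ hm, C_1]
  refine ⟨a + b, -(a * (X + 1) + b * X) * C ((k.succ : K)⁻¹), ?_⟩
  have hd : derivative ((X + 1 : K[X]) ^ k.succ - X ^ k.succ) =
      (k.succ : K[X]) * ((X + 1) ^ k - X ^ k) := by
    simp [derivative_pow, mul_sub]
  rw [hd, mul_assoc, ← mul_assoc (C _), hm', one_mul, Nat.succ_eq_add_one]
  linear_combination hab

theorem derivative_X_add_one_pow_sub_X_pow (t : ℕ) :
    derivative ((X + 1 : K[X]) ^ t - X ^ t) = C (t : K) * ((X + 1) ^ (t - 1) - X ^ (t - 1)) := by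
  simp [derivative_pow, mul_sub]

theorem four_mul_card_critical_le (p : ℕ) [Fact p.Prime] [CharP K p] [DecidableEq K] {m : ℕ}
    (hm : Odd m) (R : Finset K) (hR : ∀ x, x ∈ R ↔ (x + 1) ^ m = x ^ m) {v : K}
    (hv1 : v ^ p ≠ v) (hv2 : v ^ p ≠ -v) (hv3 : v ≠ -v) (hp : Odd p) :
    4 * (R.filter fun x ↦ x ^ m = v).card ≤ R.card := by
  set A := R.filter fun x ↦ x ^ m = v with hA
  set A₂ := A ∪ A.image (fun x ↦ -1 - x) with hA₂
  set A₄ := A₂ ∪ A₂.image (frobenius K p) with hA₄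
  have hAmem : ∀ x ∈ A, x ∈ R ∧ x ^ m = v := fun x hx ↦ Finset.mem_filter.1 hx
  have hneg : ∀ x : K, (-1 - x) ^ m = -(x + 1) ^ m := fun x ↦ by
    rw [← hm.neg_pow]; congr 1; ring
  have hneg' : ∀ x : K, (-1 - x + 1) ^ m = -x ^ m := fun x ↦ by
    rw [← hm.neg_pow]; congr 1; ring
  have himg : ∀ x ∈ A.image (fun x ↦ -1 - x), x ∈ R ∧ x ^ m = -v := by
    intro x hx
    obtain ⟨y, hy, rfl⟩ := Finset.mem_image.1 hx
    obtain ⟨hyR, hyv⟩ := hAmem y hy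
    rw [hR] at hyR ⊢
    rw [hneg, hneg', hyR, hyv]
    exact ⟨rfl, rfl⟩
  have hA₂mem : ∀ x ∈ A₂, x ∈ R ∧ (x ^ m = v ∨ x ^ m = -v) := by
    intro x hx
    rcases Finset.mem_union.1 hx with h | h
    · exact ⟨(hAmem x h).1, .inl (hAmem x h).2⟩
    · exact ⟨(himg x h).1, .inr (himg x h).2⟩
  have himg₂ : ∀ x ∈ A₂.image (frobenius K p), x ∈ R ∧ (x ^ m = v ^ p ∨ x ^ m = -v ^ p) := by
    intro x hx
    obtain ⟨y, hy, rfl⟩ := Finset.mem_image.1 hx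
    obtain ⟨hyR, hyv⟩ := hA₂mem y hy
    rw [hR] at hyR ⊢
    rw [← map_one (frobenius K p), ← map_add, ← map_pow, ← map_pow, hyR, frobenius_def]
    refine ⟨rfl, hyv.imp (fun h ↦ by rw [h]) fun h ↦ by rw [h, hp.neg_pow]⟩
  have hcard₂ : A₂.card = 2 * A.card := by
    rw [hA₂, Finset.card_union_of_disjoint, Finset.card_image_of_injective, two_mul]
    · exact sub_right_injective
    · refine Finset.disjoint_left.2 fun x hx hx' ↦ hv3 ?_
      exact (hAmem x hx).2.symm.trans (himg x hx').2
  have hcard₄ : A₄.card = 2 * A₂.card := by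
    rw [hA₄, Finset.card_union_of_disjoint, Finset.card_image_of_injective, two_mul]
    · exact (frobenius K p).injective
    · refine Finset.disjoint_left.2 fun x hx hx' ↦ ?_
      rcases (hA₂mem x hx).2 with h | h <;> rcases (himg₂ x hx').2 with h' | h' <;>
        rw [h] at h'
      · exact hv1 h'.symm
      · exact hv2 (neg_eq_iff_eq_neg.1 h'.symm)
      · exact hv2 h'.symm
      · exact hv1 (neg_injective h'.symm)
  have hsub : A₄ ⊆ R := by
    intro x hx
    rcases Finset.mem_union.1 hx with h | h
    · exact (hA₂mem x h).1
    · exact (himg₂ x h).1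
  have := Finset.card_le_card hsub
  lia

/-- The critical values `x ^ m` of `(X + 1) ^ (m + 1) - X ^ (m + 1)` are the inverses of the
`(s - 1) ^ m` with `s` a nontrivial `m`-th root of unity. -/
theorem exists_root_of_unity_of_critical {m : ℕ} (hm : m ≠ 0) {x : K} (hx : (x + 1) ^ m = x ^ m) :
    ∃ s : K, s ^ m = 1 ∧ s ≠ 1 ∧ (s - 1) ^ m = (x ^ m)⁻¹ ∧ x ≠ 0 := by
  have hx0 : x ≠ 0 := by
    rintro rfl
    simp [hm] at hx
  refine ⟨(x + 1) / x, ?_, ?_, ?_, hx0⟩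
  · rw [div_pow, hx, div_self (pow_ne_zero _ hx0)]
  · rw [ne_eq, div_eq_one_iff_eq hx0]
    simp
  · rw [← inv_pow]
    congr 1
    field_simp
    ring

theorem four_mul_card_filter_roots_le [IsAlgClosed K] (p : ℕ) [Fact p.Prime] (hp2 : p ≠ 2)
    [Algebra (ZMod p) K] [CharP K p] [DecidableEq K] {t : ℕ} (ht : 3 ≤ t) (hte : Even t)
    (ht0 : (t : K) ≠ 0) (ht1 : ((t - 1 : ℕ) : K) ≠ 0)
    (hroots : ∀ s : K, s ^ (t - 1) = 1 → s ≠ 1 →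
      ((∀ c : ZMod p, (s - 1) ^ (t - 1) ≠ algebraMap (ZMod p) K c) ∧
        (s - 1) ^ ((t - 1) * (p - 1)) ≠ -1))
    (F : K[X]) (hF : F = (X + 1) ^ t - X ^ t) (x : K) (hx : (derivative F).eval x = 0) :
    4 * ((derivative F).roots.filter fun η ↦ F.eval η = F.eval x).card ≤ t - 1 := by
  obtain ⟨m, rfl⟩ : ∃ m, t = m + 1 := ⟨t - 1, by lia⟩
  simp only [Nat.add_sub_cancel] at ht1 hroots ⊢
  have hD : derivative F = C ((m + 1 : ℕ) : K) * ((X + 1) ^ m - X ^ m) := by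
    rw [hF, derivative_X_add_one_pow_sub_X_pow, Nat.add_sub_cancel]
  have hroot : (derivative F).roots = ((X + 1 : K[X]) ^ m - X ^ m).roots := by
    rw [hD, roots_C_mul _ ht0]
  have hsep := separable_X_add_one_pow_sub_X_pow ht1
  have hmem : ∀ y, y ∈ (derivative F).roots ↔ (y + 1) ^ m = y ^ m := by
    intro y
    rw [hroot, mem_roots hsep.ne_zero]
    simp [sub_eq_zero]
  have hval : ∀ y : K, (y + 1) ^ m = y ^ m → F.eval y = y ^ m := by
    intro y hy
    simp only [hF, eval_sub, eval_pow, eval_add, eval_X, eval_one]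
    rw [pow_succ, pow_succ, hy]
    ring
  have hx' : (x + 1) ^ m = x ^ m := by
    rw [← hmem, mem_roots (by rw [hD]; exact mul_ne_zero (C_ne_zero.2 ht0) hsep.ne_zero)]
    exact hx
  have hmodd : Odd m := by
    rw [Nat.even_add_one, Nat.not_even_iff_odd] at hte
    exact hte
  have hpodd : Odd p := (Fact.out : p.Prime).odd_of_ne_two hp2
  obtain ⟨s, hs1, hs, hsv, hx0⟩ := exists_root_of_unity_of_critical (by lia) hx'
  have hv0 : x ^ m ≠ 0 := pow_ne_zero _ hx0
  obtain ⟨hr1, hr2⟩ := hroots s hs1 hs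
  have hnodup : (derivative F).roots.Nodup := by
    rw [hroot]
    exact nodup_roots hsep
  have hcard := four_mul_card_critical_le p hmodd (derivative F).roots.toFinset
    (by simpa [Multiset.mem_toFinset] using hmem) (v := x ^ m) ?_ ?_ ?_ hpodd
  · have h1 : (derivative F).roots.toFinset.card ≤ m - 1 := by
      refine (Multiset.toFinset_card_le _).trans ?_
      rw [hroot, ← natDegree_X_add_one_pow_sub_X_pow ht1]
      exact card_roots' _
    have h2 : ((derivative F).roots.filter fun η ↦ F.eval η = F.eval x).card =
        ((derivative F).roots.toFinset.filter fun y ↦ y ^ m = x ^ m).card := by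
      rw [Finset.card_def, Finset.filter_val, Multiset.toFinset_val, hnodup.dedup]
      congr 1
      refine Multiset.filter_congr fun y hy ↦ ?_
      rw [hval y ((hmem y).1 hy), hval x hx']
    lia
  · intro h
    obtain ⟨c, hc⟩ := exists_algebraMap_eq_of_pow_eq_self p (x := (x ^ m)⁻¹)
      (by rw [inv_pow, h])
    exact hr1 c (by rw [hsv, hc])
  · intro h
    apply hr2
    have h1 : (x ^ m) ^ (p - 1) = -1 := by
      apply mul_right_cancel₀ hv0
      rw [← pow_succ, Nat.sub_add_cancel (Fact.out : p.Prime).one_le, h, neg_one_mul]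
    rw [pow_mul, hsv, inv_pow, h1, inv_neg, inv_one]
  · intro h
    have h2 : (2 : K) ≠ 0 := Ring.two_ne_zero (by rw [ringChar.eq K p]; exact hp2)
    rw [eq_neg_iff_add_eq_zero, ← two_mul] at h
    exact mul_ne_zero h2 hv0 h

theorem exists_irreducible_dvd_of_roots_condition [IsAlgClosed K] (p : ℕ) [Fact p.Prime]
    (hp2 : p ≠ 2) [Algebra (ZMod p) K] [CharP K p] {t : ℕ} (ht : 3 ≤ t) (hte : Even t)
    (ht0 : (t : K) ≠ 0) (ht1 : ((t - 1 : ℕ) : K) ≠ 0)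
    (hroots : ∀ s : K, s ^ (t - 1) = 1 → s ≠ 1 →
      ((∀ c : ZMod p, (s - 1) ^ (t - 1) ≠ algebraMap (ZMod p) K c) ∧
        (s - 1) ^ ((t - 1) * (p - 1)) ≠ -1)) :
    ∃ h : MvPolynomial (Fin 2) K, Irreducible h ∧
      h ∣ aeval (MvPolynomial.X 0) ((X + 1 : K[X]) ^ t - X ^ t) -
        aeval (MvPolynomial.X 1) ((X + 1 : K[X]) ^ t - X ^ t) ∧
      t - 1 < 2 * h.totalDegree := by
  classical
  have hsep := separable_X_add_one_pow_sub_X_pow ht1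
  have hD := derivative_X_add_one_pow_sub_X_pow (K := K) t
  refine exists_irreducible_dvd_of_critical_values _ (by lia)
    (natDegree_X_add_one_pow_sub_X_pow ht0) ?_ ?_
    (four_mul_card_filter_roots_le p hp2 ht hte ht0 ht1 hroots _ rfl)
  · rw [hD, natDegree_C_mul ht0, natDegree_X_add_one_pow_sub_X_pow ht1]
  · rw [hD]
    exact hsep.unit_mul (isUnit_C.2 (isUnit_iff_ne_zero.2 ht0))

theorem totalDegree_aeval_X_sub_aeval_X_le (F : K[X]) {σ : Type*} (i j : σ) :
    (aeval (MvPolynomial.X i : MvPolynomial σ K) F - aeval (MvPolynomial.X j) F).totalDegree ≤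
      F.natDegree :=
  (MvPolynomial.totalDegree_sub _ _).trans <|
    max_le (totalDegree_aeval_X_le F i) (totalDegree_aeval_X_le F j)

theorem aeval_X_zero_sub_aeval_X_one_ne_zero {F : K[X]} (hF : 0 < F.natDegree) :
    aeval (MvPolynomial.X 0 : MvPolynomial (Fin 2) K) F - aeval (MvPolynomial.X 1) F ≠ 0 := by
  intro h
  have h1 := congr((toBivariate K $h).natDegree)
  rw [map_sub, toBivariate_aeval_X_zero, toBivariate_aeval_X_one, map_zero, natDegree_zero,
    ← natDegree_neg, neg_sub, natDegree_C_sub_map_C F (by lia)] at h1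
  lia

open MvPolynomial in
theorem MvPolynomial.totalDegree_X_sub_X_le {R σ : Type*} [CommRing R] [Nontrivial R]
    (i j : σ) :
    (X i - X j : MvPolynomial σ R).totalDegree ≤ 1 :=
  (totalDegree_sub _ _).trans (max_le (totalDegree_X i).le (totalDegree_X j).le)

end

open MvPolynomial

noncomputable section

/-- Case (A), condition (c): if `t` is even and for every `(t-1)`-th root of
unity `s ≠ 1` in the algebraic closure one has `(s-1)^{t-1} ∉ F_p` and
`(s-1)^{(t-1)(p-1)} ≠ -1`, then `g_t` has an absolutely irreducible factor
over `F_p`. -/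
theorem gt_has_abs_irred_factor_of_roots_condition
    (p t : ℕ) [Fact p.Prime] (hp2 : p ≠ 2) (ht : 3 ≤ t) (hpt : ¬ p ∣ t)
    (g : MvPolynomial (Fin 2) (ZMod p))
    (hg : ((X 0 + 1) ^ t - X 0 ^ t - (X 1 + 1) ^ t + X 1 ^ t : MvPolynomial (Fin 2) (ZMod p))
        = (X 0 - X 1) * g)
    (hte : Even t) (h0 : t % p ≠ 0) (h1 : t % p ≠ 1)
    (hroots : ∀ s : AlgebraicClosure (ZMod p), s ^ (t - 1) = 1 → s ≠ 1 →
      ((∀ c : ZMod p, (s - 1) ^ (t - 1) ≠ algebraMap (ZMod p) (AlgebraicClosure (ZMod p)) c) ∧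
        (s - 1) ^ ((t - 1) * (p - 1)) ≠ -1)) :
    ∃ h : MvPolynomial (Fin 2) (ZMod p), 0 < h.totalDegree ∧ h ∣ g ∧
      Irreducible (MvPolynomial.map (algebraMap (ZMod p) (AlgebraicClosure (ZMod p))) h) := by
  have hinj := (algebraMap (ZMod p) (AlgebraicClosure (ZMod p))).injective
  have : CharP (AlgebraicClosure (ZMod p)) p := charP_of_injective_algebraMap hinj p
  have : PerfectRing (AlgebraicClosure (ZMod p)) p := PerfectField.toPerfectRing p
  have ht0 : (t : AlgebraicClosure (ZMod p)) ≠ 0 := by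
    rwa [ne_eq, CharP.cast_eq_zero_iff _ p]
  have ht1 : ((t - 1 : ℕ) : AlgebraicClosure (ZMod p)) ≠ 0 := by
    rw [ne_eq, CharP.cast_eq_zero_iff _ p]
    rintro ⟨k, hk⟩
    apply h1
    rw [show t = 1 + p * k by lia, Nat.add_mul_mod_self_left,
      Nat.mod_eq_of_lt (Fact.out : p.Prime).one_lt]
  obtain ⟨h, hh, hd, hlt⟩ :=
    exists_irreducible_dvd_of_roots_condition p hp2 ht hte ht0 ht1 hroots
  have hdeg := natDegree_X_add_one_pow_sub_X_pow ht0
  have hne := aeval_X_zero_sub_aeval_X_one_ne_zero (by rw [hdeg]; lia)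
  have hle := totalDegree_aeval_X_sub_aeval_X_le
    ((Polynomial.X + 1) ^ t - Polynomial.X ^ t : Polynomial (AlgebraicClosure (ZMod p)))
    (0 : Fin 2) 1
  have hfg : Polynomial.aeval (X 0 : MvPolynomial (Fin 2) (AlgebraicClosure (ZMod p)))
        ((Polynomial.X + 1 : Polynomial (AlgebraicClosure (ZMod p))) ^ t - Polynomial.X ^ t) -
      Polynomial.aeval (X 1)
        ((Polynomial.X + 1 : Polynomial (AlgebraicClosure (ZMod p))) ^ t - Polynomial.X ^ t) =
      (X 0 - X 1) * map (algebraMap (ZMod p) (AlgebraicClosure (ZMod p))) g := by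
    have := congr(map (algebraMap (ZMod p) (AlgebraicClosure (ZMod p))) $hg)
    simp only [map_add, map_sub, map_mul, map_pow, map_X, map_one, Polynomial.aeval_X] at this ⊢
    rw [← this]
    ring
  rw [hfg] at hd hne hle
  obtain ⟨hX, hg0⟩ := mul_ne_zero_iff.1 hne
  have hd' : h ∣ map (algebraMap (ZMod p) (AlgebraicClosure (ZMod p))) g := by
    refine (hh.prime.dvd_or_dvd hd).resolve_left fun hdX ↦ ?_
    have h2 := totalDegree_le_of_dvd_of_isDomain hdX hX
    have h3 := totalDegree_X_sub_X_le (R := AlgebraicClosure (ZMod p)) (0 : Fin 2) 1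
    lia
  rcases two_mul_totalDegree_le_or_exists_map_dvd p (ne_zero_of_map hg0) hh hd' with
    hT | ⟨h₀, hdvd, hirr⟩
  · rw [totalDegree_mul_of_isDomain hX hg0, hdeg] at hle
    lia
  · refine ⟨h₀, ?_, hdvd, hirr⟩
    have := totalDegree_pos_of_irreducible hirr
    rwa [totalDegree, support_map_of_injective _ hinj] at this
end
end
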